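/- Suppose there exists c₀ > 0 such that for every λ > 0 and every Neumann eigenfunction φ of Ω with eigenvalue λ² one has the Cauchy-data bound (∫₀^L ⟨∇φ(c(s)), n(s)⟩² ds)^{1/2} ≤ e^{c₀λ} · (∫₀^L φ(c(s))² ds)^{1/2}. Then the curve C is good: there exists a > 0 such that for every λ > 0 and every Neumann eigenfunction φ of Ω with eigenvalue λ², ∫₀^ℓ φ(q(s))² ds ≤ e^{2aλ} · ∫₀^L φ(c(s))² ds. -/

import Mathlib

open MeasureTheory Real
open scoped RealInnerProductSpace

noncomputable section

abbrev E2 : Type := EuclideanSpace ℝ (Fin 2)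

/-- The Euclidean Laplacian `∂²/∂x₁² + ∂²/∂x₂²` on `ℝ²`. -/
def lap (φ : E2 → ℝ) (x : E2) : ℝ :=
  ∑ i : Fin 2,
    fderiv ℝ (fun y => fderiv ℝ φ y (EuclideanSpace.single i 1)) x (EuclideanSpace.single i 1)

/-- A bounded open connected planar domain. -/
structure IsPlaneDomain (Ω : Set E2) : Prop where
  isOpen : IsOpen Ω
  isBounded : Bornology.IsBounded Ω
  isConnected : IsConnected Ω

/-- An arc-length parametrization `q` of the boundary of `Ω` (periodic with period `len`,
injective on `[0, len)`, unit speed, image equal to the frontier of `Ω`), together with the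
unit normal `ν` along the boundary, pointing into `Ω`. -/
structure BoundaryParam (Ω : Set E2) where
  len : ℝ
  len_pos : 0 < len
  q : ℝ → E2
  qd : ℝ → E2
  hasDerivAt : ∀ s, HasDerivAt q (qd s) s
  periodic : Function.Periodic q len
  injOn : Set.InjOn q (Set.Ico 0 len)
  unitSpeed : ∀ s, ‖qd s‖ = 1
  range_eq : Set.range q = frontier Ω
  ν : ℝ → E2
  ν_unit : ∀ s, ‖ν s‖ = 1
  ν_orth : ∀ s, ⟪ν s, qd s⟫ = 0
  ν_inward : ∀ s, ∃ δ > 0, ∀ t ∈ Set.Ioo (0 : ℝ) δ, q s + t • ν s ∈ Ω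

/-- The boundary parametrization is `C^∞`-smooth. -/
def BoundaryParam.IsSmooth {Ω : Set E2} (B : BoundaryParam Ω) : Prop :=
  ContDiff ℝ (⊤ : ℕ∞) B.q

/-- An interior closed real-analytic curve in `Ω`: an arc-length parametrization `c`,
real-analytic, periodic with period `len`, injective on `[0, len)`, with image contained
in `Ω`, together with a unit normal `n` along the curve. -/
structure InteriorCurve (Ω : Set E2) where
  len : ℝ
  len_pos : 0 < len
  c : ℝ → E2
  cd : ℝ → E2
  hasDerivAt : ∀ s, HasDerivAt c (cd s) s
  analytic : AnalyticOnNhd ℝ c Set.univ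
  periodic : Function.Periodic c len
  injOn : Set.InjOn c (Set.Ico 0 len)
  unitSpeed : ∀ s, ‖cd s‖ = 1
  mem : ∀ s, c s ∈ Ω
  n : ℝ → E2
  n_unit : ∀ s, ‖n s‖ = 1
  n_orth : ∀ s, ⟪n s, cd s⟫ = 0

/-- `φ` is a Neumann eigenfunction of `Ω` with eigenvalue `lam²`: it is `C^∞` on an open
neighborhood of the closure of `Ω`, not identically zero on `Ω`, satisfies `Δφ = -lam² φ`
on `Ω` and has vanishing normal derivative along the boundary. -/
structure IsNeumannEigenfunction {Ω : Set E2} (B : BoundaryParam Ω) (lam : ℝ)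
    (φ : E2 → ℝ) : Prop where
  smooth : ∃ U : Set E2, IsOpen U ∧ closure Ω ⊆ U ∧ ContDiffOn ℝ (⊤ : ℕ∞) φ U
  nontrivial : ∃ x ∈ Ω, φ x ≠ 0
  eigen : ∀ x ∈ Ω, lap φ x = -lam ^ 2 * φ x
  neumann : ∀ s : ℝ, ⟪gradient φ (B.q s), B.ν s⟫ = 0

namespace NeumannCauchy

open Set Filter Topology Function

lemma hasDerivAt_intervalIntegral_param {f f' : ℝ → ℝ → ℝ} (a b t₀ : ℝ)
    (hf : Continuous (uncurry f)) (hf' : Continuous (uncurry f'))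
    (h : ∀ t s, HasDerivAt (fun t => f t s) (f' t s) t) :
    HasDerivAt (fun t => ∫ s in a..b, f t s) (∫ s in a..b, f' t₀ s) t₀ := by
  obtain ⟨C, hC⟩ := (((isCompact_closedBall t₀ (1 : ℝ)).prod
    (isCompact_uIcc (a := a) (b := b))).image hf'.norm).bddAbove
  have hsec : ∀ t, Continuous (f t) := fun t => hf.comp (Continuous.prodMk_right t)
  refine (intervalIntegral.hasDerivAt_integral_of_dominated_loc_of_deriv_le (F := f) (F' := f')
    (bound := fun _ => C) (s := Metric.closedBall t₀ 1)
    (Metric.closedBall_mem_nhds _ one_pos) (Eventually.of_forall fun t => ?_) ?_ ?_ ?_ ?_ ?_).2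
  · exact (hsec t).aestronglyMeasurable
  · exact (hsec t₀).intervalIntegrable _ _
  · exact (hf'.comp (Continuous.prodMk_right t₀)).aestronglyMeasurable
  · refine Eventually.of_forall fun s hs t ht => ?_
    exact hC ⟨(t, s), ⟨ht, uIoc_subset_uIcc hs⟩, rfl⟩
  · exact intervalIntegrable_const
  · exact Eventually.of_forall fun s _ t _ => h t s

lemma continuous_intervalIntegral_param {f : ℝ → ℝ → ℝ} (a b : ℝ)
    (hf : Continuous (uncurry f)) : Continuous fun t => ∫ s in a..b, f t s :=
  intervalIntegral.continuous_parametric_intervalIntegral_of_continuous' hf a b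

/-- A function `u` on a strip, periodic in the tangential variable `s`, together with its
tangential and normal derivatives `a`, `b` and Hessian components `p`, `q`, `r`, all computed in the
coordinates `(t, s)` with Jacobian `1 - κ s * t`. -/
structure StripJet (L : ℝ) (κ : ℝ → ℝ) (u a b p q r : ℝ → ℝ → ℝ) : Prop where
  len_pos : 0 < L
  contκ : Continuous κ
  contu : Continuous (uncurry u)
  conta : Continuous (uncurry a)
  contb : Continuous (uncurry b)
  contp : Continuous (uncurry p)
  contq : Continuous (uncurry q)
  contr : Continuous (uncurry r)
  u_t : ∀ t s, HasDerivAt (fun t => u t s) (b t s) t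
  a_t : ∀ t s, HasDerivAt (fun t => a t s) (q t s) t
  b_t : ∀ t s, HasDerivAt (fun t => b t s) (r t s) t
  u_s : ∀ t s, HasDerivAt (fun s => u t s) ((1 - κ s * t) * a t s) s
  a_s : ∀ t s, HasDerivAt (fun s => a t s) ((1 - κ s * t) * p t s + κ s * b t s) s
  b_s : ∀ t s, HasDerivAt (fun s => b t s) ((1 - κ s * t) * q t s - κ s * a t s) s
  u_per : ∀ t, u t L = u t 0
  a_per : ∀ t, a t L = a t 0
  b_per : ∀ t, b t L = b t 0

/-- The derivative of the weight exponent `τ * exp (μ * t)`. -/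
def slope (μ τ t : ℝ) : ℝ := μ * (τ * exp (μ * t))

/-- The Carleman weight `exp (2 * τ * exp (μ * t))`. -/
def weight (μ τ t : ℝ) : ℝ := exp (2 * (τ * exp (μ * t)))

lemma weight_pos (μ τ t : ℝ) : 0 < weight μ τ t := exp_pos _

lemma hasDerivAt_slope (μ τ t : ℝ) : HasDerivAt (slope μ τ) (μ * slope μ τ t) t := by
  have h : HasDerivAt (fun t => exp (μ * t)) (exp (μ * t) * μ) t := by
    simpa using ((hasDerivAt_id t).const_mul μ).exp
  refine ((h.const_mul τ).const_mul μ).congr_deriv ?_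
  simp only [slope]; ring

lemma hasDerivAt_weight (μ τ t : ℝ) :
    HasDerivAt (weight μ τ) (2 * slope μ τ t * weight μ τ t) t := by
  have h : HasDerivAt (fun t => exp (μ * t)) (exp (μ * t) * μ) t := by
    simpa using ((hasDerivAt_id t).const_mul μ).exp
  refine ((h.const_mul τ).const_mul 2).exp.congr_deriv ?_
  simp only [slope, weight]; ring

lemma continuous_slope (μ τ : ℝ) : Continuous (slope μ τ) :=
  continuous_iff_continuousAt.2 fun t => (hasDerivAt_slope μ τ t).continuousAt

lemma continuous_weight (μ τ : ℝ) : Continuous (weight μ τ) :=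
  continuous_iff_continuousAt.2 fun t => (hasDerivAt_weight μ τ t).continuousAt

/-- The density of the Carleman functional. -/
def carlemanDensity (lam μ τ : ℝ) (κ : ℝ → ℝ) (u a b : ℝ → ℝ → ℝ) (t s : ℝ) : ℝ :=
  (1 - κ s * t) * weight μ τ t * ((b t s + slope μ τ t * u t s) ^ 2 - a t s ^ 2 +
    (slope μ τ t ^ 2 + lam ^ 2) * u t s ^ 2)

/-- The Carleman functional at the level `t`. -/
def carlemanEnergy (lam μ τ L : ℝ) (κ : ℝ → ℝ) (u a b : ℝ → ℝ → ℝ) (t : ℝ) : ℝ :=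
  ∫ s in (0 : ℝ)..L, carlemanDensity lam μ τ κ u a b t s

/-- The quadratic form appearing in the derivative of the Carleman functional. -/
def carlemanForm (lam μ τ : ℝ) (κ : ℝ → ℝ) (u a b : ℝ → ℝ → ℝ) (t s : ℝ) : ℝ :=
  weight μ τ t * ((4 * slope μ τ t * (1 - κ s * t) + κ s) * (b t s + slope μ τ t * u t s) ^ 2 +
    2 * (μ * slope μ τ t * (1 - κ s * t) - κ s * slope μ τ t) *
      ((b t s + slope μ τ t * u t s) * u t s) - κ s * a t s ^ 2 +
    (2 * slope μ τ t * (μ * slope μ τ t) * (1 - κ s * t) -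
      κ s * (slope μ τ t ^ 2 + lam ^ 2)) * u t s ^ 2)

lemma carleman_cross_ge {K μ w J k V v : ℝ} (hK : |k| ≤ K) (hJ : 1 / 2 ≤ J) (hμ : 0 ≤ μ)
    (hw : 0 ≤ w) : -(J * w * (2 * V ^ 2 + (μ + 2 * K) ^ 2 / 2 * v ^ 2)) ≤
      2 * (μ * w * J - k * w) * (V * v) := by
  have hk := abs_le.1 hK
  have hK0 : 0 ≤ K := le_trans (abs_nonneg _) hK
  have hc : |μ * J - k| ≤ (μ + 2 * K) * J := by
    rw [abs_le]; constructor <;> nlinarith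
  have e : 2 * (μ * w * J - k * w) * (V * v) = 2 * w * ((μ * J - k) * (V * v)) := by ring
  have h5 : |μ * J - k| * (|V| * |v|) ≤ (μ + 2 * K) * J * (|V| * |v|) :=
    mul_le_mul_of_nonneg_right hc (by positivity)
  have h6 : 2 * ((μ + 2 * K) * (|V| * |v|)) ≤ 2 * V ^ 2 + (μ + 2 * K) ^ 2 / 2 * v ^ 2 := by
    rw [← sq_abs V, ← sq_abs v]
    nlinarith [sq_nonneg (2 * |V| - (μ + 2 * K) * |v|)]
  have h4 : |2 * (μ * w * J - k * w) * (V * v)| ≤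
      J * w * (2 * V ^ 2 + (μ + 2 * K) ^ 2 / 2 * v ^ 2) :=
    calc |2 * (μ * w * J - k * w) * (V * v)| = 2 * w * (|μ * J - k| * (|V| * |v|)) := by
          rw [e, abs_mul, abs_mul (μ * J - k), abs_mul V v, abs_of_nonneg (by linarith : 0 ≤ 2 * w)]
      _ ≤ 2 * w * ((μ + 2 * K) * J * (|V| * |v|)) := mul_le_mul_of_nonneg_left h5 (by linarith)
      _ = J * w * (2 * ((μ + 2 * K) * (|V| * |v|))) := by ring
      _ ≤ _ := mul_le_mul_of_nonneg_left h6 (by positivity)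
  linarith [neg_abs_le (2 * (μ * w * J - k * w) * (V * v))]

lemma carleman_quadratic_ge {K lam μ w J k V v A : ℝ} (hK : |k| ≤ K) (hJ : 1 / 2 ≤ J)
    (hμ : 8 * K + 2 ≤ μ) (hw : 2 * μ ≤ w) (hlam : |lam| ≤ w) :
    V ^ 2 + v ^ 2 ≤ (4 * w * J + k - 2 * K * J) * V ^ 2 +
      2 * (μ * w * J - k * w) * (V * v) + (2 * K * J - k) * A ^ 2 +
      (2 * w * (μ * w) * J - (k + 2 * K * J) * (w ^ 2 + lam ^ 2)) * v ^ 2 := by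
  have hk := abs_le.1 hK
  have hK0 : 0 ≤ K := le_trans (abs_nonneg _) hK
  have hl2 : lam ^ 2 ≤ w ^ 2 := sq_le_sq' (by linarith [(abs_le.1 hlam).1]) (abs_le.1 hlam).2
  have hJ0 : 0 < J := by linarith
  have hw0 : 0 < w := by linarith
  have hKJ : K ≤ 2 * K * J := by nlinarith
  have hA : 0 ≤ (2 * K * J - k) * A ^ 2 := mul_nonneg (by linarith) (sq_nonneg _)
  have h1 : (4 * w * J - 4 * K * J) * V ^ 2 ≤ (4 * w * J + k - 2 * K * J) * V ^ 2 :=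
    mul_le_mul_of_nonneg_right (by linarith) (sq_nonneg _)
  have h2 : (2 * w * (μ * w) * J - 8 * K * J * w ^ 2) * v ^ 2 ≤
      (2 * w * (μ * w) * J - (k + 2 * K * J) * (w ^ 2 + lam ^ 2)) * v ^ 2 := by
    refine mul_le_mul_of_nonneg_right ?_ (sq_nonneg _)
    have : (k + 2 * K * J) * (w ^ 2 + lam ^ 2) ≤ (4 * K * J) * (2 * w ^ 2) :=
      mul_le_mul (by linarith) (by linarith) (by positivity) (by positivity)
    linarith
  have h3 := carleman_cross_ge (V := V) (v := v) hK hJ (by linarith : 0 ≤ μ) hw0.le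
  have e5 : 1 ≤ J * w := by nlinarith
  have h4 : 1 ≤ 4 * w * J - 4 * K * J - 2 * (J * w) := by
    have : 1 * (1 / 2) ≤ (2 * w - 4 * K) * J * (1 / 2) := by nlinarith
    linarith
  have h5 : 1 ≤ 2 * w * (μ * w) * J - 8 * K * J * w ^ 2 - J * w * ((μ + 2 * K) ^ 2 / 2) := by
    have e1 : μ * w ≤ (2 * μ - 8 * K) * w := mul_le_mul_of_nonneg_right (by linarith) hw0.le
    have e2 : (μ + 2 * K) ^ 2 ≤ 2 * μ ^ 2 := by nlinarith
    have e3 : μ * (2 * μ) ≤ μ * w := mul_le_mul_of_nonneg_left hw (by linarith)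
    have e4 : 1 ≤ μ ^ 2 := by nlinarith
    have e7 : 1 ≤ (2 * μ - 8 * K) * w - (μ + 2 * K) ^ 2 / 2 := by linarith
    have e6 : 2 * w * (μ * w) * J - 8 * K * J * w ^ 2 - J * w * ((μ + 2 * K) ^ 2 / 2) =
      (J * w) * ((2 * μ - 8 * K) * w - (μ + 2 * K) ^ 2 / 2) := by ring
    rw [e6]
    exact one_le_mul_of_one_le_of_one_le e5 e7
  have h6 := mul_le_mul_of_nonneg_right h4 (sq_nonneg V)
  have h7 := mul_le_mul_of_nonneg_right h5 (sq_nonneg v)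
  linarith

section Strip

variable {L : ℝ} {κ : ℝ → ℝ} {u a b p q r : ℝ → ℝ → ℝ}

lemma StripJet.continuous_density (S : StripJet L κ u a b p q r) (lam μ τ : ℝ) :
    Continuous (uncurry (carlemanDensity lam μ τ κ u a b)) := by
  have h1 := S.contκ; have h2 := S.contu; have h3 := S.conta; have h4 := S.contb
  have h5 := continuous_slope μ τ; have h6 := continuous_weight μ τ
  simp only [uncurry_def, carlemanDensity] at *
  fun_prop

lemma StripJet.continuous_form (S : StripJet L κ u a b p q r) (lam μ τ : ℝ) :
    Continuous (uncurry (carlemanForm lam μ τ κ u a b)) := by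
  have h1 := S.contκ; have h2 := S.contu; have h3 := S.conta; have h4 := S.contb
  have h5 := continuous_slope μ τ; have h6 := continuous_weight μ τ
  simp only [uncurry_def, carlemanForm] at *
  fun_prop

lemma StripJet.continuous_energy (S : StripJet L κ u a b p q r) (lam μ τ : ℝ) :
    Continuous (carlemanEnergy lam μ τ L κ u a b) :=
  continuous_intervalIntegral_param 0 L (S.continuous_density lam μ τ)

lemma StripJet.hasDerivAt_energy (S : StripJet L κ u a b p q r) (lam μ τ t : ℝ)
    (hpde : ∀ s, p t s + r t s = -lam ^ 2 * u t s) :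
    HasDerivAt (carlemanEnergy lam μ τ L κ u a b)
      (∫ s in (0 : ℝ)..L, carlemanForm lam μ τ κ u a b t s) t := by
  set D : ℝ → ℝ → ℝ := fun t s =>
    (-κ s * weight μ τ t + (1 - κ s * t) * (2 * slope μ τ t * weight μ τ t)) *
      ((b t s + slope μ τ t * u t s) ^ 2 - a t s ^ 2 +
        (slope μ τ t ^ 2 + lam ^ 2) * u t s ^ 2) +
    (1 - κ s * t) * weight μ τ t *
      (2 * (b t s + slope μ τ t * u t s) *
          (r t s + (μ * slope μ τ t * u t s + slope μ τ t * b t s)) - 2 * a t s * q t s +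
        (2 * slope μ τ t * (μ * slope μ τ t) * u t s ^ 2 +
          (slope μ τ t ^ 2 + lam ^ 2) * (2 * u t s * b t s))) with hD
  have hDc : Continuous (uncurry D) := by
    have h1 := S.contκ; have h2 := S.contu; have h3 := S.conta; have h4 := S.contb
    have h5 := continuous_slope μ τ; have h6 := continuous_weight μ τ
    have h7 := S.contq; have h8 := S.contr
    simp only [uncurry_def, hD] at *
    fun_prop
  have hder : ∀ t s, HasDerivAt (fun t => carlemanDensity lam μ τ κ u a b t s) (D t s) t := by
    intro t s
    have hw := hasDerivAt_weight μ τ t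
    have hs := hasDerivAt_slope μ τ t
    have hJ : HasDerivAt (fun t => 1 - κ s * t) (-κ s) t := by
      simpa using ((hasDerivAt_id t).const_mul (κ s)).const_sub 1
    have hV := (S.b_t t s).add (hs.mul (S.u_t t s))
    have h := (hJ.mul hw).mul (((hV.pow 2).sub ((S.a_t t s).pow 2)).add
      (((hs.pow 2).add_const (lam ^ 2)).mul ((S.u_t t s).pow 2)))
    refine h.congr_deriv ?_
    simp [hD]
  have key := hasDerivAt_intervalIntegral_param 0 L t (S.continuous_density lam μ τ) hDc hder
  refine key.congr_deriv ?_
  set G : ℝ → ℝ := fun s => weight μ τ t * ((b t s + slope μ τ t * u t s) * a t s) with hG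
  have hGd : ∀ s, HasDerivAt G (weight μ τ t *
      (((1 - κ s * t) * q t s - κ s * a t s + slope μ τ t * ((1 - κ s * t) * a t s)) * a t s +
        (b t s + slope μ τ t * u t s) * ((1 - κ s * t) * p t s + κ s * b t s))) s := fun s =>
    (((S.b_s t s).add ((S.u_s t s).const_mul (slope μ τ t))).mul (S.a_s t s)).const_mul _
  have hsplit : ∀ s, D t s = carlemanForm lam μ τ κ u a b t s - 2 * (weight μ τ t *
      (((1 - κ s * t) * q t s - κ s * a t s + slope μ τ t * ((1 - κ s * t) * a t s)) * a t s +
        (b t s + slope μ τ t * u t s) * ((1 - κ s * t) * p t s + κ s * b t s))) := by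
    intro s
    have hr : r t s = -lam ^ 2 * u t s - p t s := by linarith [hpde s]
    simp only [hD, carlemanForm, hr]
    ring
  have hcG : Continuous fun s => weight μ τ t *
      (((1 - κ s * t) * q t s - κ s * a t s + slope μ τ t * ((1 - κ s * t) * a t s)) * a t s +
        (b t s + slope μ τ t * u t s) * ((1 - κ s * t) * p t s + κ s * b t s)) := by
    have h1 := S.contκ
    have h2 : Continuous (u t) := S.contu.comp (Continuous.prodMk_right t)
    have h3 : Continuous (a t) := S.conta.comp (Continuous.prodMk_right t)
    have h4 : Continuous (b t) := S.contb.comp (Continuous.prodMk_right t)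
    have h5 : Continuous (p t) := S.contp.comp (Continuous.prodMk_right t)
    have h6 : Continuous (q t) := S.contq.comp (Continuous.prodMk_right t)
    fun_prop
  have hftc := intervalIntegral.integral_eq_sub_of_hasDerivAt (a := 0) (b := L)
    (fun s _ => hGd s) (hcG.intervalIntegrable _ _)
  have hzero : G L - G 0 = 0 := by
    simp only [hG, S.u_per, S.a_per, S.b_per, sub_self]
  rw [intervalIntegral.integral_congr (g := fun s => carlemanForm lam μ τ κ u a b t s - 2 * _)
    (fun s _ => hsplit s), intervalIntegral.integral_sub, intervalIntegral.integral_const_mul,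
    hftc, hzero, mul_zero, sub_zero]
  · exact ((S.continuous_form lam μ τ).comp (Continuous.prodMk_right t)).intervalIntegrable _ _
  · exact (hcG.const_mul 2).intervalIntegrable _ _

/-- The quadratic form dominates a multiple of the density plus a positive term. -/
lemma carlemanForm_ge {K lam μ τ t s : ℝ} (hK : |κ s| ≤ K) (hJ : 1 / 2 ≤ 1 - κ s * t)
    (hμ : 8 * K + 2 ≤ μ) (hw : 2 * μ ≤ slope μ τ t) (hlam : |lam| ≤ slope μ τ t) :
    2 * K * carlemanDensity lam μ τ κ u a b t s +
      weight μ τ t * ((b t s + slope μ τ t * u t s) ^ 2 + u t s ^ 2) ≤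
      carlemanForm lam μ τ κ u a b t s := by
  unfold carlemanDensity carlemanForm
  have key := carleman_quadratic_ge (A := a t s) (V := b t s + slope μ τ t * u t s) (v := u t s)
    hK hJ hμ hw hlam
  have := mul_le_mul_of_nonneg_left key (weight_pos μ τ t).le
  linarith

end Strip

/-- The energy of a jet on the level `t`. -/
def levelEnergy (L : ℝ) (u a b : ℝ → ℝ → ℝ) (t : ℝ) : ℝ :=
  ∫ s in (0 : ℝ)..L, (u t s ^ 2 + a t s ^ 2 + b t s ^ 2)

section Strip

variable {L : ℝ} {κ : ℝ → ℝ} {u a b p q r : ℝ → ℝ → ℝ}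

lemma continuous_section {f : ℝ → ℝ → ℝ} (hf : Continuous (uncurry f)) (t : ℝ) :
    Continuous (f t) := hf.comp (Continuous.prodMk_right t)

lemma StripJet.continuous_levelEnergy (S : StripJet L κ u a b p q r) :
    Continuous (levelEnergy L u a b) := by
  refine continuous_intervalIntegral_param 0 L ?_
  have h2 := S.contu; have h3 := S.conta; have h4 := S.contb
  simp only [uncurry_def] at *
  fun_prop

lemma StripJet.levelEnergy_nonneg (S : StripJet L κ u a b p q r) (t : ℝ) :
    0 ≤ levelEnergy L u a b t :=
  intervalIntegral.integral_nonneg S.len_pos.le fun _ _ => by positivity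

lemma StripJet.energy_le (S : StripJet L κ u a b p q r) {lam μ τ t J₁ M : ℝ}
    (hJ : ∀ s, 1 / 2 ≤ 1 - κ s * t) (hJ₁ : ∀ s, 1 - κ s * t ≤ J₁)
    (hlam : |lam| ≤ slope μ τ t) (hM : slope μ τ t ≤ M) (hM1 : 1 ≤ M) :
    carlemanEnergy lam μ τ L κ u a b t ≤
      4 * J₁ * M ^ 2 * (weight μ τ t * ∫ s in (0 : ℝ)..L, (u t s ^ 2 + b t s ^ 2)) := by
  have hu := continuous_section S.contu t
  have hb := continuous_section S.contb t
  rw [← intervalIntegral.integral_const_mul, ← intervalIntegral.integral_const_mul]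
  refine intervalIntegral.integral_mono_on S.len_pos.le
    ((continuous_section (S.continuous_density lam μ τ) t).intervalIntegrable _ _)
    (Continuous.intervalIntegrable (by fun_prop) _ _) fun s _ => ?_
  have hW := weight_pos μ τ t
  have hl0 : 0 ≤ slope μ τ t := (abs_nonneg _).trans hlam
  have hl2 : lam ^ 2 ≤ M ^ 2 := by
    rw [← sq_abs]; exact pow_le_pow_left₀ (abs_nonneg _) (hlam.trans hM) 2
  have hs2 : slope μ τ t ^ 2 ≤ M ^ 2 := pow_le_pow_left₀ hl0 hM 2
  have hM2 : 1 ≤ M ^ 2 := one_le_pow₀ hM1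
  unfold carlemanDensity
  have hin : (b t s + slope μ τ t * u t s) ^ 2 - a t s ^ 2 +
      (slope μ τ t ^ 2 + lam ^ 2) * u t s ^ 2 ≤ 4 * M ^ 2 * (u t s ^ 2 + b t s ^ 2) := by
    have h1 := mul_le_mul_of_nonneg_right hs2 (sq_nonneg (u t s))
    have h2 := mul_le_mul_of_nonneg_right hl2 (sq_nonneg (u t s))
    have h3 := mul_le_mul_of_nonneg_right hM2 (sq_nonneg (b t s))
    nlinarith [sq_nonneg (b t s - slope μ τ t * u t s), sq_nonneg (a t s), sq_nonneg (b t s)]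
  have hJ0 : 0 < 1 - κ s * t := by linarith [hJ s]
  calc _ ≤ (1 - κ s * t) * weight μ τ t * (4 * M ^ 2 * (u t s ^ 2 + b t s ^ 2)) :=
        mul_le_mul_of_nonneg_left hin (by positivity)
    _ ≤ J₁ * weight μ τ t * (4 * M ^ 2 * (u t s ^ 2 + b t s ^ 2)) := by
        gcongr; exact hJ₁ s
    _ = _ := by ring

lemma StripJet.neg_energy_le (S : StripJet L κ u a b p q r) {lam μ τ t J₁ : ℝ}
    (hJ : ∀ s, 1 / 2 ≤ 1 - κ s * t) (hJ₁ : ∀ s, 1 - κ s * t ≤ J₁) :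
    -carlemanEnergy lam μ τ L κ u a b t ≤ J₁ * (weight μ τ t * levelEnergy L u a b t) := by
  have hu := continuous_section S.contu t
  have ha := continuous_section S.conta t
  have hb := continuous_section S.contb t
  rw [levelEnergy, ← intervalIntegral.integral_const_mul, ← intervalIntegral.integral_const_mul,
    carlemanEnergy, ← intervalIntegral.integral_neg]
  refine intervalIntegral.integral_mono_on S.len_pos.le
    ((continuous_section (S.continuous_density lam μ τ) t).neg.intervalIntegrable _ _)
    (Continuous.intervalIntegrable (by fun_prop) _ _) fun s _ => ?_
  have hW := weight_pos μ τ t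
  have hJ0 : 0 < 1 - κ s * t := by linarith [hJ s]
  unfold carlemanDensity
  have hin : -((b t s + slope μ τ t * u t s) ^ 2 - a t s ^ 2 +
      (slope μ τ t ^ 2 + lam ^ 2) * u t s ^ 2) ≤ u t s ^ 2 + a t s ^ 2 + b t s ^ 2 := by
    have : 0 ≤ (slope μ τ t ^ 2 + lam ^ 2) * u t s ^ 2 := by positivity
    nlinarith [sq_nonneg (b t s + slope μ τ t * u t s), sq_nonneg (u t s), sq_nonneg (b t s)]
  calc _ = (1 - κ s * t) * weight μ τ t * -((b t s + slope μ τ t * u t s) ^ 2 - a t s ^ 2 +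
          (slope μ τ t ^ 2 + lam ^ 2) * u t s ^ 2) := by ring
    _ ≤ (1 - κ s * t) * weight μ τ t * (u t s ^ 2 + a t s ^ 2 + b t s ^ 2) :=
        mul_le_mul_of_nonneg_left hin (by positivity)
    _ ≤ J₁ * weight μ τ t * (u t s ^ 2 + a t s ^ 2 + b t s ^ 2) := by
        gcongr; exact hJ₁ s
    _ = _ := by ring

/-- The weighted `L²` norm controlled by the derivative of the Carleman functional. -/
def bulkEnergy (μ τ L : ℝ) (u b : ℝ → ℝ → ℝ) (t : ℝ) : ℝ :=
  weight μ τ t * ∫ s in (0 : ℝ)..L, ((b t s + slope μ τ t * u t s) ^ 2 + u t s ^ 2)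

lemma StripJet.continuous_bulkEnergy (S : StripJet L κ u a b p q r) (μ τ : ℝ) :
    Continuous (bulkEnergy μ τ L u b) := by
  refine (continuous_weight μ τ).mul (continuous_intervalIntegral_param 0 L ?_)
  have h2 := S.contu; have h3 := S.conta; have h4 := S.contb
  have h5 := continuous_slope μ τ
  simp only [uncurry_def] at *
  fun_prop

lemma StripJet.bulkEnergy_nonneg (S : StripJet L κ u a b p q r) (μ τ t : ℝ) :
    0 ≤ bulkEnergy μ τ L u b t :=
  mul_nonneg (weight_pos _ _ _).le
    (intervalIntegral.integral_nonneg S.len_pos.le fun _ _ => by positivity)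

/-- Monotonicity of the Carleman functional. -/
lemma StripJet.integral_bulkEnergy_le (S : StripJet L κ u a b p q r) {K lam μ τ t₁ t₂ : ℝ}
    (h12 : t₁ ≤ t₂) (hK : ∀ s, |κ s| ≤ K) (hμ : 8 * K + 2 ≤ μ)
    (hJ : ∀ t ∈ Ioo t₁ t₂, ∀ s, 1 / 2 ≤ 1 - κ s * t)
    (hpde : ∀ t ∈ Ioo t₁ t₂, ∀ s, p t s + r t s = -lam ^ 2 * u t s)
    (hw : ∀ t ∈ Ioo t₁ t₂, 2 * μ ≤ slope μ τ t) (hlam : ∀ t ∈ Ioo t₁ t₂, |lam| ≤ slope μ τ t) :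
    ∫ t in t₁..t₂, exp (-(2 * K) * t) * bulkEnergy μ τ L u b t ≤
      exp (-(2 * K) * t₂) * carlemanEnergy lam μ τ L κ u a b t₂ -
      exp (-(2 * K) * t₁) * carlemanEnergy lam μ τ L κ u a b t₁ := by
  have hE : ∀ t, HasDerivAt (fun t => exp (-(2 * K) * t)) (-(2 * K) * exp (-(2 * K) * t)) t := by
    intro t
    have := ((hasDerivAt_id t).const_mul (-(2 * K))).exp
    simp only [id, mul_one] at this
    exact this.congr_deriv (by ring)
  have hEc : Continuous fun t => exp (-(2 * K) * t) := by fun_prop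
  refine intervalIntegral.integral_le_sub_of_hasDeriv_right_of_le
    (g := fun t => exp (-(2 * K) * t) * carlemanEnergy lam μ τ L κ u a b t)
    (g' := fun t => -(2 * K) * exp (-(2 * K) * t) * carlemanEnergy lam μ τ L κ u a b t +
      exp (-(2 * K) * t) * ∫ s in (0 : ℝ)..L, carlemanForm lam μ τ κ u a b t s) h12
    (hEc.mul (S.continuous_energy lam μ τ)).continuousOn
    (fun t ht => ((hE t).mul (S.hasDerivAt_energy lam μ τ t (hpde t ht))).hasDerivWithinAt)
    ((hEc.mul (S.continuous_bulkEnergy μ τ)).integrableOn_Icc) fun t ht => ?_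
  have hu := continuous_section S.contu t
  have hb := continuous_section S.contb t
  have hd := continuous_section (S.continuous_density lam μ τ) t
  have key : 2 * K * carlemanEnergy lam μ τ L κ u a b t + bulkEnergy μ τ L u b t ≤
      ∫ s in (0 : ℝ)..L, carlemanForm lam μ τ κ u a b t s := by
    unfold carlemanEnergy bulkEnergy
    rw [← intervalIntegral.integral_const_mul, ← intervalIntegral.integral_const_mul,
      ← intervalIntegral.integral_add (Continuous.intervalIntegrable (by fun_prop) _ _)
      (Continuous.intervalIntegrable (by fun_prop) _ _)]
    refine intervalIntegral.integral_mono_on S.len_pos.le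
      (Continuous.intervalIntegrable (by fun_prop) _ _)
      ((continuous_section (S.continuous_form lam μ τ) t).intervalIntegrable _ _) fun s _ => ?_
    exact carlemanForm_ge (hK s) (hJ t ht s) hμ (hw t ht) (hlam t ht)
  have := mul_le_mul_of_nonneg_left key (exp_pos (-(2 * K) * t)).le
  nlinarith

/-- Control of the weighted level energies by boundary bounds for the Carleman functional. -/
lemma StripJet.integral_levelEnergy_le (S : StripJet L κ u a b p q r)
    {K lam μ τ t₁ t₂ T J₁ M X Y : ℝ} (h12 : t₁ ≤ t₂) (hK : ∀ s, |κ s| ≤ K) (hμ : 8 * K + 2 ≤ μ)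
    (hT₁ : -T ≤ t₁) (hT₂ : t₂ ≤ T)
    (hJ : ∀ t ∈ Icc t₁ t₂, ∀ s, 1 / 2 ≤ 1 - κ s * t) (hJ₁ : ∀ t ∈ Icc t₁ t₂, ∀ s, 1 - κ s * t ≤ J₁)
    (hpde : ∀ t ∈ Ioo t₁ t₂, ∀ s, p t s + r t s = -lam ^ 2 * u t s)
    (hw : ∀ t ∈ Icc t₁ t₂, 2 * μ ≤ slope μ τ t) (hlam : ∀ t ∈ Icc t₁ t₂, |lam| ≤ slope μ τ t)
    (hM : ∀ t ∈ Icc t₁ t₂, slope μ τ t ≤ M) (hX0 : 0 ≤ X) (hY0 : 0 ≤ Y)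
    (hX : -(exp (-(2 * K) * t₁) * carlemanEnergy lam μ τ L κ u a b t₁) ≤ X)
    (hY : exp (-(2 * K) * t₂) * carlemanEnergy lam μ τ L κ u a b t₂ ≤ Y) :
    ∫ t in t₁..t₂, weight μ τ t * levelEnergy L u a b t ≤
      exp (2 * K * T) * (4 * T + 4 * J₁ + 3) * M ^ 2 * (X + Y) := by
  have hK0 : 0 ≤ K := (abs_nonneg _).trans (hK 0)
  have hJ₁0 : 0 ≤ J₁ := by
    linarith [hJ t₁ (left_mem_Icc.2 h12) 0, hJ₁ t₁ (left_mem_Icc.2 h12) 0]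
  have hM1 : 1 ≤ M := by
    linarith [hw t₁ (left_mem_Icc.2 h12), hM t₁ (left_mem_Icc.2 h12)]
  have hM2 : 1 ≤ M ^ 2 := one_le_pow₀ hM1
  set N := exp (2 * K * T) with hN
  have hN0 : 0 < N := exp_pos _
  have hexp : ∀ t ∈ Icc t₁ t₂, 1 ≤ N * exp (-(2 * K) * t) := by
    intro t ht
    rw [hN, ← exp_add]
    apply one_le_exp
    nlinarith [ht.2]
  have hbulk : ∫ t in t₁..t₂, bulkEnergy μ τ L u b t ≤ N * (X + Y) := by
    have h1 := S.integral_bulkEnergy_le h12 hK hμ (fun t ht => hJ t (Ioo_subset_Icc_self ht)) hpde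
      (fun t ht => hw t (Ioo_subset_Icc_self ht)) (fun t ht => hlam t (Ioo_subset_Icc_self ht))
    calc ∫ t in t₁..t₂, bulkEnergy μ τ L u b t
        ≤ ∫ t in t₁..t₂, N * (exp (-(2 * K) * t) * bulkEnergy μ τ L u b t) := by
          have hc := S.continuous_bulkEnergy μ τ
          refine intervalIntegral.integral_mono_on h12 (hc.intervalIntegrable _ _)
            (Continuous.intervalIntegrable (by fun_prop) _ _) fun t ht => ?_
          have := mul_le_mul_of_nonneg_right (hexp t ht) (S.bulkEnergy_nonneg μ τ t)
          linarith
      _ ≤ N * (X + Y) := by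
          rw [intervalIntegral.integral_const_mul]
          exact mul_le_mul_of_nonneg_left (by linarith) hN0.le
  have hlower : ∀ t ∈ Icc t₁ t₂, -carlemanEnergy lam μ τ L κ u a b t ≤ N * X := by
    intro t ht
    have hsub : ∀ x ∈ Ioo t₁ t, x ∈ Icc t₁ t₂ := fun x hx => ⟨hx.1.le, hx.2.le.trans ht.2⟩
    have h1 := S.integral_bulkEnergy_le (lam := lam) (τ := τ) ht.1 hK hμ
      (fun x hx => hJ x (hsub x hx))
      (fun x hx => hpde x ⟨hx.1, hx.2.trans_le ht.2⟩)
      (fun x hx => hw x (hsub x hx)) (fun x hx => hlam x (hsub x hx))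
    have h2 : 0 ≤ ∫ t in t₁..t, exp (-(2 * K) * t) * bulkEnergy μ τ L u b t :=
      intervalIntegral.integral_nonneg ht.1 fun x _ =>
        mul_nonneg (exp_pos _).le (S.bulkEnergy_nonneg μ τ x)
    have h3 : exp (-(2 * K) * t) * -carlemanEnergy lam μ τ L κ u a b t ≤ X := by linarith
    rcases le_or_gt (-carlemanEnergy lam μ τ L κ u a b t) 0 with h | h
    · exact h.trans (by positivity)
    · have h4 := mul_le_mul_of_nonneg_right (hexp t ht) h.le
      nlinarith
  have hlevel : ∀ t ∈ Icc t₁ t₂, weight μ τ t * levelEnergy L u a b t ≤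
      2 * (N * X) + (4 * J₁ + 3) * M ^ 2 * bulkEnergy μ τ L u b t := by
    intro t ht
    have hu := continuous_section S.contu t
    have ha := continuous_section S.conta t
    have hb := continuous_section S.contb t
    have hd := continuous_section (S.continuous_density lam μ τ) t
    have h1 : weight μ τ t * levelEnergy L u a b t ≤
        2 * -carlemanEnergy lam μ τ L κ u a b t +
        (4 * J₁ + 3) * M ^ 2 * bulkEnergy μ τ L u b t := by
      unfold levelEnergy bulkEnergy carlemanEnergy
      rw [← intervalIntegral.integral_neg, ← intervalIntegral.integral_const_mul,
        ← intervalIntegral.integral_const_mul, ← intervalIntegral.integral_const_mul,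
        ← intervalIntegral.integral_const_mul,
        ← intervalIntegral.integral_add (Continuous.intervalIntegrable (by fun_prop) _ _)
        (Continuous.intervalIntegrable (by fun_prop) _ _)]
      refine intervalIntegral.integral_mono_on S.len_pos.le
        (Continuous.intervalIntegrable (by fun_prop) _ _)
        (Continuous.intervalIntegrable (by fun_prop) _ _) fun s _ => ?_
      have hW := weight_pos μ τ t
      unfold carlemanDensity
      have hl0 : 0 ≤ slope μ τ t := (abs_nonneg _).trans (hlam t ht)
      have hl2 : lam ^ 2 ≤ M ^ 2 := by
        rw [← sq_abs]; exact pow_le_pow_left₀ (abs_nonneg _) ((hlam t ht).trans (hM t ht)) 2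
      have hs2 : slope μ τ t ^ 2 ≤ M ^ 2 := pow_le_pow_left₀ hl0 (hM t ht) 2
      set J := 1 - κ s * t
      set V := b t s + slope μ τ t * u t s with hV
      have hJl : 1 / 2 ≤ J := hJ t ht s
      have hJu : J ≤ J₁ := hJ₁ t ht s
      have hin : u t s ^ 2 + a t s ^ 2 + b t s ^ 2 ≤
          2 * -(J * (V ^ 2 - a t s ^ 2 + (slope μ τ t ^ 2 + lam ^ 2) * u t s ^ 2)) +
          (4 * J₁ + 3) * M ^ 2 * (V ^ 2 + u t s ^ 2) := by
        have e1 : b t s ^ 2 ≤ 2 * V ^ 2 + 2 * M ^ 2 * u t s ^ 2 := by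
          have : b t s = V - slope μ τ t * u t s := by rw [hV]; ring
          rw [this]
          nlinarith [sq_nonneg (V + slope μ τ t * u t s),
            mul_le_mul_of_nonneg_right hs2 (sq_nonneg (u t s))]
        have e2 : a t s ^ 2 ≤ 2 * J * a t s ^ 2 := by nlinarith [sq_nonneg (a t s)]
        have e3 : J * (V ^ 2 + (slope μ τ t ^ 2 + lam ^ 2) * u t s ^ 2) ≤
            J₁ * (2 * M ^ 2 * (V ^ 2 + u t s ^ 2)) := by
          refine mul_le_mul hJu ?_ (by positivity) hJ₁0
          nlinarith [mul_le_mul_of_nonneg_right hs2 (sq_nonneg (u t s)),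
            mul_le_mul_of_nonneg_right hl2 (sq_nonneg (u t s)),
            mul_le_mul_of_nonneg_right hM2 (sq_nonneg V), sq_nonneg V]
        have e4 : 2 * V ^ 2 + 2 * M ^ 2 * u t s ^ 2 + u t s ^ 2 ≤
            3 * M ^ 2 * (V ^ 2 + u t s ^ 2) := by
          nlinarith [mul_le_mul_of_nonneg_right hM2 (sq_nonneg (u t s)),
            mul_le_mul_of_nonneg_right hM2 (sq_nonneg V), sq_nonneg V]
        linarith
      have := mul_le_mul_of_nonneg_left hin hW.le
      linarith
    linarith [hlower t ht]
  have hcl := S.continuous_levelEnergy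
  have hcb := S.continuous_bulkEnergy μ τ
  have hcw := continuous_weight μ τ
  calc ∫ t in t₁..t₂, weight μ τ t * levelEnergy L u a b t
      ≤ ∫ t in t₁..t₂, (2 * (N * X) + (4 * J₁ + 3) * M ^ 2 * bulkEnergy μ τ L u b t) :=
        intervalIntegral.integral_mono_on h12 (Continuous.intervalIntegrable (by fun_prop) _ _)
          (Continuous.intervalIntegrable (by fun_prop) _ _) hlevel
    _ = (t₂ - t₁) * (2 * (N * X)) +
          (4 * J₁ + 3) * M ^ 2 * ∫ t in t₁..t₂, bulkEnergy μ τ L u b t := by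
        rw [intervalIntegral.integral_add (Continuous.intervalIntegrable (by fun_prop) _ _)
          (Continuous.intervalIntegrable (by fun_prop) _ _), intervalIntegral.integral_const,
          smul_eq_mul, intervalIntegral.integral_const_mul]
    _ ≤ (2 * T) * (2 * (N * (M ^ 2 * (X + Y)))) + (4 * J₁ + 3) * M ^ 2 * (N * (X + Y)) := by
        refine add_le_add ?_ (mul_le_mul_of_nonneg_left hbulk (by positivity))
        have : X ≤ M ^ 2 * (X + Y) := by nlinarith
        refine mul_le_mul (by linarith) ?_ (by positivity) (by linarith)
        gcongr
    _ = _ := by ring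

end Strip

/-- A closed curve `γ` of period `len` with a moving orthonormal frame `(T, n)` and signed
curvature `κ`. -/
structure Frame where
  len : ℝ
  len_pos : 0 < len
  γ : ℝ → E2
  T : ℝ → E2
  n : ℝ → E2
  κ : ℝ → ℝ
  contκ : Continuous κ
  hasDerivAt_γ : ∀ s, HasDerivAt γ (T s) s
  hasDerivAt_T : ∀ s, HasDerivAt T (κ s • n s) s
  hasDerivAt_n : ∀ s, HasDerivAt n (-(κ s) • T s) s
  norm_T : ∀ s, ‖T s‖ = 1
  norm_n : ∀ s, ‖n s‖ = 1
  orth : ∀ s, ⟪T s, n s⟫ = 0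
  γ_per : Periodic γ len
  T_per : Periodic T len
  n_per : Periodic n len
  κ_per : Periodic κ len

namespace Frame

variable (F : Frame)

/-- Normal coordinates along the curve. -/
def Φ (t s : ℝ) : E2 := F.γ s + t • F.n s

/-- The frame with the opposite normal. -/
def neg : Frame where
  len := F.len
  len_pos := F.len_pos
  γ := F.γ
  T := F.T
  n := fun s => -F.n s
  κ := fun s => -F.κ s
  contκ := F.contκ.neg
  hasDerivAt_γ := F.hasDerivAt_γ
  hasDerivAt_T s := by simpa using F.hasDerivAt_T s
  hasDerivAt_n s := (F.hasDerivAt_n s).neg.congr_deriv (by simp)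
  norm_T := F.norm_T
  norm_n s := by simpa using F.norm_n s
  orth s := by simpa using F.orth s
  γ_per := F.γ_per
  T_per := F.T_per
  n_per s := by simpa using F.n_per s
  κ_per s := by simpa using F.κ_per s

@[simp] lemma neg_len : F.neg.len = F.len := rfl
@[simp] lemma neg_κ (s : ℝ) : F.neg.κ s = -F.κ s := rfl
@[simp] lemma neg_n (s : ℝ) : F.neg.n s = -F.n s := rfl
@[simp] lemma neg_γ (s : ℝ) : F.neg.γ s = F.γ s := rfl
@[simp] lemma neg_T (s : ℝ) : F.neg.T s = F.T s := rfl

lemma neg_Φ (t s : ℝ) : F.neg.Φ t s = F.Φ (-t) s := by simp [Φ]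

lemma Φ_per (t s : ℝ) : F.Φ t (s + F.len) = F.Φ t s := by
  simp [Φ, F.γ_per s, F.n_per s]

lemma exists_Ico (s : ℝ) : ∃ s' ∈ Ico 0 F.len, F.γ s' = F.γ s ∧ F.n s' = F.n s ∧ F.κ s' = F.κ s := by
  refine ⟨toIcoMod F.len_pos 0 s, by simpa using toIcoMod_mem_Ico F.len_pos 0 s, ?_, ?_, ?_⟩
  all_goals rw [toIcoMod]
  · exact F.γ_per.sub_zsmul_eq _
  · exact F.n_per.sub_zsmul_eq _
  · exact F.κ_per.sub_zsmul_eq _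

lemma continuous_γ : Continuous F.γ :=
  continuous_iff_continuousAt.2 fun s => (F.hasDerivAt_γ s).continuousAt

lemma continuous_T : Continuous F.T :=
  continuous_iff_continuousAt.2 fun s => (F.hasDerivAt_T s).continuousAt

lemma continuous_n : Continuous F.n :=
  continuous_iff_continuousAt.2 fun s => (F.hasDerivAt_n s).continuousAt

lemma continuous_Φ : Continuous (uncurry F.Φ) := by
  have h1 := F.continuous_γ
  have h2 := F.continuous_n
  simp only [uncurry_def, Φ]
  fun_prop

lemma hasDerivAt_Φ_left (t s : ℝ) : HasDerivAt (fun t => F.Φ t s) (F.n s) t :=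
  (((hasDerivAt_id t).smul_const (F.n s)).const_add (F.γ s)).congr_deriv (one_smul _ _)

lemma hasDerivAt_Φ_right (t s : ℝ) :
    HasDerivAt (fun s => F.Φ t s) ((1 - F.κ s * t) • F.T s) s := by
  refine ((F.hasDerivAt_γ s).add ((F.hasDerivAt_n s).const_smul t)).congr_deriv ?_
  module

lemma exists_curvature_bound : ∃ K : ℝ, 0 < K ∧ ∀ s, |F.κ s| ≤ K := by
  obtain ⟨C, hC⟩ := (isCompact_Icc (a := 0) (b := F.len)).exists_bound_of_continuousOn
    F.contκ.continuousOn
  refine ⟨max C 1, by positivity, fun s => ?_⟩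
  obtain ⟨s', hs', -, -, h⟩ := F.exists_Ico s
  rw [← h]
  exact (hC s' (Ico_subset_Icc_self hs')).trans (le_max_left _ _)

/-- The part `α < t ≤ β` of the tubular neighbourhood. -/
def region (α β : ℝ) : Set E2 := {x | ∃ t ∈ Ioc α β, ∃ s, F.Φ t s = x}

lemma region_mono {α β α' β' : ℝ} (h : α' ≤ α) (h' : β ≤ β') :
    F.region α β ⊆ F.region α' β' := by
  rintro x ⟨t, ht, s, rfl⟩
  exact ⟨t, ⟨h.trans_lt ht.1, ht.2.trans h'⟩, s, rfl⟩

lemma region_union (α m β : ℝ) : F.region α β ⊆ F.region α m ∪ F.region m β := by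
  rintro x ⟨t, ht, s, rfl⟩
  rcases le_or_gt t m with h | h
  · exact Or.inl ⟨t, ⟨ht.1, h⟩, s, rfl⟩
  · exact Or.inr ⟨t, ⟨h, ht.2⟩, s, rfl⟩

end Frame

section Plane

lemma exists_sign_of_orthonormal {T n : E2} (hT : ‖T‖ = 1) (hn : ‖n‖ = 1) (h : ⟪T, n⟫ = 0) :
    ∃ σ : ℝ, (σ = 1 ∨ σ = -1) ∧ n = σ • !₂[-T 1, T 0] := by
  have e1 : T 0 ^ 2 + T 1 ^ 2 = 1 := by
    have := EuclideanSpace.real_norm_sq_eq T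
    simp [hT, Fin.sum_univ_two] at this; linarith
  have e2 : n 0 ^ 2 + n 1 ^ 2 = 1 := by
    have := EuclideanSpace.real_norm_sq_eq n
    simp [hn, Fin.sum_univ_two] at this; linarith
  have e3 : T 0 * n 0 + T 1 * n 1 = 0 := by
    simp [PiLp.inner_apply, Fin.sum_univ_two] at h; linarith
  refine ⟨T 0 * n 1 - T 1 * n 0, ?_, ?_⟩
  · have : (T 0 * n 1 - T 1 * n 0) ^ 2 = 1 := by
      have : (T 0 * n 1 - T 1 * n 0) ^ 2 + (T 0 * n 0 + T 1 * n 1) ^ 2 =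
        (T 0 ^ 2 + T 1 ^ 2) * (n 0 ^ 2 + n 1 ^ 2) := by ring
      rw [e1, e2, e3] at this; linarith
    exact mul_self_eq_one_iff.1 (by linarith)
  · ext i
    fin_cases i
    · simp
      linear_combination (-(n 0)) * e1 + T 0 * e3
    · simp
      linear_combination (-(n 1)) * e1 + T 1 * e3

lemma sum_bilin_orthonormal {T n : E2} (hT : ‖T‖ = 1) (hn : ‖n‖ = 1) (h : ⟪T, n⟫ = 0)
    (D : E2 →L[ℝ] E2 →L[ℝ] ℝ) :
    D T T + D n n = ∑ i : Fin 2, D (EuclideanSpace.single i 1) (EuclideanSpace.single i 1) := by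
  have e1 : T 0 ^ 2 + T 1 ^ 2 = 1 := by
    have := EuclideanSpace.real_norm_sq_eq T
    simp [hT, Fin.sum_univ_two] at this; linarith
  obtain ⟨σ, hσ, rfl⟩ := exists_sign_of_orthonormal hT hn h
  have hσ2 : σ * σ = 1 := by rcases hσ with rfl | rfl <;> norm_num
  set e0 : E2 := EuclideanSpace.single 0 1
  set e1' : E2 := EuclideanSpace.single 1 1
  have hT' : T = T 0 • e0 + T 1 • e1' := by
    ext i; fin_cases i <;> simp [e0, e1']
  have hn' : (!₂[-T 1, T 0] : E2) = (-T 1) • e0 + T 0 • e1' := by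
    ext i; fin_cases i <;> simp [e0, e1']
  rw [hn']
  generalize T 0 = x at *
  generalize T 1 = y at *
  rw [hT']
  simp only [map_add, map_smul, add_apply, smul_apply, smul_eq_mul, Fin.sum_univ_two]
  linear_combination (D e0 e0 * y ^ 2 + D e1' e1' * x ^ 2 - D e0 e1' * x * y - D e1' e0 * x * y) * hσ2 +
    (D e0 e0 + D e1' e1') * e1

lemma sq_norm_dual_orthonormal {T n : E2} (hT : ‖T‖ = 1) (hn : ‖n‖ = 1) (h : ⟪T, n⟫ = 0)
    (ℓ : E2 →L[ℝ] ℝ) : ℓ T ^ 2 + ℓ n ^ 2 = ‖ℓ‖ ^ 2 := by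
  have e1 : T 0 ^ 2 + T 1 ^ 2 = 1 := by
    have := EuclideanSpace.real_norm_sq_eq T
    simp [hT, Fin.sum_univ_two] at this; linarith
  obtain ⟨σ, hσ, rfl⟩ := exists_sign_of_orthonormal hT hn h
  have hσ2 : σ * σ = 1 := by rcases hσ with rfl | rfl <;> norm_num
  set v := (InnerProductSpace.toDual ℝ E2).symm ℓ with hv
  have hℓ : ∀ x, ℓ x = ⟪v, x⟫ := fun x => by simp [hv]
  have hnorm : ‖ℓ‖ = ‖v‖ := by simp [hv]
  rw [hnorm, EuclideanSpace.real_norm_sq_eq, hℓ, hℓ]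
  simp [PiLp.inner_apply, Fin.sum_univ_two]
  linear_combination ((v 1 * T 0 - v 0 * T 1) ^ 2) * hσ2 + (v 0 ^ 2 + v 1 ^ 2) * e1

lemma lap_eq {φ : E2 → ℝ} (hφ : ContDiff ℝ 2 φ) (x : E2) :
    lap φ x = ∑ i : Fin 2, fderiv ℝ (fderiv ℝ φ) x
      (EuclideanSpace.single i 1) (EuclideanSpace.single i 1) := by
  have h1 : Differentiable ℝ (fderiv ℝ φ) :=
    (hφ.fderiv_right (m := 1) (by norm_num)).differentiable (by norm_num)
  refine Finset.sum_congr rfl fun i _ => ?_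
  rw [fderiv_clm_apply (h1 x) (differentiableAt_const _)]
  simp

end Plane

lemma hasDerivAt_fderiv_apply {φ : E2 → ℝ} (hφ : ContDiff ℝ 2 φ) {g v : ℝ → E2} {g' v' : E2}
    {x : ℝ} (hg : HasDerivAt g g' x) (hv : HasDerivAt v v' x) :
    HasDerivAt (fun y => fderiv ℝ φ (g y) (v y))
      (fderiv ℝ (fderiv ℝ φ) (g x) g' (v x) + fderiv ℝ φ (g x) v') x := by
  have h1 : ContDiff ℝ 1 (fderiv ℝ φ) := hφ.fderiv_right (by norm_num)
  have h2 := ((h1.differentiable (by norm_num) (g x)).hasFDerivAt).comp_hasDerivAt x hg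
  exact h2.clm_apply hv

namespace Frame

variable (F : Frame) (φ : E2 → ℝ)

/-- The value in normal coordinates. -/
def ju (t s : ℝ) : ℝ := φ (F.Φ t s)

/-- Tangential derivative in normal coordinates. -/
def ja (t s : ℝ) : ℝ := fderiv ℝ φ (F.Φ t s) (F.T s)

/-- Normal derivative in normal coordinates. -/
def jb (t s : ℝ) : ℝ := fderiv ℝ φ (F.Φ t s) (F.n s)

/-- Tangential second derivative in normal coordinates. -/
def jp (t s : ℝ) : ℝ := fderiv ℝ (fderiv ℝ φ) (F.Φ t s) (F.T s) (F.T s)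

/-- Mixed second derivative in normal coordinates. -/
def jq (t s : ℝ) : ℝ := fderiv ℝ (fderiv ℝ φ) (F.Φ t s) (F.T s) (F.n s)

/-- Normal second derivative in normal coordinates. -/
def jr (t s : ℝ) : ℝ := fderiv ℝ (fderiv ℝ φ) (F.Φ t s) (F.n s) (F.n s)

variable {φ}

lemma stripJet (hφ : ContDiff ℝ 2 φ) :
    StripJet F.len F.κ (F.ju φ) (F.ja φ) (F.jb φ) (F.jp φ) (F.jq φ) (F.jr φ) := by
  have h1 : ContDiff ℝ 1 (fderiv ℝ φ) := hφ.fderiv_right (by norm_num)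
  have hd : ∀ x, HasFDerivAt φ (fderiv ℝ φ x) x :=
    fun x => (hφ.differentiable (by norm_num) x).hasFDerivAt
  have c0 := hφ.continuous
  have c1 := h1.continuous
  have c2 : Continuous (fderiv ℝ (fderiv ℝ φ)) := h1.continuous_fderiv (by norm_num)
  have cΦ : Continuous fun p : ℝ × ℝ => F.Φ p.1 p.2 := F.continuous_Φ
  have cT := F.continuous_T
  have cn := F.continuous_n
  have symm : ∀ x v w, fderiv ℝ (fderiv ℝ φ) x v w = fderiv ℝ (fderiv ℝ φ) x w v := fun x v w =>
    (hφ.contDiffAt.isSymmSndFDerivAt (by simp)).eq v w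
  refine ⟨F.len_pos, F.contκ, ?_, ?_, ?_, ?_, ?_, ?_, fun t s => ?_, fun t s => ?_, fun t s => ?_,
    fun t s => ?_, fun t s => ?_, fun t s => ?_, fun t => ?_, fun t => ?_, fun t => ?_⟩
  iterate 6 simp only [uncurry_def, ju, ja, jb, jp, jq, jr]; fun_prop
  · exact (hd _).comp_hasDerivAt t (F.hasDerivAt_Φ_left t s)
  · refine (hasDerivAt_fderiv_apply hφ (F.hasDerivAt_Φ_left t s)
      (hasDerivAt_const t (F.T s))).congr_deriv ?_
    rw [map_zero, add_zero, symm]; rfl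
  · refine (hasDerivAt_fderiv_apply hφ (F.hasDerivAt_Φ_left t s)
      (hasDerivAt_const t (F.n s))).congr_deriv ?_
    rw [map_zero, add_zero]; rfl
  · refine ((hd _).comp_hasDerivAt s (F.hasDerivAt_Φ_right t s)).congr_deriv ?_
    simp [ja]
  · refine (hasDerivAt_fderiv_apply hφ (F.hasDerivAt_Φ_right t s)
      (F.hasDerivAt_T s)).congr_deriv ?_
    simp only [map_smul, smul_apply, smul_eq_mul, jp, jb]
  · refine (hasDerivAt_fderiv_apply hφ (F.hasDerivAt_Φ_right t s)
      (F.hasDerivAt_n s)).congr_deriv ?_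
    simp only [map_smul, smul_apply, smul_eq_mul, jq, ja]; ring
  all_goals
    have e1 := F.Φ_per t 0
    have e2 := F.T_per 0
    have e3 := F.n_per 0
    rw [zero_add] at e1 e2 e3
    simp only [ju, ja, jb, e1, e2, e3]

lemma jp_add_jr (hφ : ContDiff ℝ 2 φ) (t s : ℝ) :
    F.jp φ t s + F.jr φ t s = lap φ (F.Φ t s) := by
  rw [lap_eq hφ, ← sum_bilin_orthonormal (F.norm_T s) (F.norm_n s) (F.orth s)]
  rfl

end Frame

/-- The energy density `φ² + |∇φ|²`. -/
def energyDensity (φ : E2 → ℝ) (x : E2) : ℝ := φ x ^ 2 + ‖fderiv ℝ φ x‖ ^ 2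

lemma energyDensity_nonneg (φ : E2 → ℝ) (x : E2) : 0 ≤ energyDensity φ x := by
  unfold energyDensity; positivity

lemma continuous_energyDensity {φ : E2 → ℝ} (hφ : ContDiff ℝ 1 φ) :
    Continuous (energyDensity φ) := by
  have := hφ.continuous
  have := hφ.continuous_fderiv (by norm_num)
  unfold energyDensity; fun_prop

lemma Frame.levelEnergy_eq (F : Frame) (φ : E2 → ℝ) (t : ℝ) :
    levelEnergy F.len (F.ju φ) (F.ja φ) (F.jb φ) t =
      ∫ s in (0 : ℝ)..F.len, energyDensity φ (F.Φ t s) := by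
  refine intervalIntegral.integral_congr fun s _ => ?_
  simp only [energyDensity,
    ← sq_norm_dual_orthonormal (F.norm_T s) (F.norm_n s) (F.orth s) (fderiv ℝ φ (F.Φ t s)),
    Frame.ju, Frame.ja, Frame.jb]
  ring

end NeumannCauchy

namespace NeumannCauchy

open Set Filter Topology Function
open scoped ENNReal NNReal

/-- The coordinates of the plane as a measurable equivalence with `ℝ × ℝ`. -/
def planeEquiv : E2 ≃ᵐ ℝ × ℝ :=
  (MeasurableEquiv.toLp 2 (Fin 2 → ℝ)).symm.trans MeasurableEquiv.finTwoArrow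

lemma planeEquiv_apply (x : E2) : planeEquiv x = (x 0, x 1) := rfl

lemma measurePreserving_planeEquiv : MeasurePreserving planeEquiv volume volume :=
  (EuclideanSpace.volume_preserving_symm_measurableEquiv_toLp (Fin 2)).trans
    (volume_preserving_finTwoArrow ℝ)

lemma setIntegral_plane_eq {g : ℝ → ℝ → ℝ} (hg : Continuous (uncurry g)) {a b c d : ℝ}
    (hab : a ≤ b) (hcd : c ≤ d) :
    ∫ x in {x : E2 | x 0 ∈ Ioc a b ∧ x 1 ∈ Ioc c d}, g (x 0) (x 1) =
      ∫ t in a..b, ∫ s in c..d, g t s := by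
  have h1 : {x : E2 | x 0 ∈ Ioc a b ∧ x 1 ∈ Ioc c d} = planeEquiv ⁻¹' (Ioc a b ×ˢ Ioc c d) := rfl
  have h2 := measurePreserving_planeEquiv.setIntegral_preimage_emb
    planeEquiv.measurableEmbedding (uncurry g) (Ioc a b ×ˢ Ioc c d)
  rw [h1]
  simp only [planeEquiv_apply, uncurry_apply_pair] at h2
  rw [h2, intervalIntegral.integral_of_le hab, Measure.volume_eq_prod, setIntegral_prod]
  · refine setIntegral_congr_fun measurableSet_Ioc fun t _ => ?_
    rw [intervalIntegral.integral_of_le hcd]; rfl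
  · exact (hg.continuousOn.integrableOn_compact (isCompact_Icc.prod isCompact_Icc)).mono_set
      (prod_mono Ioc_subset_Icc_self Ioc_subset_Icc_self)

namespace Frame

variable (F : Frame)

/-- Normal coordinates as a map of the plane. -/
def Ψ (x : E2) : E2 := F.Φ (x 0) (x 1)

/-- The differential of the normal coordinates. -/
def Ψ' (x : E2) : E2 →L[ℝ] E2 :=
  (EuclideanSpace.proj (0 : Fin 2) : E2 →L[ℝ] ℝ).smulRight (F.n (x 1)) +
    (EuclideanSpace.proj (1 : Fin 2) : E2 →L[ℝ] ℝ).smulRight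
      ((1 - F.κ (x 1) * x 0) • F.T (x 1))

lemma abs_det_Ψ' (x : E2) : |(F.Ψ' x).det| = |1 - F.κ (x 1) * x 0| := by
  have h : (F.Ψ' x).det =
      (1 - F.κ (x 1) * x 0) * (F.n (x 1) 0 * F.T (x 1) 1 - F.T (x 1) 0 * F.n (x 1) 1) := by
    rw [ContinuousLinearMap.det,
      ← LinearMap.det_toMatrix (EuclideanSpace.basisFun (Fin 2) ℝ).toBasis, Matrix.det_fin_two]
    simp [LinearMap.toMatrix_apply, Ψ']
    ring
  obtain ⟨σ, hσ, hn⟩ := exists_sign_of_orthonormal (F.norm_T (x 1)) (F.norm_n (x 1))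
    (F.orth (x 1))
  have e1 : F.T (x 1) 0 ^ 2 + F.T (x 1) 1 ^ 2 = 1 := by
    have := EuclideanSpace.real_norm_sq_eq (F.T (x 1))
    simp [F.norm_T, Fin.sum_univ_two] at this; linarith
  have h2 : F.n (x 1) 0 * F.T (x 1) 1 - F.T (x 1) 0 * F.n (x 1) 1 = -σ := by
    rw [hn]; simp; linear_combination (-σ) * e1
  rw [h, h2, abs_mul]
  rcases hσ with rfl | rfl <;> simp

lemma continuous_Ψ : Continuous F.Ψ := by
  have := F.continuous_Φ
  simp only [uncurry_def] at this
  unfold Ψ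
  exact this.comp (f := fun x : E2 => (x 0, x 1)) (by fun_prop)

lemma hasFDerivAt_Ψ (x : E2) : HasFDerivAt F.Ψ (F.Ψ' x) x := by
  have p0 : HasFDerivAt (fun x : E2 => x 0) (EuclideanSpace.proj (0 : Fin 2) : E2 →L[ℝ] ℝ) x :=
    (EuclideanSpace.proj (0 : Fin 2) : E2 →L[ℝ] ℝ).hasFDerivAt
  have p1 : HasFDerivAt (fun x : E2 => x 1) (EuclideanSpace.proj (1 : Fin 2) : E2 →L[ℝ] ℝ) x :=
    (EuclideanSpace.proj (1 : Fin 2) : E2 →L[ℝ] ℝ).hasFDerivAt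
  have h1 := (F.hasDerivAt_γ (x 1)).hasFDerivAt.comp x p1
  have h2 := (F.hasDerivAt_n (x 1)).hasFDerivAt.comp x p1
  refine (h1.add (p0.smul h2)).congr_fderiv ?_
  ext v i
  simp [Ψ']
  ring

lemma continuous_Ψ' : Continuous F.Ψ' := by
  have h1 := F.continuous_n
  have h2 := F.continuous_T
  have h3 := F.contκ
  have hs : ∀ c : E2 →L[ℝ] ℝ, ∀ f : E2 → E2, Continuous f →
      Continuous fun x => c.smulRight (f x) := fun c f hf =>
    (ContinuousLinearMap.smulRightL ℝ E2 E2 c).continuous.comp hf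
  unfold Ψ'
  exact (hs _ _ (by fun_prop)).add (hs _ _ (by fun_prop))

lemma hasStrictFDerivAt_Ψ {x : E2} (hx : 1 - F.κ (x 1) * x 0 ≠ 0) :
    ∃ e : E2 ≃L[ℝ] E2, HasStrictFDerivAt F.Ψ (e : E2 →L[ℝ] E2) x := by
  have hdet : (F.Ψ' x).det ≠ 0 := by
    rw [← abs_pos, abs_det_Ψ', abs_pos]; exact hx
  refine ⟨(F.Ψ' x).toContinuousLinearEquivOfDetNeZero hdet, ?_⟩
  rw [ContinuousLinearMap.coe_toContinuousLinearEquivOfDetNeZero]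
  exact hasStrictFDerivAt_of_hasFDerivAt_of_continuousAt
    (Eventually.of_forall F.hasFDerivAt_Ψ) F.continuous_Ψ'.continuousAt

lemma exists_injOn_Ψ {x : E2} (hx : 1 - F.κ (x 1) * x 0 ≠ 0) :
    ∃ U : Set E2, IsOpen U ∧ x ∈ U ∧ InjOn F.Ψ U := by
  obtain ⟨e, he⟩ := F.hasStrictFDerivAt_Ψ hx
  refine ⟨(he.toOpenPartialHomeomorph F.Ψ).source, (he.toOpenPartialHomeomorph F.Ψ).open_source,
    he.mem_toOpenPartialHomeomorph_source, ?_⟩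
  exact (he.toOpenPartialHomeomorph F.Ψ).injOn

lemma lintegral_image_Ψ {A : Set E2} (hA : MeasurableSet A) (hinj : InjOn F.Ψ A)
    (ρ : E2 → ℝ≥0∞) :
    ∫⁻ x in F.Ψ '' A, ρ x = ∫⁻ x in A, ENNReal.ofReal |1 - F.κ (x 1) * x 0| * ρ (F.Ψ x) := by
  rw [lintegral_image_eq_lintegral_abs_det_fderiv_mul volume hA
    (fun x _ => (F.hasFDerivAt_Ψ x).hasFDerivWithinAt) hinj]
  simp only [abs_det_Ψ']

lemma exists_lintegral_compare {Q : Set E2} (hQ : IsCompact Q) {J₁ : ℝ≥0}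
    (hJ : ∀ x ∈ Q, 1 / 2 ≤ 1 - F.κ (x 1) * x 0) (hJ₁ : ∀ x ∈ Q, 1 - F.κ (x 1) * x 0 ≤ J₁) :
    ∃ C : ℝ≥0, ∀ ρ : E2 → ℝ≥0∞, ∀ A ⊆ Q, MeasurableSet A →
      ∫⁻ x in F.Ψ '' A, ρ x ≤ C * ∫⁻ x in A, ρ (F.Ψ x) ∧
      ∫⁻ x in A, ρ (F.Ψ x) ≤ C * ∫⁻ x in F.Ψ '' A, ρ x := by
  have key : ∃ C : ℝ≥0, ∀ ρ : E2 → ℝ≥0∞, ∀ A ⊆ Q, MeasurableSet A →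
      ∃ A' ⊆ A, MeasurableSet A' ∧ A ∩ Q ⊆ A' ∧
      ∫⁻ x in F.Ψ '' A', ρ x ≤ C * ∫⁻ x in A, ρ (F.Ψ x) ∧
      ∫⁻ x in A', ρ (F.Ψ x) ≤ C * ∫⁻ x in F.Ψ '' A, ρ x := by
    refine hQ.induction_on (p := fun S => ∃ C : ℝ≥0, ∀ ρ : E2 → ℝ≥0∞, ∀ A ⊆ Q, MeasurableSet A →
      ∃ A' ⊆ A, MeasurableSet A' ∧ A ∩ S ⊆ A' ∧
      ∫⁻ x in F.Ψ '' A', ρ x ≤ C * ∫⁻ x in A, ρ (F.Ψ x) ∧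
      ∫⁻ x in A', ρ (F.Ψ x) ≤ C * ∫⁻ x in F.Ψ '' A, ρ x) ?_ ?_ ?_ ?_
    · exact ⟨0, fun ρ A _ _ => ⟨∅, by simp⟩⟩
    · rintro S S' hSS ⟨C, hC⟩
      refine ⟨C, fun ρ A hAQ hA => ?_⟩
      obtain ⟨A', h1, h2, h3, h4⟩ := hC ρ A hAQ hA
      exact ⟨A', h1, h2, (inter_subset_inter_right _ hSS).trans h3, h4⟩
    · rintro S S' ⟨C, hC⟩ ⟨D, hD⟩
      refine ⟨C + D, fun ρ A hAQ hA => ?_⟩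
      obtain ⟨A', h1, h2, h3, h4, h5⟩ := hC ρ A hAQ hA
      obtain ⟨B', g1, g2, g3, g4, g5⟩ := hD ρ A hAQ hA
      refine ⟨A' ∪ B', union_subset h1 g1, h2.union g2, ?_, ?_, ?_⟩
      · rw [inter_union_distrib_left]; exact union_subset_union h3 g3
      · rw [image_union, ENNReal.coe_add, add_mul]
        exact (lintegral_union_le _ _ _).trans (add_le_add h4 g4)
      · rw [ENNReal.coe_add, add_mul]
        exact (lintegral_union_le _ _ _).trans (add_le_add h5 g5)
    · intro x hx
      obtain ⟨U, hU, hxU, hinj⟩ := F.exists_injOn_Ψ (x := x) (by linarith [hJ x hx])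
      refine ⟨U, mem_nhdsWithin_of_mem_nhds (hU.mem_nhds hxU), J₁ + 2, fun ρ A hAQ hA => ?_⟩
      have hAU := hA.inter hU.measurableSet
      refine ⟨A ∩ U, inter_subset_left, hAU, subset_rfl, ?_, ?_⟩
      · rw [F.lintegral_image_Ψ hAU (hinj.mono inter_subset_right)]
        calc _ ≤ ∫⁻ x in A ∩ U, ((J₁ + 2 : ℝ≥0) : ℝ≥0∞) * ρ (F.Ψ x) := by
              refine setLIntegral_mono' hAU fun y hy => ?_
              gcongr
              rw [abs_of_nonneg (by linarith [hJ y (hAQ hy.1)])]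
              refine (ENNReal.ofReal_le_ofReal (hJ₁ y (hAQ hy.1))).trans ?_
              rw [ENNReal.ofReal_coe_nnreal]
              exact_mod_cast le_self_add
          _ = ((J₁ + 2 : ℝ≥0) : ℝ≥0∞) * ∫⁻ x in A ∩ U, ρ (F.Ψ x) :=
              lintegral_const_mul' _ _ ENNReal.coe_ne_top
          _ ≤ _ := by gcongr; exact inter_subset_left
      · calc ∫⁻ x in A ∩ U, ρ (F.Ψ x)
            ≤ ∫⁻ x in A ∩ U, 2 * (ENNReal.ofReal |1 - F.κ (x 1) * x 0| * ρ (F.Ψ x)) := by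
              refine setLIntegral_mono' hAU fun y hy => ?_
              rw [← mul_assoc]
              refine le_mul_of_one_le_left zero_le ?_
              have h := hJ y (hAQ hy.1)
              rw [abs_of_nonneg (by linarith)]
              calc (1 : ℝ≥0∞) = ENNReal.ofReal 2 * ENNReal.ofReal (1 / 2) := by
                    rw [← ENNReal.ofReal_mul (by norm_num)]; norm_num
                _ ≤ _ := by
                    rw [ENNReal.ofReal_ofNat]
                    gcongr
          _ = 2 * ∫⁻ x in F.Ψ '' (A ∩ U), ρ x := by
              rw [lintegral_const_mul' _ _ (by norm_num),
                F.lintegral_image_Ψ hAU (hinj.mono inter_subset_right)]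
          _ ≤ _ := by
              gcongr
              · push_cast; exact le_add_self
              · exact inter_subset_left
  obtain ⟨C, hC⟩ := key
  refine ⟨C, fun ρ A hAQ hA => ?_⟩
  obtain ⟨A', h1, h2, h3, h4, h5⟩ := hC ρ A hAQ hA
  rw [inter_eq_left.2 hAQ] at h3
  obtain rfl := h1.antisymm h3
  exact ⟨h4, h5⟩

lemma isCompact_closedStrip (α β : ℝ) : IsCompact {x : E2 | x 0 ∈ Icc α β ∧ x 1 ∈ Icc 0 F.len} := by
  have : {x : E2 | x 0 ∈ Icc α β ∧ x 1 ∈ Icc 0 F.len} =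
      (fun p : ℝ × ℝ => (!₂[p.1, p.2] : E2)) '' (Icc α β ×ˢ Icc 0 F.len) := by
    ext x
    constructor
    · intro h
      exact ⟨(x 0, x 1), h, by ext i; fin_cases i <;> rfl⟩
    · rintro ⟨p, hp, rfl⟩
      exact hp
  rw [this]
  exact (isCompact_Icc.prod isCompact_Icc).image (by fun_prop)

lemma image_Ψ_strip (α β : ℝ) :
    F.Ψ '' {x : E2 | x 0 ∈ Ioc α β ∧ x 1 ∈ Ioc 0 F.len} = F.region α β := by
  ext y
  constructor
  · rintro ⟨x, hx, rfl⟩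
    exact ⟨x 0, hx.1, x 1, rfl⟩
  · rintro ⟨t, ht, s, rfl⟩
    refine ⟨!₂[t, toIocMod F.len_pos 0 s], ⟨ht, by simpa using toIocMod_mem_Ioc F.len_pos 0 s⟩, ?_⟩
    change F.Φ t (toIocMod F.len_pos 0 s) = F.Φ t s
    rw [toIocMod]
    exact Periodic.sub_zsmul_eq (f := F.Φ t) (F.Φ_per t) _

lemma isCompact_closedRegion (α β : ℝ) : IsCompact {x | ∃ t ∈ Icc α β, ∃ s, F.Φ t s = x} := by
  have : {x | ∃ t ∈ Icc α β, ∃ s, F.Φ t s = x} =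
      uncurry F.Φ '' (Icc α β ×ˢ Icc 0 F.len) := by
    ext y
    constructor
    · rintro ⟨t, ht, s, rfl⟩
      refine ⟨(t, toIocMod F.len_pos 0 s), ⟨ht, Ioc_subset_Icc_self
        (by simpa using toIocMod_mem_Ioc F.len_pos 0 s)⟩, ?_⟩
      change F.Φ t (toIocMod F.len_pos 0 s) = F.Φ t s
      rw [toIocMod]
      exact Periodic.sub_zsmul_eq (f := F.Φ t) (F.Φ_per t) _
    · rintro ⟨⟨t, s⟩, h, rfl⟩
      exact ⟨t, h.1, s, rfl⟩
  rw [this]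
  exact (isCompact_Icc.prod isCompact_Icc).image F.continuous_Φ

lemma region_subset_closedRegion (α β : ℝ) :
    F.region α β ⊆ {x | ∃ t ∈ Icc α β, ∃ s, F.Φ t s = x} := by
  rintro x ⟨t, ht, s, rfl⟩
  exact ⟨t, Ioc_subset_Icc_self ht, s, rfl⟩

lemma integrableOn_region {ρ : E2 → ℝ} (hρ : Continuous ρ) (α β : ℝ) :
    IntegrableOn ρ (F.region α β) :=
  (hρ.continuousOn.integrableOn_compact (F.isCompact_closedRegion α β)).mono_set
    (F.region_subset_closedRegion α β)

/-- Comparison between integrals in normal coordinates and in the plane. -/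
lemma exists_integral_compare {α β : ℝ} (hJ : ∀ t ∈ Icc α β, ∀ s, 1 / 2 ≤ 1 - F.κ s * t) :
    ∃ C : ℝ, 0 < C ∧ ∀ ρ : E2 → ℝ, Continuous ρ → (∀ x, 0 ≤ ρ x) →
      ∀ α₁ β₁, α ≤ α₁ → α₁ ≤ β₁ → β₁ ≤ β →
      ∫ x in F.region α₁ β₁, ρ x ≤ C * ∫ t in α₁..β₁, ∫ s in (0 : ℝ)..F.len, ρ (F.Φ t s) ∧
      ∫ t in α₁..β₁, ∫ s in (0 : ℝ)..F.len, ρ (F.Φ t s) ≤ C * ∫ x in F.region α₁ β₁, ρ x := by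
  obtain ⟨J₁, hJ₁⟩ : ∃ J₁ : ℝ≥0, ∀ x ∈ {x : E2 | x 0 ∈ Icc α β ∧ x 1 ∈ Icc 0 F.len},
      1 - F.κ (x 1) * x 0 ≤ J₁ := by
    have hc : Continuous fun x : E2 => 1 - F.κ (x 1) * x 0 := by
      have := F.contκ
      fun_prop
    obtain ⟨M, hM⟩ := ((F.isCompact_closedStrip α β).image hc).bddAbove
    exact ⟨M.toNNReal, fun x hx => (hM ⟨x, hx, rfl⟩).trans (Real.le_coe_toNNReal M)⟩
  obtain ⟨C, hC⟩ := F.exists_lintegral_compare (F.isCompact_closedStrip α β)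
    (fun x hx => hJ _ hx.1 _) hJ₁
  refine ⟨C + 1, by positivity, fun ρ hρ h0 α₁ β₁ h1 h2 h3 => ?_⟩
  set A := {x : E2 | x 0 ∈ Ioc α₁ β₁ ∧ x 1 ∈ Ioc 0 F.len} with hA
  have hAm : MeasurableSet A := by
    have : A = planeEquiv ⁻¹' (Ioc α₁ β₁ ×ˢ Ioc 0 F.len) := rfl
    rw [this]
    exact planeEquiv.measurable (measurableSet_Ioc.prod measurableSet_Ioc)
  have hAQ : A ⊆ {x : E2 | x 0 ∈ Icc α β ∧ x 1 ∈ Icc 0 F.len} := fun x hx =>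
    ⟨⟨h1.trans hx.1.1.le, hx.1.2.trans h3⟩, Ioc_subset_Icc_self hx.2⟩
  have hcont : Continuous (uncurry fun t s => ρ (F.Φ t s)) := hρ.comp F.continuous_Φ
  have hAint : IntegrableOn (fun x => ρ (F.Ψ x)) A :=
    ((hρ.comp F.continuous_Ψ).continuousOn.integrableOn_compact
      (F.isCompact_closedStrip α β)).mono_set hAQ
  have hRint := F.integrableOn_region hρ α₁ β₁
  obtain ⟨e1, e2⟩ := hC (fun x => ENNReal.ofReal (ρ x)) A hAQ hAm
  rw [F.image_Ψ_strip] at e1 e2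
  rw [← setIntegral_plane_eq (g := fun t s => ρ (F.Φ t s)) hcont h2 F.len_pos.le]
  change _ ≤ _ * (∫ x in A, ρ (F.Ψ x)) ∧ (∫ x in A, ρ (F.Ψ x)) ≤ _
  rw [← ofReal_integral_eq_lintegral_ofReal hAint (Eventually.of_forall fun x => h0 _),
    ← ofReal_integral_eq_lintegral_ofReal hRint (Eventually.of_forall fun x => h0 _)] at e1 e2
  rw [← ENNReal.ofReal_coe_nnreal, ← ENNReal.ofReal_mul C.coe_nonneg] at e1 e2
  have p1 : 0 ≤ ∫ x in A, ρ (F.Ψ x) := integral_nonneg fun x => h0 _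
  have p2 : 0 ≤ ∫ x in F.region α₁ β₁, ρ x := integral_nonneg fun x => h0 _
  rw [ENNReal.ofReal_le_ofReal_iff (by positivity)] at e1 e2
  constructor <;> nlinarith

lemma exists_ball_subset_region {α β t s : ℝ} (ht : t ∈ Ioo α β) (hJ : 1 - F.κ s * t ≠ 0) :
    ∃ r > 0, Metric.ball (F.Φ t s) r ⊆ F.region α β := by
  obtain ⟨e, he⟩ := F.hasStrictFDerivAt_Ψ (x := !₂[t, s]) hJ
  have h := he.map_nhds_eq_of_equiv
  have hU : {x : E2 | x 0 ∈ Ioo α β} ∈ 𝓝 (!₂[t, s] : E2) :=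
    (isOpen_Ioo.preimage (by fun_prop : Continuous fun x : E2 => x 0)).mem_nhds ht
  have h2 : F.Ψ '' {x : E2 | x 0 ∈ Ioo α β} ∈ 𝓝 (F.Φ t s) := by
    change _ ∈ 𝓝 (F.Ψ !₂[t, s])
    rw [← h]; exact image_mem_map hU
  obtain ⟨r, hr, h3⟩ := Metric.mem_nhds_iff.1 h2
  refine ⟨r, hr, h3.trans ?_⟩
  rintro _ ⟨x, hx, rfl⟩
  exact ⟨x 0, Ioo_subset_Ioc_self hx, x 1, rfl⟩

end Frame

lemma exists_level_le {f : ℝ → ℝ} (hf : Continuous f) {a b : ℝ} (hab : a ≤ b) :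
    ∃ t ∈ Icc a b, f t * (b - a) ≤ ∫ x in a..b, f x := by
  obtain ⟨t, ht, hmin⟩ := isCompact_Icc.exists_isMinOn (nonempty_Icc.2 hab) hf.continuousOn
  refine ⟨t, ht, ?_⟩
  have := intervalIntegral.integral_mono_on (μ := volume) hab
    (continuous_const (y := f t) |>.intervalIntegrable a b)
    (hf.intervalIntegrable a b) fun x hx => hmin hx
  rw [intervalIntegral.integral_const, smul_eq_mul] at this
  linarith

lemma integral_interval_mono {f : ℝ → ℝ} (hf : Continuous f) (h0 : ∀ x, 0 ≤ f x) {a b c d : ℝ}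
    (hab : a ≤ b) (hca : c ≤ a) (hbd : b ≤ d) : ∫ x in a..b, f x ≤ ∫ x in c..d, f x :=
  intervalIntegral.integral_mono_interval hca hab hbd (Eventually.of_forall h0)
    (hf.intervalIntegrable _ _)

lemma weight_mono {μ τ s t : ℝ} (hμ : 0 ≤ μ) (hτ : 0 ≤ τ) (h : s ≤ t) :
    weight μ τ s ≤ weight μ τ t := by
  unfold weight
  gcongr

lemma pow_four_le_exp {d τ : ℝ} (hd : 0 < d) (hτ : 0 ≤ τ) :
    τ ^ 4 ≤ 24 / d ^ 4 * exp (d * τ) := by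
  have h := Real.pow_div_factorial_le_exp (d * τ) (by positivity) 4
  have e : (Nat.factorial 4 : ℝ) = 24 := by norm_num [Nat.factorial]
  rw [e, mul_pow] at h
  have hd4 : 0 < d ^ 4 := by positivity
  rw [div_mul_eq_mul_div, le_div_iff₀ hd4]
  linarith

namespace Frame

variable (F : Frame)

/-- The energy of `φ` on the level curve `t`. -/
def level (φ : E2 → ℝ) (t : ℝ) : ℝ := levelEnergy F.len (F.ju φ) (F.ja φ) (F.jb φ) t

/-- The Cauchy data of `φ` on the level curve `t`. -/
def cauchyData (φ : E2 → ℝ) (t : ℝ) : ℝ :=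
  ∫ s in (0 : ℝ)..F.len, (F.ju φ t s ^ 2 + F.jb φ t s ^ 2)

variable {F} {φ : E2 → ℝ}

lemma level_nonneg (hφ : ContDiff ℝ 2 φ) (t : ℝ) : 0 ≤ F.level φ t :=
  (F.stripJet hφ).levelEnergy_nonneg t

lemma continuous_level (hφ : ContDiff ℝ 2 φ) : Continuous (F.level φ) :=
  (F.stripJet hφ).continuous_levelEnergy

lemma cauchyData_nonneg (t : ℝ) : 0 ≤ F.cauchyData φ t :=
  intervalIntegral.integral_nonneg F.len_pos.le fun _ _ => by positivity

lemma cauchyData_le_level (hφ : ContDiff ℝ 2 φ) (t : ℝ) : F.cauchyData φ t ≤ F.level φ t := by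
  have S := F.stripJet hφ
  have hu := continuous_section S.contu t
  have ha := continuous_section S.conta t
  have hb := continuous_section S.contb t
  refine intervalIntegral.integral_mono_on F.len_pos.le
    (Continuous.intervalIntegrable (by fun_prop) _ _)
    (Continuous.intervalIntegrable (by fun_prop) _ _) fun s _ => ?_
  linarith [sq_nonneg (F.ja φ t s)]

/-- The parameters of the Carleman estimate are admissible for large `τ`. -/
lemma slope_bounds {μ τ T t lam : ℝ} (hμ : 2 ≤ μ) (hlam : 0 < lam)
    (hτ : 2 * exp (μ * T) * (1 + lam) ≤ τ) (h1 : -T ≤ t) (h2 : t ≤ T) :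
    2 * μ ≤ slope μ τ t ∧ |lam| ≤ slope μ τ t ∧ slope μ τ t ≤ μ * exp (μ * T) * τ ∧
      1 ≤ μ * exp (μ * T) * τ := by
  have hτ0 : 0 < τ := lt_of_lt_of_le (by positivity) hτ
  have e1 : 2 * (1 + lam) ≤ τ * exp (μ * t) := by
    calc 2 * (1 + lam) = 2 * exp (μ * T) * (1 + lam) * exp (-(μ * T)) := by
          have : exp (μ * T) * exp (-(μ * T)) = 1 := by rw [← exp_add]; simp
          linear_combination (-2 * (1 + lam)) * this
      _ ≤ τ * exp (μ * t) := by
          gcongr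
          nlinarith
  have e2 : slope μ τ t ≤ μ * exp (μ * T) * τ := by
    have : exp (μ * t) ≤ exp (μ * T) := by gcongr
    have := mul_le_mul_of_nonneg_left this (by positivity : 0 ≤ μ * τ)
    unfold slope; linarith
  have e3 : 2 * μ ≤ slope μ τ t := by
    unfold slope; nlinarith
  refine ⟨e3, ?_, e2, by linarith⟩
  rw [abs_of_pos hlam]; unfold slope; nlinarith

lemma carleman_strip {K T μ α β : ℝ} (hK0 : 0 < K) (hK : ∀ s, |F.κ s| ≤ K) (hT : 0 ≤ T)
    (hα : -T ≤ α) (hβ : β ≤ T) (hμ : μ = 8 * K + 2)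
    (hJ : ∀ t ∈ Icc α β, ∀ s, 1 / 2 ≤ 1 - F.κ s * t) {lam τ t₁ t₂ : ℝ} (hlam : 0 < lam)
    (hφ : ContDiff ℝ 2 φ)
    (heig : ∀ t ∈ Ioo α β, ∀ s, lap φ (F.Φ t s) = -lam ^ 2 * φ (F.Φ t s))
    (hτ : 2 * exp (μ * T) * (1 + lam) ≤ τ) (h1 : α ≤ t₁) (h12 : t₁ ≤ t₂) (h2 : t₂ ≤ β) {x : ℝ}
    (hx : 0 ≤ x)
    (hX : -carlemanEnergy lam μ τ F.len F.κ (F.ju φ) (F.ja φ) (F.jb φ) t₁ ≤ x) :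
    ∫ t in t₁..t₂, weight μ τ t * F.level φ t ≤
      (exp (2 * K * T) * (4 * T + 4 * (1 + K * T) + 3) * (exp (2 * K * T) * (4 * (1 + K * T)))) *
      (μ * exp (μ * T) * τ) ^ 4 * (x + weight μ τ t₂ * F.cauchyData φ t₂) := by
  have S := F.stripJet hφ
  set M := μ * exp (μ * T) * τ
  set J₁ := 1 + K * T
  have hbd : ∀ t ∈ Icc t₁ t₂, -T ≤ t ∧ t ≤ T := fun t ht => ⟨by linarith [ht.1], by linarith [ht.2]⟩
  have hJJ : ∀ t ∈ Icc t₁ t₂, ∀ s, 1 - F.κ s * t ≤ J₁ := fun t ht s => by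
    have h3 : |F.κ s * t| ≤ K * T := by
      rw [abs_mul]
      exact mul_le_mul (hK s) (abs_le.2 (hbd t ht)) (abs_nonneg _) hK0.le
    linarith [neg_abs_le (F.κ s * t)]
  have hJ' : ∀ t ∈ Icc t₁ t₂, ∀ s, 1 / 2 ≤ 1 - F.κ s * t :=
    fun t ht => hJ t ⟨h1.trans ht.1, ht.2.trans h2⟩
  have hsl := fun t ht => slope_bounds (μ := μ) (by linarith) hlam hτ (hbd t ht).1 (hbd t ht).2
  have m2 : t₂ ∈ Icc t₁ t₂ := ⟨h12, le_rfl⟩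
  have m1 : t₁ ∈ Icc t₁ t₂ := ⟨le_rfl, h12⟩
  have hM1 : 1 ≤ M := (hsl t₂ m2).2.2.2
  have hJ₁ : 1 ≤ J₁ := le_add_of_nonneg_right (by positivity)
  have hexp : ∀ t ∈ Icc t₁ t₂, exp (-(2 * K) * t) ≤ exp (2 * K * T) := fun t ht => by
    rw [exp_le_exp]; nlinarith [(hbd t ht).1]
  have hZ : 0 ≤ weight μ τ t₂ * F.cauchyData φ t₂ :=
    mul_nonneg (weight_pos _ _ _).le (cauchyData_nonneg t₂)
  have hF2 := S.energy_le (τ := τ) (μ := μ) (hJ' t₂ m2) (hJJ t₂ m2) (hsl t₂ m2).2.1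
    (hsl t₂ m2).2.2.1 hM1
  have key := S.integral_levelEnergy_le (lam := lam) (μ := μ) (τ := τ) (M := M) (J₁ := J₁)
    (X := exp (2 * K * T) * x)
    (Y := exp (2 * K * T) * (4 * J₁ * M ^ 2 * (weight μ τ t₂ * F.cauchyData φ t₂)))
    h12 hK (by linarith) (hα.trans h1) (h2.trans hβ) hJ' hJJ
    (fun t ht s => by
      rw [F.jp_add_jr hφ]; exact heig t ⟨h1.trans_lt ht.1, ht.2.trans_le h2⟩ s)
    (fun t ht => (hsl t ht).1) (fun t ht => (hsl t ht).2.1) (fun t ht => (hsl t ht).2.2.1)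
    (by positivity) (by positivity) ?_ ?_
  · refine key.trans ?_
    have e1 : x ≤ 4 * J₁ * M ^ 2 * x := by
      refine le_mul_of_one_le_left hx ?_
      nlinarith [one_le_pow₀ hM1 (n := 2)]
    calc _ ≤ exp (2 * K * T) * (4 * T + 4 * J₁ + 3) * M ^ 2 * (exp (2 * K * T) *
            (4 * J₁ * M ^ 2 * x) + exp (2 * K * T) *
            (4 * J₁ * M ^ 2 * (weight μ τ t₂ * F.cauchyData φ t₂))) := by gcongr
      _ = _ := by ring
  · rw [← mul_neg]
    exact (mul_le_mul_of_nonneg_left hX (exp_pos _).le).trans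
      (mul_le_mul_of_nonneg_right (hexp t₁ m1) hx)
  · refine (mul_le_mul_of_nonneg_left hF2 (exp_pos _).le).trans ?_
    exact mul_le_mul_of_nonneg_right (hexp t₂ m2) (by positivity)

end Frame

lemma weight_le_exp {μ τ t T : ℝ} (hμ : 0 ≤ μ) (hτ : 0 ≤ τ) (h : t ≤ T) :
    weight μ τ t ≤ exp (2 * exp (μ * T) * τ) := by
  refine (weight_mono hμ hτ h).trans (le_of_eq ?_)
  unfold weight
  congr 1; ring

lemma one_le_weight {μ τ t : ℝ} (hτ : 0 ≤ τ) : 1 ≤ weight μ τ t := by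
  unfold weight
  exact one_le_exp (by positivity)

/-- Turns a Carleman inequality into an interpolation inequality. -/
lemma interpolation_of_carleman {A d m D τ I Z Y w₀ w₁ w₂ : ℝ} (hA : 0 ≤ A) (hd : 0 < d)
    (hτ : 0 ≤ τ) (hZ : 0 ≤ Z) (hY : 0 ≤ Y) (hw₀ : 1 ≤ w₀)
    (hw₁ : w₁ ≤ w₀ * exp (-(2 * d * τ))) (hw₂ : w₂ ≤ exp (D * τ))
    (h : w₀ * I ≤ A * (m * τ) ^ 4 * (w₁ * Y + w₂ * Z)) :
    I ≤ A * m ^ 4 * (24 / d ^ 4) * (exp ((d + D) * τ) * Z + exp (-(d * τ)) * Y) := by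
  have hw : 0 < w₀ := by linarith
  have h1 : w₀ * I ≤ w₀ * (A * (m * τ) ^ 4 * (exp (-(2 * d * τ)) * Y + exp (D * τ) * Z)) := by
    refine h.trans ?_
    have e1 : w₁ * Y ≤ w₀ * exp (-(2 * d * τ)) * Y := by gcongr
    have e2 : w₂ * Z ≤ w₀ * (exp (D * τ) * Z) := by
      refine (mul_le_mul_of_nonneg_right hw₂ hZ).trans ?_
      exact le_mul_of_one_le_left (by positivity) hw₀
    calc _ ≤ A * (m * τ) ^ 4 * (w₀ * exp (-(2 * d * τ)) * Y + w₀ * (exp (D * τ) * Z)) := by gcongr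
      _ = _ := by ring
  refine (le_of_mul_le_mul_left h1 hw).trans ?_
  have h4 := pow_four_le_exp hd hτ
  calc A * (m * τ) ^ 4 * (exp (-(2 * d * τ)) * Y + exp (D * τ) * Z)
      = A * m ^ 4 * (τ ^ 4 * (exp (-(2 * d * τ)) * Y + exp (D * τ) * Z)) := by ring
    _ ≤ A * m ^ 4 * (24 / d ^ 4 * exp (d * τ) * (exp (-(2 * d * τ)) * Y + exp (D * τ) * Z)) := by
        gcongr
    _ = _ := by
        have e1 : exp ((d + D) * τ) = exp (d * τ) * exp (D * τ) := by rw [← exp_add]; ring_nf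
        have e2 : exp (-(d * τ)) = exp (d * τ) * exp (-(2 * d * τ)) := by
          rw [← exp_add]; ring_nf
        rw [e1, e2]; ring

namespace Frame

variable (F : Frame)

/-- Interpolation inequality in a strip: the energy is controlled by Cauchy data on the top level
and an exponentially small multiple of the total energy. -/
lemma exists_strip_estimate {α α' β : ℝ} (hα : α < α') (hβ : α' ≤ β)
    (hJ : ∀ t ∈ Icc α β, ∀ s, 1 / 2 ≤ 1 - F.κ s * t) :
    ∃ C > 0, ∃ c > 0, ∀ lam > 0, ∀ φ : E2 → ℝ, ContDiff ℝ 2 φ →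
      (∀ t ∈ Ioo α β, ∀ s, lap φ (F.Φ t s) = -lam ^ 2 * φ (F.Φ t s)) →
      ∀ τ, C * (1 + lam) ≤ τ → ∀ t₂ ∈ Icc α' β,
        ∫ t in α'..t₂, F.level φ t ≤
          C * (exp (C * τ) * F.cauchyData φ t₂ + exp (-(c * τ)) * ∫ t in α..α', F.level φ t) := by
  obtain ⟨K, hK0, hK⟩ := F.exists_curvature_bound
  set T := max |α| |β|
  have hT0 : 0 ≤ T := (abs_nonneg _).trans (le_max_left _ _)
  have hTα : -T ≤ α := by linarith [neg_abs_le α, le_max_left |α| |β|]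
  have hTβ : β ≤ T := (le_abs_self β).trans (le_max_right _ _)
  set μ := 8 * K + 2 with hμ
  have hμ0 : 0 < μ := by positivity
  set α'' := (α + α') / 2 with hα''
  set d := exp (μ * α') - exp (μ * α'') with hd_def
  have hd : 0 < d := by
    rw [hd_def, sub_pos, exp_lt_exp]
    exact mul_lt_mul_of_pos_left (by linarith) hμ0
  set A := exp (2 * K * T) * (4 * T + 4 * (1 + K * T) + 3) * (exp (2 * K * T) * (4 * (1 + K * T)))
  have hA : 0 ≤ A := by positivity
  set m := μ * exp (μ * T)
  set D := 2 * exp (μ * T)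
  set C₁ := (1 + K * T)
  set B := A * m ^ 4 * (24 / d ^ 4)
  have hB : 0 ≤ B := by positivity
  have hδ : 0 < α'' - α := by linarith
  refine ⟨D + (d + D) + B + B * (C₁ / (α'' - α)), by positivity, d, hd, ?_⟩
  intro lam hlam φ hφ heig τ hτ t₂ ht₂
  set C := D + (d + D) + B + B * (C₁ / (α'' - α)) with hC
  have hp : 0 ≤ B * (C₁ / (α'' - α)) := by positivity
  have hD : 0 < D := by positivity
  have hτD : 2 * exp (μ * T) * (1 + lam) ≤ τ :=
    (mul_le_mul_of_nonneg_right (by linarith : D ≤ C) (by linarith)).trans hτ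
  have hτ0 : 0 ≤ τ := le_trans (by positivity) hτD
  have hlc := continuous_level (F := F) hφ
  have hl0 := level_nonneg (F := F) hφ
  obtain ⟨t₁, ht₁, hlev⟩ := exists_level_le hlc (a := α) (b := α'') (by linarith)
  have S := F.stripJet hφ
  have hJ1 : ∀ s, 1 - F.κ s * t₁ ≤ C₁ := fun s => by
    have h3 : |F.κ s * t₁| ≤ K * T := by
      rw [abs_mul]
      exact mul_le_mul (hK s) (abs_le.2 ⟨by linarith [ht₁.1], by linarith [ht₁.2, ht₂.1, ht₂.2]⟩)
        (abs_nonneg _) hK0.le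
    have := neg_abs_le (F.κ s * t₁)
    change _ ≤ 1 + K * T
    linarith
  have hX := S.neg_energy_le (lam := lam) (μ := μ) (τ := τ) (t := t₁)
    (fun s => hJ t₁ ⟨ht₁.1, by linarith [ht₁.2, ht₂.1, ht₂.2]⟩ s) hJ1
  have hw := fun t => (weight_pos μ τ t).le
  have h12 : t₁ ≤ t₂ := by linarith [ht₁.2, ht₂.1]
  have key := carleman_strip hK0 hK hT0 hTα hTβ hμ hJ hlam hφ heig hτD ht₁.1 h12 ht₂.2
    (mul_nonneg (by positivity : 0 ≤ C₁) (mul_nonneg (hw t₁) (hl0 t₁))) hX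
  have hE : F.level φ t₁ ≤ (∫ t in α..α', F.level φ t) / (α'' - α) := by
    rw [le_div_iff₀ hδ]
    exact hlev.trans (integral_interval_mono hlc hl0 (by linarith) le_rfl (by linarith))
  have hI0 : 0 ≤ ∫ t in α'..t₂, F.level φ t :=
    intervalIntegral.integral_nonneg ht₂.1 fun t _ => hl0 t
  have hlow : weight μ τ α' * ∫ t in α'..t₂, F.level φ t ≤
      ∫ t in t₁..t₂, weight μ τ t * F.level φ t := by
    have hcw := continuous_weight μ τ
    rw [← intervalIntegral.integral_const_mul]
    refine le_trans (intervalIntegral.integral_mono_on ht₂.1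
      (Continuous.intervalIntegrable (by fun_prop) _ _)
      (Continuous.intervalIntegrable (by fun_prop) _ _) fun t ht =>
        mul_le_mul_of_nonneg_right (weight_mono hμ0.le hτ0 ht.1) (hl0 t)) ?_
    exact integral_interval_mono (by fun_prop) (fun t => mul_nonneg (hw t) (hl0 t)) ht₂.1
      (by linarith [ht₁.2]) le_rfl
  have hEn : 0 ≤ ∫ t in α..α', F.level φ t :=
    intervalIntegral.integral_nonneg hα.le fun t _ => hl0 t
  have hfin := interpolation_of_carleman (A := A) (d := d) (m := m) (D := D) (τ := τ)
    (I := ∫ t in α'..t₂, F.level φ t) (Z := F.cauchyData φ t₂)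
    (Y := C₁ * ((∫ t in α..α', F.level φ t) / (α'' - α)))
    (w₀ := weight μ τ α') (w₁ := weight μ τ t₁) (w₂ := weight μ τ t₂) hA hd hτ0
    (cauchyData_nonneg t₂) (by positivity) (one_le_weight hτ0) ?_
    (weight_le_exp hμ0.le hτ0 (ht₂.2.trans hTβ)) ?_
  · refine hfin.trans ?_
    have hY : B * (exp (-(d * τ)) * (C₁ * ((∫ t in α..α', F.level φ t) / (α'' - α)))) ≤
        C * (exp (-(d * τ)) * ∫ t in α..α', F.level φ t) := by
      calc _ = B * (C₁ / (α'' - α)) * (exp (-(d * τ)) * ∫ t in α..α', F.level φ t) := by ring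
        _ ≤ _ := mul_le_mul_of_nonneg_right (by linarith) (by positivity)
    have hZ : B * (exp ((d + D) * τ) * F.cauchyData φ t₂) ≤
        C * (exp (C * τ) * F.cauchyData φ t₂) := by
      have := cauchyData_nonneg (F := F) (φ := φ) t₂
      gcongr <;> linarith
    calc _ = B * (exp ((d + D) * τ) * F.cauchyData φ t₂) +
          B * (exp (-(d * τ)) * (C₁ * ((∫ t in α..α', F.level φ t) / (α'' - α)))) := by ring
      _ ≤ _ := by linarith
  · refine (weight_mono hμ0.le hτ0 ht₁.2).trans (le_of_eq ?_)
    simp only [weight, ← exp_add]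
    congr 1
    rw [hd_def]; ring
  · refine hlow.trans (key.trans ?_)
    have : C₁ * (weight μ τ t₁ * F.level φ t₁) ≤
        weight μ τ t₁ * (C₁ * ((∫ t in α..α', F.level φ t) / (α'' - α))) := by
      calc _ = weight μ τ t₁ * (C₁ * F.level φ t₁) := by ring
        _ ≤ _ := mul_le_mul_of_nonneg_left
          (mul_le_mul_of_nonneg_left hE (by positivity : (0 : ℝ) ≤ 1 + K * T)) (hw t₁)
    exact mul_le_mul_of_nonneg_left (add_le_add_left this _) (by positivity)

lemma neg_level (φ : E2 → ℝ) (t : ℝ) : F.neg.level φ t = F.level φ (-t) := by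
  rw [level, levelEnergy_eq, level, levelEnergy_eq]
  simp only [neg_Φ, neg_len]

/-- Up to a curve with Neumann conditions, the energy is controlled by any interior level. -/
lemma exists_boundary_estimate {β : ℝ} (hβ : 0 < β)
    (hJ : ∀ t ∈ Icc 0 β, ∀ s, 1 / 2 ≤ 1 - F.κ s * t) :
    ∃ C > 0, ∀ lam > 0, ∀ φ : E2 → ℝ, ContDiff ℝ 2 φ →
      (∀ t ∈ Ioo 0 β, ∀ s, lap φ (F.Φ t s) = -lam ^ 2 * φ (F.Φ t s)) →
      (∀ s, F.jb φ 0 s = 0) →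
      ∀ τ, C * (1 + lam) ≤ τ → ∀ t₂ ∈ Icc 0 β,
        ∫ t in (0 : ℝ)..t₂, F.level φ t ≤ C * (exp (C * τ) * F.level φ t₂) := by
  obtain ⟨K, hK0, hK⟩ := F.exists_curvature_bound
  set μ := 8 * K + 2 with hμ
  have hμ0 : 0 < μ := by positivity
  set A := exp (2 * K * β) * (4 * β + 4 * (1 + K * β) + 3) * (exp (2 * K * β) * (4 * (1 + K * β)))
  have hA : 0 ≤ A := by positivity
  set m := μ * exp (μ * β)
  set D := 2 * exp (μ * β)
  set C₁ := exp (2 * K * β) * (1 + K * β) + 1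
  set B := A * m ^ 4 * (24 / (1 : ℝ) ^ 4)
  have hB : 0 ≤ B := by positivity
  refine ⟨D + (1 + D) + B * C₁, by positivity, ?_⟩
  intro lam hlam φ hφ heig hneu τ hτ t₂ ht₂
  set C := D + (1 + D) + B * C₁ with hC
  have hC₁ : 0 < C₁ := by positivity
  have hp : 0 ≤ B * C₁ := by positivity
  have hD : 0 < D := by positivity
  have hτD : 2 * exp (μ * β) * (1 + lam) ≤ τ :=
    (mul_le_mul_of_nonneg_right (by linarith : D ≤ C) (by linarith)).trans hτ
  have hτ0 : 0 ≤ τ := le_trans (by positivity) hτD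
  have hlc := continuous_level (F := F) hφ
  have hl0 := level_nonneg (F := F) hφ
  have hw := fun t => (weight_pos μ τ t).le
  have SN := F.neg.stripJet hφ
  have hx : -carlemanEnergy lam μ τ F.len F.κ (F.ju φ) (F.ja φ) (F.jb φ) 0 ≤
      exp (2 * K * β) * ((1 + K * β) * (weight μ τ t₂ * F.level φ t₂)) := by
    have hJn : ∀ t ∈ Icc (-t₂) 0, ∀ s, 1 / 2 ≤ 1 - F.neg.κ s * t := fun t ht s => by
      have := hJ (-t) ⟨by linarith [ht.2], by linarith [ht.1, ht₂.2]⟩ s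
      simp only [neg_κ]; linarith
    have hsl := fun t (ht : t ∈ Icc (-t₂) 0) => slope_bounds (μ := μ) (by linarith) hlam hτD
      (by linarith [ht.1, ht₂.2] : -β ≤ t) (by linarith [ht.2])
    have h1 := SN.integral_bulkEnergy_le (K := K) (lam := lam) (μ := μ) (τ := τ) (t₁ := -t₂)
      (t₂ := 0) (by linarith [ht₂.1]) (fun s => by simpa using hK s) (by linarith)
      (fun t ht => hJn t (Ioo_subset_Icc_self ht))
      (fun t ht s => by
        rw [F.neg.jp_add_jr hφ, ju, neg_Φ]
        exact heig (-t) ⟨by linarith [ht.2], by linarith [ht.1, ht₂.2]⟩ s)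
      (fun t ht => (hsl t (Ioo_subset_Icc_self ht)).1)
      (fun t ht => (hsl t (Ioo_subset_Icc_self ht)).2.1)
    have h2 : 0 ≤ ∫ t in (-t₂)..0, exp (-(2 * K) * t) *
        bulkEnergy μ τ F.neg.len (F.neg.ju φ) (F.neg.jb φ) t :=
      intervalIntegral.integral_nonneg (by linarith [ht₂.1]) fun t _ =>
        mul_nonneg (exp_pos _).le (SN.bulkEnergy_nonneg μ τ t)
    have h3 := SN.neg_energy_le (lam := lam) (μ := μ) (τ := τ) (t := -t₂) (J₁ := 1 + K * β)
      (hJn _ ⟨le_rfl, by linarith [ht₂.1]⟩) (fun s => by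
        have e : |F.κ s * t₂| ≤ K * β := by
          rw [abs_mul]
          exact mul_le_mul (hK s) (abs_le.2 ⟨by linarith [ht₂.1], ht₂.2⟩) (abs_nonneg _) hK0.le
        have := neg_abs_le (F.κ s * t₂)
        simp only [neg_κ]; linarith)
    have h4 : carlemanEnergy lam μ τ F.neg.len F.neg.κ (F.neg.ju φ) (F.neg.ja φ) (F.neg.jb φ) 0 =
        carlemanEnergy lam μ τ F.len F.κ (F.ju φ) (F.ja φ) (F.jb φ) 0 := by
      refine intervalIntegral.integral_congr fun s _ => ?_
      have e1 : F.neg.jb φ 0 s = 0 := by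
        have := hneu s
        simp only [jb, neg_Φ, neg_n, map_neg, neg_zero] at this ⊢
        rw [this]; simp
      have e2 : F.neg.ju φ 0 s = F.ju φ 0 s := by simp [ju, neg_Φ]
      have e3 : F.neg.ja φ 0 s = F.ja φ 0 s := by simp [ja, neg_Φ]
      simp only [carlemanDensity, e1, e2, e3, hneu s, mul_zero]
    have h5 : levelEnergy F.neg.len (F.neg.ju φ) (F.neg.ja φ) (F.neg.jb φ) (-t₂) =
        F.level φ t₂ := by
      have := F.neg_level φ (-t₂)
      rwa [neg_neg] at this
    rw [h4] at h1
    rw [h5] at h3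
    have h6 : weight μ τ (-t₂) ≤ weight μ τ t₂ := weight_mono hμ0.le hτ0 (by linarith [ht₂.1])
    have h7 : exp (-(2 * K) * -t₂) ≤ exp (2 * K * β) := by
      rw [exp_le_exp]; nlinarith [ht₂.2]
    have h8 : exp (-(2 * K) * -t₂) *
        -carlemanEnergy lam μ τ F.neg.len F.neg.κ (F.neg.ju φ) (F.neg.ja φ) (F.neg.jb φ) (-t₂) ≤
        exp (2 * K * β) * ((1 + K * β) * (weight μ τ t₂ * F.level φ t₂)) := by
      have := hl0 t₂
      have := hw t₂
      have := hw (-t₂)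
      refine (mul_le_mul_of_nonneg_left h3 (exp_pos _).le).trans ?_
      gcongr
    simp only [mul_zero, exp_zero, one_mul] at h1
    linarith
  have hZ := cauchyData_nonneg (F := F) (φ := φ) t₂
  have hZl := cauchyData_le_level (F := F) hφ t₂
  have key := carleman_strip hK0 hK hβ.le (by linarith : -β ≤ 0) le_rfl hμ hJ hlam hφ heig hτD
    le_rfl ht₂.1 ht₂.2 (by have := hl0 t₂; have := hw t₂; positivity) hx
  have hI0 : 0 ≤ ∫ t in (0 : ℝ)..t₂, F.level φ t :=
    intervalIntegral.integral_nonneg ht₂.1 fun t _ => hl0 t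
  have hcw := continuous_weight μ τ
  have hlow : 1 * ∫ t in (0 : ℝ)..t₂, F.level φ t ≤
      ∫ t in (0 : ℝ)..t₂, weight μ τ t * F.level φ t := by
    rw [← intervalIntegral.integral_const_mul]
    exact intervalIntegral.integral_mono_on ht₂.1
      (Continuous.intervalIntegrable (by fun_prop) _ _)
      (Continuous.intervalIntegrable (by fun_prop) _ _) fun t ht =>
        mul_le_mul_of_nonneg_right (one_le_weight hτ0) (hl0 t)
  have hfin := interpolation_of_carleman (A := A) (d := 1) (m := m) (D := D) (τ := τ)
    (I := ∫ t in (0 : ℝ)..t₂, F.level φ t) (Z := C₁ * F.level φ t₂) (Y := 0)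
    (w₀ := 1) (w₁ := 0) (w₂ := weight μ τ t₂) hA one_pos hτ0
    (mul_nonneg hC₁.le (hl0 t₂)) le_rfl le_rfl (by positivity)
    (weight_le_exp hμ0.le hτ0 ht₂.2) ?_
  · refine hfin.trans ?_
    have := hl0 t₂
    calc _ = B * C₁ * (exp ((1 + D) * τ) * F.level φ t₂) := by
          simp only [mul_zero, add_zero]
          ring
      _ ≤ _ := by gcongr <;> linarith
  · refine hlow.trans (key.trans ?_)
    have hw2 := hw t₂
    have : exp (2 * K * β) * ((1 + K * β) * (weight μ τ t₂ * F.level φ t₂)) +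
        weight μ τ t₂ * F.cauchyData φ t₂ ≤ 0 * 0 + weight μ τ t₂ * (C₁ * F.level φ t₂) := by
      have h9 := mul_le_mul_of_nonneg_left hZl hw2
      calc _ ≤ exp (2 * K * β) * ((1 + K * β) * (weight μ τ t₂ * F.level φ t₂)) +
            weight μ τ t₂ * F.level φ t₂ := by linarith
        _ = _ := by change _ = 0 * 0 + weight μ τ t₂ * ((exp (2 * K * β) * (1 + K * β) + 1) * _); ring
    gcongr

end Frame

/-- A globally smooth Neumann eigenfunction with positive frequency. -/
structure Eig {Ω : Set E2} (B : BoundaryParam Ω) (lam : ℝ) (φ : E2 → ℝ) : Prop where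
  pos : 0 < lam
  contDiff : ContDiff ℝ (⊤ : ℕ∞) φ
  isEigenfunction : IsNeumannEigenfunction B lam φ

lemma inner_gradient (φ : E2 → ℝ) (x v : E2) : ⟪gradient φ x, v⟫ = fderiv ℝ φ x v := by
  rw [gradient, InnerProductSpace.toDual_symm_apply]

namespace Eig

variable {Ω : Set E2} {B : BoundaryParam Ω} {lam : ℝ} {φ : E2 → ℝ} (h : Eig B lam φ)
include h

lemma smooth : ContDiff ℝ 2 φ := h.contDiff.of_le (WithTop.coe_le_coe.2 (le_top : (2 : ℕ∞) ≤ ⊤))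

lemma eigen : ∀ x ∈ Ω, lap φ x = -lam ^ 2 * φ x := h.isEigenfunction.eigen

lemma neumann (s : ℝ) : fderiv ℝ φ (B.q s) (B.ν s) = 0 := by
  rw [← inner_gradient, h.isEigenfunction.neumann]

end Eig

lemma setIntegral_union_le {ρ : E2 → ℝ} {Ω S T : Set E2} (hρ : IntegrableOn ρ Ω) (h0 : ∀ x, 0 ≤ ρ x)
    (hS : S ⊆ Ω) (hT : T ⊆ Ω) : ∫ x in S ∪ T, ρ x ≤ (∫ x in S, ρ x) + ∫ x in T, ρ x := by
  have iS := hρ.mono_set hS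
  have iT := hρ.mono_set hT
  rw [← integral_add_measure iS iT]
  exact integral_mono_measure (Measure.restrict_union_le S T) (ae_of_all _ h0)
    (Integrable.add_measure iS iT)

lemma setIntegral_mono_subset {ρ : E2 → ℝ} {S T : Set E2} (hρ : IntegrableOn ρ T)
    (h0 : ∀ x, 0 ≤ ρ x) (hS : S ⊆ T) : ∫ x in S, ρ x ≤ ∫ x in T, ρ x :=
  setIntegral_mono_set hρ (ae_of_all _ h0) hS.eventuallyLE

lemma integrableOn_of_isBounded {Ω : Set E2} (hΩ : Bornology.IsBounded Ω) {ρ : E2 → ℝ}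
    (hρ : Continuous ρ) : IntegrableOn ρ Ω :=
  (hρ.continuousOn.integrableOn_compact hΩ.isCompact_closure).mono_set subset_closure

lemma interpolation_mono {A a D d C c τ N E : ℝ} (hτ : 0 ≤ τ) (hN : 0 ≤ N) (hE : 0 ≤ E)
    (hC : 0 ≤ C) (hA : A ≤ C) (ha : a ≤ C) (hD : D ≤ C) (hc : c ≤ d) :
    A * (exp (a * τ) * N) + D * (exp (-(d * τ)) * E) ≤
      C * (exp (C * τ) * N + exp (-(c * τ)) * E) := by
  rw [mul_add]
  gcongr

/-- The energy on `S ∩ Ω` of all eigenfunctions is controlled by the functional `N` up to an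
exponentially small multiple of the full energy. -/
def Controlled {Ω : Set E2} (B : BoundaryParam Ω) (N : (E2 → ℝ) → ℝ) (S : Set E2) : Prop :=
  ∃ C > 0, ∃ c > 0, ∀ lam φ, Eig B lam φ → ∀ τ, C * (1 + lam) ≤ τ →
    ∫ x in S ∩ Ω, energyDensity φ x ≤
      C * (exp (C * τ) * N φ + exp (-(c * τ)) * ∫ x in Ω, energyDensity φ x)

namespace Controlled

variable {Ω : Set E2} {B : BoundaryParam Ω} {N : (E2 → ℝ) → ℝ} {S T : Set E2}

lemma inter (h : Controlled B N (S ∩ Ω)) : Controlled B N S := by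
  unfold Controlled at *
  simpa only [inter_assoc, inter_self] using h

lemma mono (hΩ : IsPlaneDomain Ω) (hST : S ⊆ T) (h : Controlled B N T) : Controlled B N S := by
  obtain ⟨C, hC, c, hc, h⟩ := h
  refine ⟨C, hC, c, hc, fun lam φ hφ τ hτ => le_trans ?_ (h lam φ hφ τ hτ)⟩
  have hρ := continuous_energyDensity (hφ.smooth.of_le one_le_two)
  exact setIntegral_mono_subset ((integrableOn_of_isBounded hΩ.isBounded hρ).mono_set
    inter_subset_right) (energyDensity_nonneg φ) (inter_subset_inter_left _ hST)

lemma union (hΩ : IsPlaneDomain Ω) (hN : ∀ φ, 0 ≤ N φ) (hS : Controlled B N S)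
    (hT : Controlled B N T) : Controlled B N (S ∪ T) := by
  obtain ⟨C₁, hC₁, c₁, hc₁, h₁⟩ := hS
  obtain ⟨C₂, hC₂, c₂, hc₂, h₂⟩ := hT
  refine ⟨C₁ + C₂, by positivity, min c₁ c₂, lt_min hc₁ hc₂, fun lam φ hφ τ hτ => ?_⟩
  have hlam := hφ.pos
  have hρ := integrableOn_of_isBounded hΩ.isBounded
    (continuous_energyDensity (hφ.smooth.of_le one_le_two))
  have hE : 0 ≤ ∫ x in Ω, energyDensity φ x := integral_nonneg (energyDensity_nonneg φ)
  have hτ0 : 0 ≤ τ := le_trans (by positivity) hτ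
  have a₁ := h₁ lam φ hφ τ (by nlinarith)
  have a₂ := h₂ lam φ hφ τ (by nlinarith)
  have hN := hN φ
  rw [union_inter_distrib_right]
  refine (setIntegral_union_le hρ (energyDensity_nonneg φ) inter_subset_right
    inter_subset_right).trans ?_
  have e₁ : exp (C₁ * τ) ≤ exp ((C₁ + C₂) * τ) := by gcongr; linarith
  have e₂ : exp (C₂ * τ) ≤ exp ((C₁ + C₂) * τ) := by gcongr; linarith
  have e₃ : exp (-(c₁ * τ)) ≤ exp (-(min c₁ c₂ * τ)) := by gcongr; exact min_le_left _ _
  have e₄ : exp (-(c₂ * τ)) ≤ exp (-(min c₁ c₂ * τ)) := by gcongr; exact min_le_right _ _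
  rw [add_mul]
  refine add_le_add (a₁.trans ?_) (a₂.trans ?_) <;> gcongr

/-- Control propagates through an interpolation inequality. -/
lemma of_interpolation (hN : ∀ φ, 0 ≤ N φ) (hS : Controlled B N S) {C c : ℝ} (hC : 0 < C)
    (hc : 0 < c)
    (h : ∀ lam φ, Eig B lam φ → ∀ τ, C * (1 + lam) ≤ τ →
      ∫ x in T ∩ Ω, energyDensity φ x ≤
        C * (exp (C * τ) * (∫ x in S ∩ Ω, energyDensity φ x) +
          exp (-(c * τ)) * ∫ x in Ω, energyDensity φ x)) : Controlled B N T := by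
  obtain ⟨C₁, hC₁, c₁, hc₁, h₁⟩ := hS
  set k := 1 + (C + 1) / c₁ with hk
  have hk1 : 1 ≤ k := by have : 0 ≤ (C + 1) / c₁ := by positivity
                         linarith
  refine ⟨C + C₁ + C * C₁ + C₁ * k, by positivity, min c 1, lt_min hc one_pos,
    fun lam φ hφ τ hτ => ?_⟩
  have hlam := hφ.pos
  have hE : 0 ≤ ∫ x in Ω, energyDensity φ x := integral_nonneg (energyDensity_nonneg φ)
  have hτ0 : 0 ≤ τ := le_trans (by positivity) hτ
  have hCC : 0 < C * C₁ := by positivity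
  have hCk : 0 < C₁ * k := by positivity
  have a := h lam φ hφ τ (le_trans (by gcongr; linarith) hτ)
  have b := h₁ lam φ hφ (k * τ) (by
    refine le_trans ?_ (le_mul_of_one_le_left hτ0 hk1)
    exact le_trans (by gcongr; linarith) hτ)
  have hN := hN φ
  set E := ∫ x in Ω, energyDensity φ x
  have hck : C + 1 ≤ c₁ * k := by
    have : c₁ * ((C + 1) / c₁) = C + 1 := by field_simp
    rw [hk, mul_add, this]; linarith
  have e1 : exp (C * τ) * exp (C₁ * (k * τ)) = exp ((C + C₁ * k) * τ) := by
    rw [← exp_add]; ring_nf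
  have e2 : exp (C * τ) * exp (-(c₁ * (k * τ))) ≤ exp (-(min c 1 * τ)) := by
    rw [← exp_add, exp_le_exp]
    have : min c 1 * τ ≤ 1 * τ := by gcongr; exact min_le_right _ _
    nlinarith
  have e3 : exp (-(c * τ)) ≤ exp (-(min c 1 * τ)) := by gcongr; exact min_le_left _ _
  calc _ ≤ C * (exp (C * τ) * (C₁ * (exp (C₁ * (k * τ)) * N φ + exp (-(c₁ * (k * τ))) * E)) +
        exp (-(c * τ)) * E) := a.trans (by gcongr)
    _ = C * C₁ * (exp ((C + C₁ * k) * τ) * N φ) +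
        (C * C₁ * ((exp (C * τ) * exp (-(c₁ * (k * τ)))) * E) + C * (exp (-(c * τ)) * E)) := by
          rw [← e1]; ring
    _ ≤ C * C₁ * (exp ((C + C₁ * k) * τ) * N φ) +
        (C * C₁ * (exp (-(min c 1 * τ)) * E) + C * (exp (-(min c 1 * τ)) * E)) := by gcongr
    _ = C * C₁ * (exp ((C + C₁ * k) * τ) * N φ) +
        (C * C₁ + C) * (exp (-(min c 1 * τ)) * E) := by ring
    _ ≤ _ := interpolation_mono hτ0 hN hE (by positivity) (by linarith) (by linarith)
        (by linarith) le_rfl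

end Controlled

namespace Frame

variable (F : Frame)

lemma exists_energy_compare {α β : ℝ} (hJ : ∀ t ∈ Icc α β, ∀ s, 1 / 2 ≤ 1 - F.κ s * t) :
    ∃ C : ℝ, 0 < C ∧ ∀ φ : E2 → ℝ, ContDiff ℝ 2 φ →
      ∀ α₁ β₁, α ≤ α₁ → α₁ ≤ β₁ → β₁ ≤ β →
      ∫ x in F.region α₁ β₁, energyDensity φ x ≤ C * ∫ t in α₁..β₁, F.level φ t ∧
      ∫ t in α₁..β₁, F.level φ t ≤ C * ∫ x in F.region α₁ β₁, energyDensity φ x := by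
  obtain ⟨C, hC, h⟩ := F.exists_integral_compare hJ
  refine ⟨C, hC, fun φ hφ α₁ β₁ h1 h2 h3 => ?_⟩
  have := h _ (continuous_energyDensity (hφ.of_le one_le_two)) (energyDensity_nonneg φ) α₁ β₁ h1 h2 h3
  simpa only [level, levelEnergy_eq] using this

variable {Ω : Set E2} {B : BoundaryParam Ω} {N : (E2 → ℝ) → ℝ}

/-- Control propagates across an interior strip. -/
lemma controlled_interior (hΩ : IsPlaneDomain Ω) (hN : ∀ φ, 0 ≤ N φ) {α α' m β : ℝ} (hα : α < α')
    (hα' : α' < m) (hm : m < β) (hJ : ∀ t ∈ Icc α β, ∀ s, 1 / 2 ≤ 1 - F.κ s * t)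
    (hF : ∀ t ∈ Icc α β, ∀ s, F.Φ t s ∈ Ω) (h : Controlled B N (F.region m β)) :
    Controlled B N (F.region α' β) := by
  obtain ⟨C₁, hC₁, hcmp⟩ := F.exists_energy_compare hJ
  obtain ⟨C₂, hC₂, c, hc, hest⟩ := F.exists_strip_estimate hα (hα'.trans hm).le hJ
  have hreg : ∀ {a b : ℝ}, α ≤ a → b ≤ β → F.region a b ⊆ Ω := by
    rintro a b ha hb _ ⟨t, ht, s, rfl⟩
    exact hF t ⟨ha.trans ht.1.le, ht.2.trans hb⟩ s
  have hδ : 0 < β - m := by linarith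
  set A := C₁ * (C₂ * (C₁ / (β - m))) + 1 with hA
  have hA0 : 0 < C₁ * (C₂ * (C₁ / (β - m))) := by positivity
  set D := C₁ * (C₂ * C₁) with hD
  have hD0 : 0 < D := by positivity
  refine h.of_interpolation (C := A + D + C₂) hN (by positivity) hc fun lam φ hφ τ hτ => ?_
  have hlam := hφ.pos
  have hρ := integrableOn_of_isBounded hΩ.isBounded
    (continuous_energyDensity (hφ.smooth.of_le one_le_two))
  have h0 := energyDensity_nonneg φ
  have hE : 0 ≤ ∫ x in Ω, energyDensity φ x := integral_nonneg h0
  have hτ0 : 0 ≤ τ := le_trans (by positivity) hτ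
  rw [inter_eq_left.2 (hreg (by linarith) le_rfl), inter_eq_left.2 (hreg (by linarith) le_rfl)]
  obtain ⟨t₂, ht₂, hlev⟩ := exists_level_le (continuous_level (F := F) hφ.smooth) hm.le
  have b1 := (hcmp φ hφ.smooth m β (by linarith) hm.le le_rfl).2
  have b2 := (hcmp φ hφ.smooth α' t₂ hα.le (by linarith [ht₂.1]) ht₂.2).1
  have b3 := (hcmp φ hφ.smooth α α' le_rfl hα.le (by linarith)).2
  have b4 := hest lam hlam φ hφ.smooth
    (fun t ht s => hφ.eigen _ (hF t (Ioo_subset_Icc_self ht) s)) τ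
    (le_trans (by gcongr; linarith) hτ) t₂ ⟨by linarith [ht₂.1], ht₂.2⟩
  have b5 := cauchyData_le_level (F := F) hφ.smooth t₂
  have b6 := setIntegral_mono_subset hρ h0 (hreg (a := α) (b := α') le_rfl (by linarith))
  have b7 : ∫ x in F.region α' β, energyDensity φ x ≤ (∫ x in F.region α' t₂, energyDensity φ x) +
      ∫ x in F.region m β, energyDensity φ x :=
    (setIntegral_mono_subset (hρ.mono_set (union_subset (hreg hα.le ht₂.2)
        (hreg (by linarith) le_rfl))) h0 ((F.region_union α' t₂ β).trans
        (union_subset_union_right _ (F.region_mono ht₂.1 le_rfl)))).trans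
      (setIntegral_union_le hρ h0 (hreg hα.le ht₂.2) (hreg (by linarith) le_rfl))
  set e := ∫ x in F.region m β, energyDensity φ x
  have he : 0 ≤ e := integral_nonneg h0
  set E := ∫ x in Ω, energyDensity φ x
  have b8 : F.cauchyData φ t₂ ≤ C₁ / (β - m) * e := by
    rw [div_mul_eq_mul_div, le_div_iff₀ hδ]
    calc _ ≤ F.level φ t₂ * (β - m) := by gcongr
      _ ≤ _ := hlev.trans b1
  have b9 : ∫ t in α..α', F.level φ t ≤ C₁ * E := b3.trans (by gcongr)
  have b10 : e ≤ exp (C₂ * τ) * e := le_mul_of_one_le_left he (one_le_exp (by positivity))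
  calc _ ≤ C₁ * (C₂ * (exp (C₂ * τ) * (C₁ / (β - m) * e) + exp (-(c * τ)) * (C₁ * E))) +
        exp (C₂ * τ) * e := by
        refine b7.trans (add_le_add (b2.trans ?_) b10)
        refine mul_le_mul_of_nonneg_left (b4.trans ?_) hC₁.le
        gcongr
    _ = A * (exp (C₂ * τ) * e) + D * (exp (-(c * τ)) * E) := by rw [hA, hD]; ring
    _ ≤ _ := interpolation_mono hτ0 he hE (by positivity) (by linarith) (by linarith)
        (by linarith) le_rfl

/-- Control propagates up to the boundary. -/
lemma controlled_boundary (hΩ : IsPlaneDomain Ω) (hN : ∀ φ, 0 ≤ N φ) {m β : ℝ} (hm0 : 0 < m)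
    (hm : m < β) (hJ : ∀ t ∈ Icc 0 β, ∀ s, 1 / 2 ≤ 1 - F.κ s * t)
    (hF : ∀ t ∈ Ioc 0 β, ∀ s, F.Φ t s ∈ Ω)
    (hneu : ∀ lam φ, Eig B lam φ → ∀ s, fderiv ℝ φ (F.γ s) (F.n s) = 0)
    (h : Controlled B N (F.region m β)) :
    Controlled B N (F.region 0 β) := by
  obtain ⟨C₁, hC₁, hcmp⟩ := F.exists_energy_compare hJ
  obtain ⟨C₂, hC₂, hest⟩ := F.exists_boundary_estimate (hm0.trans hm) hJ
  have hreg : ∀ {a b : ℝ}, 0 ≤ a → b ≤ β → F.region a b ⊆ Ω := by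
    rintro a b ha hb _ ⟨t, ht, s, rfl⟩
    exact hF t ⟨ha.trans_lt ht.1, ht.2.trans hb⟩ s
  have hδ : 0 < β - m := by linarith
  set A := C₁ * (C₂ * (C₁ / (β - m))) + 1 with hA
  have hA0 : 0 < C₁ * (C₂ * (C₁ / (β - m))) := by positivity
  refine h.of_interpolation (C := A + C₂) (c := 1) hN (by positivity) one_pos
    fun lam φ hφ τ hτ => ?_
  have hlam := hφ.pos
  have hρ := integrableOn_of_isBounded hΩ.isBounded
    (continuous_energyDensity (hφ.smooth.of_le one_le_two))
  have h0 := energyDensity_nonneg φ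
  have hE : 0 ≤ ∫ x in Ω, energyDensity φ x := integral_nonneg h0
  have hτ0 : 0 ≤ τ := le_trans (by positivity) hτ
  rw [inter_eq_left.2 (hreg le_rfl le_rfl), inter_eq_left.2 (hreg (by linarith) le_rfl)]
  obtain ⟨t₂, ht₂, hlev⟩ := exists_level_le (continuous_level (F := F) hφ.smooth) hm.le
  have b1 := (hcmp φ hφ.smooth m β (by linarith) hm.le le_rfl).2
  have b2 := (hcmp φ hφ.smooth 0 t₂ le_rfl (by linarith [ht₂.1]) ht₂.2).1
  have b4 := hest lam hlam φ hφ.smooth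
    (fun t ht s => hφ.eigen _ (hF t (Ioo_subset_Ioc_self ht) s))
    (fun s => by simpa [jb, Φ] using hneu lam φ hφ s) τ
    (le_trans (by gcongr; linarith) hτ) t₂ ⟨by linarith [ht₂.1], ht₂.2⟩
  have b7 : ∫ x in F.region 0 β, energyDensity φ x ≤ (∫ x in F.region 0 t₂, energyDensity φ x) +
      ∫ x in F.region m β, energyDensity φ x :=
    (setIntegral_mono_subset (hρ.mono_set (union_subset (hreg le_rfl ht₂.2)
        (hreg (by linarith) le_rfl))) h0 ((F.region_union 0 t₂ β).trans
        (union_subset_union_right _ (F.region_mono ht₂.1 le_rfl)))).trans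
      (setIntegral_union_le hρ h0 (hreg le_rfl ht₂.2) (hreg (by linarith) le_rfl))
  set e := ∫ x in F.region m β, energyDensity φ x
  have he : 0 ≤ e := integral_nonneg h0
  set E := ∫ x in Ω, energyDensity φ x
  have b8 : F.level φ t₂ ≤ C₁ / (β - m) * e := by
    rw [div_mul_eq_mul_div, le_div_iff₀ hδ]
    exact hlev.trans b1
  have b10 : e ≤ exp (C₂ * τ) * e := le_mul_of_one_le_left he (one_le_exp (by positivity))
  calc _ ≤ C₁ * (C₂ * (exp (C₂ * τ) * (C₁ / (β - m) * e))) + exp (C₂ * τ) * e := by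
        refine b7.trans (add_le_add (b2.trans ?_) b10)
        refine mul_le_mul_of_nonneg_left (b4.trans ?_) hC₁.le
        gcongr
    _ = A * (exp (C₂ * τ) * e) + 0 * (exp (-(1 * τ)) * E) := by rw [hA]; ring
    _ ≤ _ := interpolation_mono hτ0 he hE (by positivity) (by linarith) (by linarith)
        (by positivity) le_rfl

/-- Control of the Cauchy data on the base curve of a frame gives control on a strip. -/
lemma controlled_base (hΩ : IsPlaneDomain Ω) (hN : ∀ φ, 0 ≤ N φ) {α α' C₀ : ℝ} (hα : α < α')
    (hα' : α' < 0) (hJ : ∀ t ∈ Icc α 0, ∀ s, 1 / 2 ≤ 1 - F.κ s * t)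
    (hF : ∀ t ∈ Icc α 0, ∀ s, F.Φ t s ∈ Ω) (hC₀ : 0 < C₀)
    (h : ∀ lam φ, Eig B lam φ → F.cauchyData φ 0 ≤ C₀ * exp (C₀ * lam) * N φ) :
    Controlled B N (F.region α' 0) := by
  obtain ⟨C₁, hC₁, hcmp⟩ := F.exists_energy_compare hJ
  obtain ⟨C₂, hC₂, c, hc, hest⟩ := F.exists_strip_estimate hα hα'.le hJ
  have hreg : ∀ {a b : ℝ}, α ≤ a → b ≤ 0 → F.region a b ⊆ Ω := by
    rintro a b ha hb _ ⟨t, ht, s, rfl⟩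
    exact hF t ⟨ha.trans ht.1.le, ht.2.trans hb⟩ s
  set A := C₁ * (C₂ * C₀) with hA
  have hA0 : 0 < A := by positivity
  set D := C₁ * (C₂ * C₁) with hD
  have hD0 : 0 < D := by positivity
  refine ⟨A + D + (C₂ + C₀) + 1, by positivity, c, hc, fun lam φ hφ τ hτ => ?_⟩
  have hlam := hφ.pos
  have hρ := integrableOn_of_isBounded hΩ.isBounded
    (continuous_energyDensity (hφ.smooth.of_le one_le_two))
  have h0 := energyDensity_nonneg φ
  have hE : 0 ≤ ∫ x in Ω, energyDensity φ x := integral_nonneg h0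
  have hτ0 : 0 ≤ τ := le_trans (by positivity) hτ
  rw [inter_eq_left.2 (hreg hα.le le_rfl)]
  have b2 := (hcmp φ hφ.smooth α' 0 hα.le hα'.le le_rfl).1
  have b3 := (hcmp φ hφ.smooth α α' le_rfl hα.le (by linarith)).2
  have b4 := hest lam hlam φ hφ.smooth
    (fun t ht s => hφ.eigen _ (hF t (Ioo_subset_Icc_self ht) s)) τ
    (le_trans (by gcongr; linarith) hτ) 0 ⟨hα'.le, le_rfl⟩
  have b6 := setIntegral_mono_subset hρ h0 (hreg (a := α) (b := α') le_rfl (by linarith))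
  have hN := hN φ
  have b5 := h lam φ hφ
  set E := ∫ x in Ω, energyDensity φ x
  have hlt : lam ≤ τ := by
    refine le_trans ?_ hτ
    have : 0 < A + D + (C₂ + C₀) := by positivity
    nlinarith
  have b8 : F.cauchyData φ 0 ≤ C₀ * (exp (C₀ * τ) * N φ) := by
    refine b5.trans ?_
    rw [mul_assoc]
    gcongr
  have b9 : ∫ t in α..α', F.level φ t ≤ C₁ * E := b3.trans (by gcongr)
  calc _ ≤ C₁ * (C₂ * (exp (C₂ * τ) * (C₀ * (exp (C₀ * τ) * N φ)) +
          exp (-(c * τ)) * (C₁ * E))) := by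
        refine b2.trans ?_
        refine mul_le_mul_of_nonneg_left (b4.trans ?_) hC₁.le
        gcongr
    _ = A * (exp ((C₂ + C₀) * τ) * N φ) + D * (exp (-(c * τ)) * E) := by
        rw [hA, hD, add_mul C₂, exp_add]; ring
    _ ≤ _ := interpolation_mono hτ0 hN hE (by positivity) (by linarith) (by linarith)
        (by linarith) le_rfl

end Frame

lemma sq_integral_le {h : ℝ → ℝ} (hh : Continuous h) {a b : ℝ} (hab : a ≤ b) :
    (∫ t in a..b, h t) ^ 2 ≤ (b - a) * ∫ t in a..b, h t ^ 2 := by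
  rcases hab.eq_or_lt with rfl | hab
  · simp
  have hL : 0 < b - a := by linarith
  set M := ∫ t in a..b, h t with hM
  have h1 : 0 ≤ ∫ t in a..b, (h t - M / (b - a)) ^ 2 :=
    intervalIntegral.integral_nonneg hab.le fun _ _ => sq_nonneg _
  have h2 : ∫ t in a..b, (h t - M / (b - a)) ^ 2 =
      (∫ t in a..b, h t ^ 2) - 2 * (M / (b - a)) * M + (M / (b - a)) ^ 2 * (b - a) := by
    have e : ∀ t, (h t - M / (b - a)) ^ 2 =
        h t ^ 2 - 2 * (M / (b - a)) * h t + (M / (b - a)) ^ 2 := fun t => by ring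
    simp only [e]
    rw [intervalIntegral.integral_add, intervalIntegral.integral_sub,
      intervalIntegral.integral_const_mul, intervalIntegral.integral_const]
    · simp only [smul_eq_mul, ← hM]; ring
    all_goals exact Continuous.intervalIntegrable (by fun_prop) _ _
  have h3 : (b - a) * ((∫ t in a..b, h t ^ 2) - 2 * (M / (b - a)) * M +
      (M / (b - a)) ^ 2 * (b - a)) = (b - a) * (∫ t in a..b, h t ^ 2) - M ^ 2 := by
    field_simp; ring
  have := mul_nonneg hL.le (h2 ▸ h1)
  linarith

lemma sq_le_sq_add_integral {g g' : ℝ → ℝ} (hg : ∀ t, HasDerivAt g (g' t) t) (hg' : Continuous g')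
    {a b x y : ℝ} (hx : x ∈ Icc a b) (hy : y ∈ Icc a b) :
    g x ^ 2 ≤ 2 * g y ^ 2 + 2 * ((b - a) * ∫ t in a..b, g' t ^ 2) := by
  have hab : a ≤ b := hx.1.trans hx.2
  have h1 : g x - g y = ∫ t in y..x, g' t :=
    (intervalIntegral.integral_eq_sub_of_hasDerivAt (fun t _ => hg t)
      (hg'.intervalIntegrable _ _)).symm
  have h2 : |g x - g y| ≤ ∫ t in a..b, |g' t| := by
    rw [h1]
    refine (intervalIntegral.norm_integral_le_abs_integral_norm (f := g')).trans ?_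
    simp only [norm_eq_abs]
    refine (intervalIntegral.abs_integral_mono_interval ?_ (ae_of_all _ fun t => abs_nonneg _)
      (hg'.abs.intervalIntegrable a b)).trans (le_of_eq (abs_of_nonneg ?_))
    · rw [uIoc_of_le hab]
      exact Ioc_subset_Ioc (le_min hy.1 hx.1) (max_le hy.2 hx.2)
    · exact intervalIntegral.integral_nonneg hab fun _ _ => abs_nonneg _
  have h3 := sq_integral_le hg'.abs hab
  simp only [sq_abs] at h3
  have h4 : (g x - g y) ^ 2 ≤ (b - a) * ∫ t in a..b, g' t ^ 2 := by
    rw [← sq_abs]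
    exact (pow_le_pow_left₀ (abs_nonneg _) h2 2).trans h3
  nlinarith [sq_nonneg (g x - 2 * g y)]

namespace Frame

variable (F : Frame) {f : E2 → ℝ}

lemma sq_jb_le (t s : ℝ) : F.jb f t s ^ 2 ≤ ‖fderiv ℝ f (F.Φ t s)‖ ^ 2 := by
  rw [← sq_abs]
  refine pow_le_pow_left₀ (abs_nonneg _) ?_ 2
  simpa [jb, F.norm_n s] using (fderiv ℝ f (F.Φ t s)).le_opNorm (F.n s)

lemma continuous_sq_norm_fderiv (hf : ContDiff ℝ 2 f) : Continuous fun x => ‖fderiv ℝ f x‖ ^ 2 :=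
  ((hf.continuous_fderiv (by norm_num)).norm).pow 2

/-- Comparison of the mass of a function on two levels of a strip. -/
lemma integral_sq_ju_le (hf : ContDiff ℝ 2 f) {α β t t₂ : ℝ} (ht : t ∈ Icc α β)
    (ht₂ : t₂ ∈ Icc α β) :
    ∫ s in (0 : ℝ)..F.len, F.ju f t s ^ 2 ≤ 2 * (∫ s in (0 : ℝ)..F.len, F.ju f t₂ s ^ 2) +
      2 * ((β - α) * ∫ t in α..β, ∫ s in (0 : ℝ)..F.len, ‖fderiv ℝ f (F.Φ t s)‖ ^ 2) := by
  have S := F.stripJet hf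
  have hαβ : α ≤ β := ht.1.trans ht.2
  have cb := S.contb
  have cu := continuous_section S.contu
  have cΦ : Continuous fun p : ℝ × ℝ => F.Φ p.1 p.2 := F.continuous_Φ
  have cf := continuous_sq_norm_fderiv hf
  have cb2 : Continuous (uncurry fun t s => F.jb f t s ^ 2) := cb.pow 2
  have cb3 : Continuous fun s => ∫ t in α..β, F.jb f t s ^ 2 :=
    intervalIntegral.continuous_parametric_intervalIntegral_of_continuous'
      (f := fun s t => F.jb f t s ^ 2) (cb2.comp continuous_swap) α β
  have h1 : ∫ s in (0 : ℝ)..F.len, F.ju f t s ^ 2 ≤ ∫ s in (0 : ℝ)..F.len,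
      (2 * F.ju f t₂ s ^ 2 + 2 * ((β - α) * ∫ t in α..β, F.jb f t s ^ 2)) := by
    have c1 := cu t; have c2 := cu t₂
    refine intervalIntegral.integral_mono_on F.len_pos.le
      (Continuous.intervalIntegrable (by fun_prop) _ _)
      (Continuous.intervalIntegrable (by fun_prop) _ _) fun s _ => ?_
    refine sq_le_sq_add_integral (g := fun t => F.ju f t s) (fun t => S.u_t t s) ?_ ht ht₂
    exact cb.comp (by fun_prop : Continuous fun t : ℝ => (t, s))
  have h2 : ∫ s in (0 : ℝ)..F.len, ∫ t in α..β, F.jb f t s ^ 2 =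
      ∫ t in α..β, ∫ s in (0 : ℝ)..F.len, F.jb f t s ^ 2 := by
    refine intervalIntegral_intervalIntegral_swap (F := fun s t => F.jb f t s ^ 2) ?_
    exact (cb2.comp continuous_swap).continuousOn.integrableOn_compact
      (isCompact_uIcc.prod isCompact_uIcc) |>.mono_set
        (prod_mono uIoc_subset_uIcc uIoc_subset_uIcc)
  have h3 : ∫ t in α..β, ∫ s in (0 : ℝ)..F.len, F.jb f t s ^ 2 ≤
      ∫ t in α..β, ∫ s in (0 : ℝ)..F.len, ‖fderiv ℝ f (F.Φ t s)‖ ^ 2 := by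
    have cfΦ : Continuous (uncurry fun t s => ‖fderiv ℝ f (F.Φ t s)‖ ^ 2) := cf.comp cΦ
    refine intervalIntegral.integral_mono_on hαβ
      (Continuous.intervalIntegrable
        (intervalIntegral.continuous_parametric_intervalIntegral_of_continuous' cb2 _ _) _ _)
      (Continuous.intervalIntegrable
        (intervalIntegral.continuous_parametric_intervalIntegral_of_continuous' cfΦ _ _) _ _)
      fun t _ => ?_
    exact intervalIntegral.integral_mono_on F.len_pos.le
      ((continuous_section cb2 t).intervalIntegrable _ _)
      ((continuous_section cfΦ t).intervalIntegrable _ _) fun s _ => F.sq_jb_le t s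
  refine h1.trans ?_
  have c2 := cu t₂
  rw [intervalIntegral.integral_add (Continuous.intervalIntegrable (by fun_prop) _ _)
      (Continuous.intervalIntegrable (by fun_prop) _ _), intervalIntegral.integral_const_mul,
    intervalIntegral.integral_const_mul, intervalIntegral.integral_const_mul, h2]
  have : 0 ≤ β - α := by linarith
  gcongr

/-- The mass in a strip is controlled by the mass on one level and the Dirichlet energy. -/
lemma exists_sq_le_level {α β : ℝ} (hαβ : α ≤ β)
    (hJ : ∀ t ∈ Icc α β, ∀ s, 1 / 2 ≤ 1 - F.κ s * t) :
    ∃ C : ℝ, 0 < C ∧ ∀ f : E2 → ℝ, ContDiff ℝ 2 f → ∀ t₂ ∈ Icc α β,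
      ∫ x in F.region α β, f x ^ 2 ≤ C * ((∫ s in (0 : ℝ)..F.len, F.ju f t₂ s ^ 2) +
        ∫ x in F.region α β, ‖fderiv ℝ f x‖ ^ 2) := by
  obtain ⟨C₁, hC₁, hcmp⟩ := F.exists_integral_compare hJ
  have hL : 0 ≤ β - α := by linarith
  refine ⟨C₁ * ((β - α) * 2) + C₁ * ((β - α) * (2 * ((β - α) * C₁))) + 1, by positivity,
    fun f hf t₂ ht₂ => ?_⟩
  have b1 := (hcmp (fun x => f x ^ 2) (hf.continuous.pow 2) (fun x => sq_nonneg _) α β le_rfl hαβ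
    le_rfl).1
  have b2 := (hcmp _ (continuous_sq_norm_fderiv hf) (fun x => sq_nonneg _) α β le_rfl hαβ le_rfl).2
  set U := ∫ s in (0 : ℝ)..F.len, F.ju f t₂ s ^ 2 with hU
  have hU0 : 0 ≤ U := intervalIntegral.integral_nonneg F.len_pos.le fun _ _ => sq_nonneg _
  set G := ∫ x in F.region α β, ‖fderiv ℝ f x‖ ^ 2
  have hG0 : 0 ≤ G := integral_nonneg fun _ => sq_nonneg _
  have S := F.stripJet hf
  have cu2 : Continuous (uncurry fun t s => F.ju f t s ^ 2) := S.contu.pow 2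
  have b3 : ∫ t in α..β, ∫ s in (0 : ℝ)..F.len, f (F.Φ t s) ^ 2 ≤
      ∫ _ in α..β, (2 * U + 2 * ((β - α) * (C₁ * G))) := by
    refine intervalIntegral.integral_mono_on hαβ
      (Continuous.intervalIntegrable
        (intervalIntegral.continuous_parametric_intervalIntegral_of_continuous' cu2 _ _) _ _)
      (Continuous.intervalIntegrable (by fun_prop) _ _) fun t ht => ?_
    refine (F.integral_sq_ju_le hf ht ht₂).trans ?_
    gcongr
  rw [intervalIntegral.integral_const, smul_eq_mul] at b3
  have p1 : 0 ≤ C₁ * ((β - α) * 2) := by positivity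
  have p2 : 0 ≤ C₁ * ((β - α) * (2 * ((β - α) * C₁))) := by positivity
  calc _ ≤ C₁ * ((β - α) * (2 * U + 2 * ((β - α) * (C₁ * G)))) := b1.trans (by gcongr)
    _ = C₁ * ((β - α) * 2) * U + C₁ * ((β - α) * (2 * ((β - α) * C₁))) * G := by ring
    _ ≤ _ := by
      rw [mul_add]
      gcongr <;> linarith

/-- Poincaré inequality on a strip. -/
lemma exists_poincare {α β : ℝ} (hαβ : α < β)
    (hJ : ∀ t ∈ Icc α β, ∀ s, 1 / 2 ≤ 1 - F.κ s * t) :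
    ∃ C : ℝ, 0 < C ∧ ∀ f : E2 → ℝ, ContDiff ℝ 2 f → ∃ m : ℝ,
      ∫ x in F.region α β, (f x - m) ^ 2 ≤ C * ∫ x in F.region α β, ‖fderiv ℝ f x‖ ^ 2 := by
  obtain ⟨C₁, hC₁, hcmp⟩ := F.exists_integral_compare hJ
  obtain ⟨C₂, hC₂, hlev⟩ := F.exists_sq_le_level hαβ.le hJ
  obtain ⟨K, hK0, hK⟩ := F.exists_curvature_bound
  set T := max |α| |β|
  have hT0 : 0 ≤ T := (abs_nonneg _).trans (le_max_left _ _)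
  have hL : 0 < β - α := by linarith
  have hlen := F.len_pos
  refine ⟨C₂ * (F.len * (2 * (F.len * ((1 + K * T) ^ 2 * (C₁ / (β - α))))) + 1), by positivity,
    fun f hf => ?_⟩
  set G := ∫ x in F.region α β, ‖fderiv ℝ f x‖ ^ 2
  have b2 := (hcmp _ (continuous_sq_norm_fderiv hf) (fun x => sq_nonneg _) α β le_rfl hαβ.le
    le_rfl).2
  have cΦ : Continuous fun p : ℝ × ℝ => F.Φ p.1 p.2 := F.continuous_Φ
  have cfΦ : Continuous (uncurry fun t s => ‖fderiv ℝ f (F.Φ t s)‖ ^ 2) :=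
    (continuous_sq_norm_fderiv hf).comp cΦ
  obtain ⟨t, ht, hlt⟩ := exists_level_le
    (f := fun t => ∫ s in (0 : ℝ)..F.len, ‖fderiv ℝ f (F.Φ t s)‖ ^ 2)
    (intervalIntegral.continuous_parametric_intervalIntegral_of_continuous' cfΦ 0 F.len) hαβ.le
  set V := ∫ s in (0 : ℝ)..F.len, ‖fderiv ℝ f (F.Φ t s)‖ ^ 2
  have hV : V ≤ C₁ / (β - α) * G := by
    rw [div_mul_eq_mul_div, le_div_iff₀ hL]
    exact hlt.trans b2
  refine ⟨f (F.Φ t 0), ?_⟩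
  set m := f (F.Φ t 0)
  have hfm : ContDiff ℝ 2 fun x => f x - m := hf.sub contDiff_const
  have hfd : ∀ x, fderiv ℝ (fun x => f x - m) x = fderiv ℝ f x := fun x => fderiv_sub_const m
  have S := F.stripJet hfm
  have b4 := hlev _ hfm t ht
  simp only [hfd] at b4
  have ca := S.conta
  have cκ := S.contκ
  have hd : Continuous fun s => (1 - F.κ s * t) * F.ja (fun x => f x - m) t s := by
    have := continuous_section ca t
    fun_prop
  have b5 : ∫ s in (0 : ℝ)..F.len, ((1 - F.κ s * t) * F.ja (fun x => f x - m) t s) ^ 2 ≤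
      (1 + K * T) ^ 2 * V := by
    rw [← intervalIntegral.integral_const_mul]
    refine intervalIntegral.integral_mono_on hlen.le ((hd.pow 2).intervalIntegrable _ _)
      (((continuous_section cfΦ t).const_mul _).intervalIntegrable _ _) fun s _ => ?_
    have e1 : |1 - F.κ s * t| ≤ 1 + K * T := by
      refine (abs_sub _ _).trans ?_
      rw [abs_one, abs_mul]
      have : |t| ≤ T := abs_le_max_abs_abs ht.1 ht.2
      gcongr
      exact hK s
    have e2 : |F.ja (fun x => f x - m) t s| ≤ ‖fderiv ℝ f (F.Φ t s)‖ := by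
      simp only [ja, hfd]
      simpa [F.norm_T s] using (fderiv ℝ f (F.Φ t s)).le_opNorm (F.T s)
    rw [mul_pow, ← sq_abs (1 - _), ← sq_abs (F.ja _ _ _)]
    gcongr
  have b6 : ∫ s in (0 : ℝ)..F.len, F.ju (fun x => f x - m) t s ^ 2 ≤
      F.len * (2 * (F.len * ((1 + K * T) ^ 2 * V))) := by
    have : ∀ s ∈ Icc 0 F.len, F.ju (fun x => f x - m) t s ^ 2 ≤
        2 * (F.len * ((1 + K * T) ^ 2 * V)) := fun s hs => by
      have := sq_le_sq_add_integral (g := F.ju (fun x => f x - m) t) (fun s => S.u_s t s) hd hs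
        (left_mem_Icc.2 hlen.le)
      refine this.trans ?_
      have e : F.ju (fun x => f x - m) t 0 = 0 := sub_self _
      rw [e, sub_zero]
      simp only [ne_eq, OfNat.ofNat_ne_zero, not_false_eq_true, zero_pow, mul_zero, zero_add]
      gcongr
    refine (intervalIntegral.integral_mono_on hlen.le
      (((continuous_section S.contu t).pow 2).intervalIntegrable _ _)
      (Continuous.intervalIntegrable continuous_const _ _) this).trans (le_of_eq ?_)
    rw [intervalIntegral.integral_const, smul_eq_mul, sub_zero]
  calc _ ≤ C₂ * (F.len * (2 * (F.len * ((1 + K * T) ^ 2 * (C₁ / (β - α) * G)))) + G) := by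
        refine b4.trans ?_
        gcongr
        refine b6.trans ?_
        gcongr
    _ = _ := by ring

end Frame

/-- A property of sets that propagates across strips of normal coordinates in `Ω`, up to the
boundary. -/
structure Propagates {Ω : Set E2} (B : BoundaryParam Ω) (P : Set E2 → Prop) : Prop where
  inter : ∀ S, P (S ∩ Ω) → P S
  mono : ∀ S T, S ⊆ T → P T → P S
  union : ∀ S T, P S → P T → P (S ∪ T)
  interior : ∀ (F : Frame) (α α' m β : ℝ), α < α' → α' < m → m < β →
    (∀ t ∈ Icc α β, ∀ s, 1 / 2 ≤ 1 - F.κ s * t) → (∀ t ∈ Icc α β, ∀ s, F.Φ t s ∈ Ω) →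
    P (F.region m β) → P (F.region α' β)
  boundary : ∀ (F : Frame) (m β : ℝ), 0 < m → m < β →
    (∀ t ∈ Icc 0 β, ∀ s, 1 / 2 ≤ 1 - F.κ s * t) → (∀ t ∈ Ioc 0 β, ∀ s, F.Φ t s ∈ Ω) →
    (∀ s, ∃ s', F.γ s = B.q s' ∧ (F.n s = B.ν s' ∨ F.n s = -B.ν s')) →
    P (F.region m β) → P (F.region 0 β)

lemma Controlled.propagates {Ω : Set E2} (hΩ : IsPlaneDomain Ω) {B : BoundaryParam Ω}
    {N : (E2 → ℝ) → ℝ} (hN : ∀ φ, 0 ≤ N φ) : Propagates B (Controlled B N) where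
  inter _ h := h.inter
  mono _ _ hST h := h.mono hΩ hST
  union _ _ hS hT := hS.union hΩ hN hT
  interior F _ _ _ _ hα hα' hm hJ hF h := F.controlled_interior hΩ hN hα hα' hm hJ hF h
  boundary F m β hm0 hm hJ hF hn h :=
    F.controlled_boundary hΩ hN hm0 hm hJ hF (fun lam φ hφ s => by
      obtain ⟨s', h1, h2 | h2⟩ := hn s
      · rw [h1, h2, hφ.neumann]
      · rw [h1, h2, map_neg, hφ.neumann, neg_zero]) h

/-- The mass of functions on `S ∩ Ω` is controlled by the mass on `R` and the Dirichlet energy. -/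
def MassBound (Ω R S : Set E2) : Prop :=
  ∃ C > 0, ∀ f : E2 → ℝ, ContDiff ℝ 2 f →
    ∫ x in S ∩ Ω, f x ^ 2 ≤ C * ((∫ x in R, f x ^ 2) + ∫ x in Ω, ‖fderiv ℝ f x‖ ^ 2)

lemma MassBound.step {Ω R : Set E2} (hΩ : IsPlaneDomain Ω) (F : Frame) {α m β : ℝ} (hα : α < m)
    (hm : m < β) (hJ : ∀ t ∈ Icc α β, ∀ s, 1 / 2 ≤ 1 - F.κ s * t)
    (hF : ∀ t ∈ Ioc α β, ∀ s, F.Φ t s ∈ Ω) (h : MassBound Ω R (F.region m β)) :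
    MassBound Ω R (F.region α β) := by
  obtain ⟨C₁, hC₁, hcmp⟩ := F.exists_integral_compare hJ
  obtain ⟨C₂, hC₂, hlev⟩ := F.exists_sq_le_level (hα.trans hm).le hJ
  obtain ⟨C, hC, h⟩ := h
  have hreg : ∀ {a b : ℝ}, α ≤ a → b ≤ β → F.region a b ⊆ Ω := by
    rintro a b ha hb _ ⟨t, ht, s, rfl⟩
    exact hF t ⟨ha.trans_lt ht.1, ht.2.trans hb⟩ s
  have hδ : 0 < β - m := by linarith
  refine ⟨C₂ * (C₁ * C / (β - m) + 1), by positivity, fun f hf => ?_⟩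
  have h := h f hf
  rw [inter_eq_left.2 (hreg hα.le le_rfl)] at h
  rw [inter_eq_left.2 (hreg le_rfl le_rfl)]
  have cf2 : Continuous fun x => f x ^ 2 := hf.continuous.pow 2
  have b1 := (hcmp (fun x => f x ^ 2) cf2 (fun x => sq_nonneg _) m β hα.le hm.le le_rfl).2
  have cu2 : Continuous (uncurry fun t s => f (F.Φ t s) ^ 2) := cf2.comp F.continuous_Φ
  obtain ⟨t, ht, hlt⟩ := exists_level_le
    (f := fun t => ∫ s in (0 : ℝ)..F.len, f (F.Φ t s) ^ 2)
    (intervalIntegral.continuous_parametric_intervalIntegral_of_continuous' cu2 0 F.len) hm.le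
  have b2 := hlev f hf t ⟨hα.le.trans ht.1, ht.2⟩
  have b3 : ∫ x in F.region α β, ‖fderiv ℝ f x‖ ^ 2 ≤ ∫ x in Ω, ‖fderiv ℝ f x‖ ^ 2 :=
    setIntegral_mono_subset
      (integrableOn_of_isBounded hΩ.isBounded (Frame.continuous_sq_norm_fderiv hf))
      (fun _ => sq_nonneg _) (hreg le_rfl le_rfl)
  set G := ∫ x in Ω, ‖fderiv ℝ f x‖ ^ 2
  set M := ∫ x in R, f x ^ 2
  have hM : 0 ≤ M := integral_nonneg fun _ => sq_nonneg _
  have b4 : ∫ s in (0 : ℝ)..F.len, F.ju f t s ^ 2 ≤ C₁ * C / (β - m) * (M + G) := by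
    rw [div_mul_eq_mul_div, le_div_iff₀ hδ, mul_assoc]
    exact (hlt.trans b1).trans (by gcongr)
  calc _ ≤ C₂ * (C₁ * C / (β - m) * (M + G) + (M + G)) := by
        refine b2.trans ?_
        gcongr
        linarith
    _ = _ := by ring

lemma MassBound.propagates {Ω : Set E2} (hΩ : IsPlaneDomain Ω) (B : BoundaryParam Ω)
    (R : Set E2) : Propagates B (MassBound Ω R) where
  inter S h := by
    unfold MassBound at *
    simpa only [inter_assoc, inter_self] using h
  mono S T hST h := by
    obtain ⟨C, hC, h⟩ := h
    refine ⟨C, hC, fun f hf => le_trans ?_ (h f hf)⟩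
    exact setIntegral_mono_subset
      ((integrableOn_of_isBounded hΩ.isBounded (hf.continuous.pow 2)).mono_set inter_subset_right)
      (fun _ => sq_nonneg _) (inter_subset_inter_left _ hST)
  union S T hS hT := by
    obtain ⟨C₁, hC₁, h₁⟩ := hS
    obtain ⟨C₂, hC₂, h₂⟩ := hT
    refine ⟨C₁ + C₂, by positivity, fun f hf => ?_⟩
    rw [union_inter_distrib_right, add_mul]
    exact (setIntegral_union_le (integrableOn_of_isBounded hΩ.isBounded (hf.continuous.pow 2))
      (fun _ => sq_nonneg _) inter_subset_right inter_subset_right).trans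
      (add_le_add (h₁ f hf) (h₂ f hf))
  interior F α α' m β hα hα' hm hJ hF h :=
    h.step hΩ F hα' hm (fun t ht => hJ t ⟨hα.le.trans ht.1, ht.2⟩)
      (fun t ht => hF t ⟨hα.le.trans ht.1.le, ht.2⟩)
  boundary F m β hm0 hm hJ hF _ h := h.step hΩ F hm0 hm hJ hF

lemma MassBound.self (Ω R : Set E2) (hR : R ⊆ Ω) : MassBound Ω R R :=
  ⟨1, one_pos, fun f _ => by
    rw [inter_eq_left.2 hR, one_mul]
    exact le_add_of_nonneg_right (integral_nonneg fun _ => sq_nonneg _)⟩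

/-- The unit vector of angle `θ`. -/
def unitVec (θ : ℝ) : E2 :=
  cos θ • EuclideanSpace.single 0 1 + sin θ • EuclideanSpace.single 1 1

/-- The unit vector of angle `θ + π / 2`. -/
def unitVec' (θ : ℝ) : E2 :=
  (-sin θ) • EuclideanSpace.single 0 1 + cos θ • EuclideanSpace.single 1 1

lemma hasDerivAt_unitVec (θ : ℝ) : HasDerivAt unitVec (unitVec' θ) θ :=
  ((hasDerivAt_cos θ).smul_const _).add ((hasDerivAt_sin θ).smul_const _)

lemma hasDerivAt_unitVec' (θ : ℝ) : HasDerivAt unitVec' (-unitVec θ) θ := by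
  refine (((hasDerivAt_sin θ).neg.smul_const _).add
    ((hasDerivAt_cos θ).smul_const _)).congr_deriv ?_
  simp only [unitVec, neg_smul, neg_add]

lemma norm_unitVec (θ : ℝ) : ‖unitVec θ‖ = 1 := by
  rw [EuclideanSpace.norm_eq, Fin.sum_univ_two]
  simp [unitVec]

lemma norm_unitVec' (θ : ℝ) : ‖unitVec' θ‖ = 1 := by
  rw [EuclideanSpace.norm_eq, Fin.sum_univ_two]
  simp [unitVec']

lemma inner_unitVec'_unitVec (θ : ℝ) : ⟪unitVec' θ, unitVec θ⟫ = 0 := by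
  simp [unitVec, unitVec', PiLp.inner_apply, Fin.sum_univ_two]
  ring

lemma unitVec_periodic : Periodic unitVec (2 * π) := fun θ => by simp [unitVec]

lemma unitVec'_periodic : Periodic unitVec' (2 * π) := fun θ => by simp [unitVec']

lemma exists_eq_norm_smul_unitVec (x : E2) : ∃ θ, x = ‖x‖ • unitVec θ := by
  set c : ℂ := ⟨x 0, x 1⟩ with hc
  have hn : ‖x‖ = ‖c‖ := by
    rw [EuclideanSpace.norm_eq, Fin.sum_univ_two, Complex.norm_def, Complex.normSq_apply]
    simp [hc, sq]
  refine ⟨c.arg, ?_⟩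
  rw [hn]
  ext i
  fin_cases i
  · simp [unitVec]; rfl
  · simp [unitVec]; rfl

lemma hasDerivAt_comp_div {f : ℝ → E2} {f' : E2} {s r : ℝ} (hf : HasDerivAt f f' (s / r)) :
    HasDerivAt (fun s => f (s / r)) ((1 / r) • f') s :=
  HasDerivAt.scomp (h := fun s => s / r) s hf ((hasDerivAt_id s).div_const r)

/-- The circle of centre `z` and radius `r`, with inward normal. -/
def circleFrame (z : E2) {r : ℝ} (hr : 0 < r) : Frame where
  len := 2 * π * r
  len_pos := by positivity
  γ s := z + r • unitVec (s / r)
  T s := unitVec' (s / r)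
  n s := -unitVec (s / r)
  κ _ := 1 / r
  contκ := continuous_const
  hasDerivAt_γ s := by
    have := (hasDerivAt_comp_div (hasDerivAt_unitVec (s / r))).const_smul r
    refine (this.const_add z).congr_deriv ?_
    rw [smul_smul, mul_one_div_cancel hr.ne', one_smul]
  hasDerivAt_T s := hasDerivAt_comp_div (hasDerivAt_unitVec' (s / r))
  hasDerivAt_n s := by
    refine (hasDerivAt_comp_div (hasDerivAt_unitVec (s / r))).neg.congr_deriv ?_
    rw [neg_smul]
  norm_T s := norm_unitVec' _
  norm_n s := by rw [norm_neg, norm_unitVec]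
  orth s := by rw [inner_neg_right, inner_unitVec'_unitVec, neg_zero]
  γ_per s := by
    have : (s + 2 * π * r) / r = s / r + 2 * π := by field_simp
    simp only [this, unitVec_periodic (s / r)]
  T_per s := by
    have : (s + 2 * π * r) / r = s / r + 2 * π := by field_simp
    simp only [this, unitVec'_periodic (s / r)]
  n_per s := by
    have : (s + 2 * π * r) / r = s / r + 2 * π := by field_simp
    simp only [this, unitVec_periodic (s / r)]
  κ_per _ := rfl

lemma circleFrame_Φ (z : E2) {r : ℝ} (hr : 0 < r) (t s : ℝ) :
    (circleFrame z hr).Φ t s = z + (r - t) • unitVec (s / r) := by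
  simp only [Frame.Φ, circleFrame, sub_smul, smul_neg]
  abel

lemma dist_circleFrame_Φ (z : E2) {r : ℝ} (hr : 0 < r) {t : ℝ} (ht : t ≤ r) (s : ℝ) :
    dist ((circleFrame z hr).Φ t s) z = r - t := by
  rw [circleFrame_Φ, dist_eq_norm, add_sub_cancel_left, norm_smul, norm_unitVec, mul_one,
    norm_eq_abs, abs_of_nonneg (by linarith)]

lemma mem_region_circleFrame {z : E2} {r : ℝ} (hr : 0 < r) {α β : ℝ} {x : E2}
    (h1 : r - β ≤ dist x z) (h2 : dist x z < r - α) : x ∈ (circleFrame z hr).region α β := by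
  refine ⟨r - dist x z, ⟨by linarith, by linarith⟩, ?_⟩
  obtain ⟨θ, hθ⟩ := exists_eq_norm_smul_unitVec (x - z)
  refine ⟨r * θ, ?_⟩
  rw [circleFrame_Φ, mul_div_cancel_left₀ _ hr.ne', sub_sub_cancel, dist_eq_norm, ← hθ,
    add_sub_cancel]

namespace Propagates

variable {Ω : Set E2} {B : BoundaryParam Ω} {P : Set E2 → Prop}

/-- Propagation from a small ball to a large concentric ball. -/
lemma ball (h : Propagates B P) {z : E2} {ε R R' : ℝ} (hε : 0 < ε) (hεR : ε ≤ R) (hR : R < R')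
    (hΩ : Metric.closedBall z R' ⊆ Ω) (hP : P (Metric.ball z ε)) : P (Metric.ball z R) := by
  have h1 : P ((circleFrame z hε).region (ε / 4) (ε / 2)) := by
    refine h.mono _ _ ?_ hP
    rintro _ ⟨t, ht, s, rfl⟩
    rw [Metric.mem_ball, dist_circleFrame_Φ z hε (by linarith [ht.2])]
    linarith [ht.1]
  have h2 := h.interior (circleFrame z hε) (ε - R') (ε - R) (ε / 4) (ε / 2) (by linarith)
    (by linarith) (by linarith) (fun t ht s => by
      change 1 / 2 ≤ 1 - 1 / ε * t
      have : 1 / ε * t ≤ 1 / 2 := by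
        rw [one_div_mul_eq_div, div_le_iff₀ hε]; linarith [ht.2]
      linarith) (fun t ht s => hΩ (by
        rw [Metric.mem_closedBall, dist_circleFrame_Φ z hε (by linarith [ht.2])]
        linarith [ht.1])) h1
  refine h.mono _ _ (fun x hx => ?_) (h.union _ _ hP h2)
  rw [Metric.mem_ball] at hx
  rcases lt_or_ge (dist x z) ε with hd | hd
  · exact Or.inl hd
  · exact Or.inr (mem_region_circleFrame hε (by linarith) (by linarith))

/-- Interior propagation: the property holds on all compact subsets. -/
lemma of_isCompact (h : Propagates B P) (hΩ : IsPlaneDomain Ω) {z : E2} (hz : z ∈ Ω) {ε : ℝ}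
    (hε : 0 < ε) (hP : P (Metric.ball z ε)) {K : Set E2} (hK : IsCompact K) (hKΩ : K ⊆ Ω) :
    P K := by
  set G : Set E2 := {x | ∃ ε > 0, P (Metric.ball x ε)} with hG
  have hGo : IsOpen G := by
    rw [Metric.isOpen_iff]
    rintro x ⟨ε, hε, hx⟩
    refine ⟨ε, hε, fun y hy => ⟨ε - dist y x, by simpa using hy, h.mono _ _ ?_ hx⟩⟩
    exact Metric.ball_subset_ball' (by linarith)
  have hsub : Ω ⊆ G := by
    refine hΩ.isConnected.isPreconnected.subset_of_closure_inter_subset hGo ⟨z, hz, ε, hε, hP⟩ ?_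
    rintro x ⟨hxc, hxΩ⟩
    obtain ⟨ρ, hρ, hball⟩ := Metric.isOpen_iff.1 hΩ.isOpen x hxΩ
    obtain ⟨y, ⟨δ, hδ, hy⟩, hxy⟩ := Metric.mem_closure_iff.1 hxc (ρ / 8) (by positivity)
    have hy' : P (Metric.ball y (min δ (ρ / 8))) :=
      h.mono _ _ (Metric.ball_subset_ball (min_le_left _ _)) hy
    have := h.ball (R := ρ / 4) (R' := ρ / 2) (lt_min hδ (by positivity))
      ((min_le_right _ _).trans (by linarith)) (by linarith) (by
        refine (Metric.closedBall_subset_ball' ?_).trans hball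
        rw [dist_comm]; linarith) hy'
    refine ⟨ρ / 8, by positivity, h.mono _ _ (Metric.ball_subset_ball' ?_) this⟩
    linarith
  refine hK.induction_on (h.mono _ _ (empty_subset _) hP) (fun _ _ hst ht => h.mono _ _ hst ht)
    (fun _ _ hs ht => h.union _ _ hs ht) fun x hx => ?_
  obtain ⟨δ, hδ, hx'⟩ := hsub (hKΩ hx)
  exact ⟨_, mem_nhdsWithin_of_mem_nhds (Metric.ball_mem_nhds x hδ), hx'⟩

end Propagates

/-- Rotation by a right angle. -/
def rot : E2 →L[ℝ] E2 :=
  LinearMap.toContinuousLinearMap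
    { toFun := fun v => !₂[-v 1, v 0]
      map_add' := fun v w => by ext i; fin_cases i <;> simp; ring
      map_smul' := fun c v => by ext i; fin_cases i <;> simp }

lemma rot_apply (v : E2) : rot v = !₂[-v 1, v 0] := rfl

lemma norm_rot (v : E2) : ‖rot v‖ = ‖v‖ := by
  rw [rot_apply, EuclideanSpace.norm_eq, EuclideanSpace.norm_eq, Fin.sum_univ_two, Fin.sum_univ_two]
  simp [add_comm]

lemma inner_self_rot (v : E2) : ⟪v, rot v⟫ = 0 := by
  simp [rot_apply, PiLp.inner_apply, Fin.sum_univ_two]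
  ring

lemma rot_rot (v : E2) : rot (rot v) = -v := by
  ext i; fin_cases i <;> simp [rot_apply]

lemma eq_inner_smul_rot {T v : E2} (hT : ‖T‖ = 1) (h : ⟪v, T⟫ = 0) :
    v = ⟪v, rot T⟫ • rot T := by
  have e1 : T 0 ^ 2 + T 1 ^ 2 = 1 := by
    have := EuclideanSpace.real_norm_sq_eq T
    simp [hT, Fin.sum_univ_two] at this; linarith
  have e2 : v 0 * T 0 + v 1 * T 1 = 0 := by
    simp [PiLp.inner_apply, Fin.sum_univ_two] at h; linarith
  ext i
  fin_cases i
  · simp [rot_apply, PiLp.inner_apply, Fin.sum_univ_two]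
    linear_combination (-(v 0)) * e1 + T 0 * e2
  · simp [rot_apply, PiLp.inner_apply, Fin.sum_univ_two]
    linear_combination (-(v 1)) * e1 + T 1 * e2

lemma eq_rot_or_eq_neg_rot {T n : E2} (hT : ‖T‖ = 1) (hn : ‖n‖ = 1) (h : ⟪n, T⟫ = 0) :
    n = rot T ∨ n = -rot T := by
  obtain ⟨σ, rfl | rfl, h⟩ := exists_sign_of_orthonormal hT hn (by rwa [real_inner_comm])
  · exact Or.inl (by simpa [rot_apply] using h)
  · exact Or.inr (by simpa [rot_apply] using h)

lemma periodic_deriv {f f' : ℝ → E2} {L : ℝ} (hf : Periodic f L) (h : ∀ s, HasDerivAt f (f' s) s) :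
    Periodic f' L := fun s => by
  have h1 : HasDerivAt (fun x => f (x + L)) (f' (s + L)) s := (h (s + L)).comp_add_const s L
  rw [show (fun x => f (x + L)) = f from funext hf] at h1
  exact h1.unique (h s)

/-- The frame of a unit speed `C²` closed curve, with normal the rotated tangent. -/
def Frame.ofCurve {len : ℝ} (hlen : 0 < len) {γ T : ℝ → E2} (hd : ∀ s, HasDerivAt γ (T s) s)
    (hγ : ContDiff ℝ 2 γ) (hT : ∀ s, ‖T s‖ = 1) (hper : Periodic γ len) : Frame := by
  have hTd : T = deriv γ := funext fun s => (hd s).deriv.symm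
  have hT1 : ContDiff ℝ 1 T := by
    rw [hTd]
    exact ((contDiff_succ_iff_deriv (n := 1)).1 (by simpa [one_add_one_eq_two] using hγ)).2.2
  have hT' : ∀ s, HasDerivAt T (deriv T s) s := fun s =>
    (hT1.differentiable (by norm_num) s).hasDerivAt
  have hT'' : Continuous (deriv T) := hT1.continuous_deriv (by norm_num)
  have hTT : ∀ s, ⟪deriv T s, T s⟫ = 0 := fun s => by
    have h1 := (hT' s).norm_sq
    have h2 : (fun s => ‖T s‖ ^ 2) = fun _ => 1 := by simp [hT]
    rw [h2] at h1
    have := h1.unique (hasDerivAt_const s 1)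
    rw [real_inner_comm]
    linarith
  have hκ : ∀ s, HasDerivAt T (⟪deriv T s, rot (T s)⟫ • rot (T s)) s := fun s => by
    rw [← eq_inner_smul_rot (hT s) (hTT s)]; exact hT' s
  have pT : Periodic T len := periodic_deriv hper hd
  have pT' : Periodic (deriv T) len := periodic_deriv pT hT'
  exact
  { len := len
    len_pos := hlen
    γ := γ
    T := T
    n := fun s => rot (T s)
    κ := fun s => ⟪deriv T s, rot (T s)⟫
    contκ := hT''.inner (rot.continuous.comp hT1.continuous)
    hasDerivAt_γ := hd
    hasDerivAt_T := hκ
    hasDerivAt_n := fun s => by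
      refine (rot.hasFDerivAt.comp_hasDerivAt s (hκ s)).congr_deriv ?_
      rw [map_smul, rot_rot, smul_neg, neg_smul]
    norm_T := hT
    norm_n := fun s => by rw [norm_rot, hT]
    orth := fun s => inner_self_rot _
    γ_per := hper
    T_per := pT
    n_per := fun s => by simp only [pT s]
    κ_per := fun s => by simp only [pT s, pT' s] }

section ofCurve

variable {len : ℝ} (hlen : 0 < len) {γ T : ℝ → E2} (hd : ∀ s, HasDerivAt γ (T s) s)
    (hγ : ContDiff ℝ 2 γ) (hT : ∀ s, ‖T s‖ = 1) (hper : Periodic γ len)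

@[simp] lemma Frame.ofCurve_len : (Frame.ofCurve hlen hd hγ hT hper).len = len := rfl
@[simp] lemma Frame.ofCurve_γ : (Frame.ofCurve hlen hd hγ hT hper).γ = γ := rfl
@[simp] lemma Frame.ofCurve_T : (Frame.ofCurve hlen hd hγ hT hper).T = T := rfl
@[simp] lemma Frame.ofCurve_n (s : ℝ) : (Frame.ofCurve hlen hd hγ hT hper).n s = rot (T s) := rfl

end ofCurve

/-- The frame of the boundary curve. -/
def boundaryFrame {Ω : Set E2} (B : BoundaryParam Ω) (hB : B.IsSmooth) : Frame :=
  Frame.ofCurve B.len_pos B.hasDerivAt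
    (ContDiff.of_le hB (WithTop.coe_le_coe.2 (le_top : (2 : ℕ∞) ≤ ⊤))) B.unitSpeed B.periodic

/-- The frame of the interior curve. -/
def curveFrame {Ω : Set E2} (Γ : InteriorCurve Ω) : Frame :=
  Frame.ofCurve Γ.len_pos Γ.hasDerivAt
    (contDiff_iff_contDiffAt.2 fun s => (Γ.analytic s (mem_univ s)).contDiffAt) Γ.unitSpeed
    Γ.periodic

lemma lipschitz_tangent (F : Frame) : ∃ K > 0, ∀ s h, ‖F.T (s + h) - F.T s‖ ≤ K * |h| := by
  obtain ⟨K, hK0, hK⟩ := F.exists_curvature_bound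
  refine ⟨K, hK0, fun s h => ?_⟩
  have := convex_univ.norm_image_sub_le_of_norm_hasDerivWithin_le (C := K)
    (fun x _ => (F.hasDerivAt_T x).hasDerivWithinAt)
    (fun x _ => by rw [norm_smul, F.norm_n, mul_one]; exact hK x) (mem_univ s) (mem_univ (s + h))
  simpa using this

/-- A closed curve without self-intersections avoids its parallel curves. -/
lemma Frame.exists_tubular (F : Frame) (hinj : InjOn F.γ (Ico 0 F.len)) :
    ∃ δ > 0, ∀ t, t ≠ 0 → |t| ≤ δ → ∀ s s', F.Φ t s ≠ F.γ s' := by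
  obtain ⟨K, hK0, hK⟩ := lipschitz_tangent F
  have hlen := F.len_pos
  set η := min (1 / (2 * K)) (F.len / 2) with hη
  have hη0 : 0 < η := lt_min (by positivity) (by positivity)
  have hηK : K * η ≤ 1 / 2 := by
    calc K * η ≤ K * (1 / (2 * K)) := by gcongr; exact min_le_left _ _
      _ = 1 / 2 := by field_simp
  have hηl : η ≤ F.len / 2 := min_le_right _ _
  have hnear : ∀ s h, |h| ≤ η → h ≠ 0 → ⟪F.γ (s + h) - F.γ s, F.T s⟫ ≠ 0 := by
    intro s h hh h0 hz
    have h1 : ‖F.γ (s + h) - (s + h) • F.T s - (F.γ s - s • F.T s)‖ ≤ 1 / 2 * ‖s + h - s‖ := by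
      refine (convex_uIcc s (s + h)).norm_image_sub_le_of_norm_hasDerivWithin_le
        (f := fun x => F.γ x - x • F.T s) (f' := fun x => F.T x - F.T s)
        (fun x _ => ?_) (fun x hx => ?_) left_mem_uIcc right_mem_uIcc
      · refine ((F.hasDerivAt_γ x).sub ((hasDerivAt_id x).smul_const (F.T s))).hasDerivWithinAt
          |>.congr_deriv ?_
        rw [one_smul]
      · have := hK s (x - s)
        rw [add_sub_cancel] at this
        refine this.trans (le_trans ?_ hηK)
        have : |x - s| ≤ |s + h - s| := abs_sub_left_of_mem_uIcc hx
        rw [add_sub_cancel_left] at this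
        gcongr
        exact this.trans hh
    have h2 : F.γ (s + h) - (s + h) • F.T s - (F.γ s - s • F.T s) =
        F.γ (s + h) - F.γ s - h • F.T s := by rw [add_smul]; abel
    rw [h2, add_sub_cancel_left, norm_eq_abs] at h1
    have h3 := abs_real_inner_le_norm (F.γ (s + h) - F.γ s - h • F.T s) (F.T s)
    rw [inner_sub_left, hz, real_inner_smul_left, real_inner_self_eq_norm_sq, F.norm_T, one_pow,
      mul_one, mul_one, zero_sub, abs_neg] at h3
    have := abs_pos.2 h0
    linarith
  have hfar : ∀ p ∈ Icc 0 F.len ×ˢ Icc η (F.len - η), 0 < ‖F.γ (p.1 + p.2) - F.γ p.1‖ := by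
    rintro ⟨s, h⟩ ⟨-, hh⟩
    rw [norm_pos_iff, sub_ne_zero]
    intro he
    simp only at he hh
    obtain ⟨n, hn, -⟩ := existsUnique_zsmul_near_of_pos' hlen s
    have hs : F.γ (s - n • F.len) = F.γ s := F.γ_per.sub_zsmul_eq n
    rcases lt_or_ge (s - n • F.len + h) F.len with hlt | hge
    · have e : F.γ (s - n • F.len + h) = F.γ (s + h) := by
        rw [sub_add_eq_add_sub]; exact F.γ_per.sub_zsmul_eq n
      have := hinj ⟨by linarith [hn.1, hh.1], hlt⟩ hn (by rw [e, hs, he])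
      linarith [hh.1]
    · have e : F.γ (s - n • F.len + h - F.len) = F.γ (s + h) := by
        rw [F.γ_per.sub_eq, sub_add_eq_add_sub]; exact F.γ_per.sub_zsmul_eq n
      have := @hinj (s - n • F.len + h - F.len) ⟨by linarith, by linarith [hn.2, hh.2]⟩ _ hn
        (by rw [e, hs, he])
      linarith [hh.2]
  have hcont : Continuous fun p : ℝ × ℝ => ‖F.γ (p.1 + p.2) - F.γ p.1‖ := by
    have := F.continuous_γ
    fun_prop
  obtain ⟨d, hd0, hd⟩ : ∃ d > 0, ∀ p ∈ Icc 0 F.len ×ˢ Icc η (F.len - η),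
      d ≤ ‖F.γ (p.1 + p.2) - F.γ p.1‖ := by
    obtain ⟨p, hp, hmin⟩ := (isCompact_Icc.prod isCompact_Icc).exists_isMinOn
      (⟨(0, η), ⟨by simp [hlen.le], by simp; linarith⟩⟩ :
        (Icc 0 F.len ×ˢ Icc η (F.len - η)).Nonempty) hcont.continuousOn
    exact ⟨_, hfar p hp, fun q hq => hmin hq⟩
  refine ⟨d / 2, by positivity, fun t ht0 ht s s' he => ?_⟩
  obtain ⟨s₀, hs₀, hγ, hn, -⟩ := F.exists_Ico s
  obtain ⟨s₁, hs₁, hγ'⟩ := F.γ_per.exists_mem_Ico hlen s' s₀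
  set h := s₁ - s₀ with hh
  have hdiff : F.γ (s₀ + h) - F.γ s₀ = t • F.n s := by
    rw [hh, add_sub_cancel, ← hγ', ← he, Φ, hγ, add_sub_cancel_left]
  have horth : ⟪F.γ (s₀ + h) - F.γ s₀, F.T s₀⟫ = 0 := by
    rw [hdiff, ← hn, real_inner_smul_left, real_inner_comm, F.orth, mul_zero]
  have hnorm : ‖F.γ (s₀ + h) - F.γ s₀‖ = |t| := by
    rw [hdiff, norm_smul, F.norm_n, mul_one, norm_eq_abs]
  have hh0 : 0 ≤ h := by linarith [hs₁.1]
  have hhl : h < F.len := by linarith [hs₁.2]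
  rcases lt_or_ge h η with h1 | h1
  · refine hnear s₀ h (by rw [abs_of_nonneg hh0]; exact h1.le) (fun h0 => ?_) horth
    rw [h0, add_zero, sub_self, norm_zero] at hnorm
    exact ht0 (abs_eq_zero.1 hnorm.symm)
  rcases le_or_gt h (F.len - η) with h2 | h2
  · have := hd (s₀, h) ⟨Ico_subset_Icc_self hs₀, h1, h2⟩
    simp only at this
    rw [hnorm] at this
    linarith
  · refine hnear s₀ (h - F.len) (by rw [abs_of_neg (by linarith)]; linarith)
      (by linarith) ?_
    rwa [← add_sub_assoc, F.γ_per.sub_eq]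

/-- A strip that avoids the frontier of an open set lies either inside or outside that set. -/
lemma Frame.strip_inside_or_outside (F : Frame) {Ω : Set E2} (hΩ : IsOpen Ω) {δ : ℝ}
    (h : ∀ t ∈ Ioc 0 δ, ∀ s, F.Φ t s ∉ frontier Ω) :
    (∀ t ∈ Ioc 0 δ, ∀ s, F.Φ t s ∈ Ω) ∨ ∀ t ∈ Ioc 0 δ, ∀ s, F.Φ t s ∉ Ω := by
  have hpre : IsPreconnected (uncurry F.Φ '' (Ioc 0 δ ×ˢ univ)) :=
    (isPreconnected_Ioc.prod isPreconnected_univ).image _ F.continuous_Φ.continuousOn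
  by_cases hne : ∃ t ∈ Ioc 0 δ, ∃ s, F.Φ t s ∈ Ω
  · obtain ⟨t₀, ht₀, s₀, h₀⟩ := hne
    refine Or.inl fun t ht s => ?_
    refine hpre.subset_of_closure_inter_subset hΩ
      ⟨_, ⟨(t₀, s₀), ⟨ht₀, mem_univ _⟩, rfl⟩, h₀⟩ ?_ ⟨(t, s), ⟨ht, mem_univ _⟩, rfl⟩
    rintro _ ⟨hc, ⟨t, s⟩, ⟨ht, -⟩, rfl⟩
    by_contra hn
    exact h t ht s (by rw [hΩ.frontier_eq]; exact ⟨hc, hn⟩)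
  · push Not at hne
    exact Or.inr hne

section collar

variable {Ω : Set E2} (B : BoundaryParam Ω) (hB : B.IsSmooth)

/-- The two frames of the boundary curve: one for each choice of the normal. -/
def IsBoundaryFrame (G : Frame) : Prop := G = boundaryFrame B hB ∨ G = (boundaryFrame B hB).neg

variable {B hB}

lemma IsBoundaryFrame.normal {G : Frame} (hG : IsBoundaryFrame B hB G) (s : ℝ) :
    G.n s = B.ν s ∨ G.n s = -B.ν s := by
  rcases hG with rfl | rfl <;>
    rcases eq_rot_or_eq_neg_rot (B.unitSpeed s) (B.ν_unit s) (B.ν_orth s) with h | h <;>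
    simp [boundaryFrame, h]

lemma IsBoundaryFrame.γ_eq {G : Frame} (hG : IsBoundaryFrame B hB G) : G.γ = B.q := by
  rcases hG with rfl | rfl <;> rfl

lemma IsBoundaryFrame.len_eq {G : Frame} (hG : IsBoundaryFrame B hB G) : G.len = B.len := by
  rcases hG with rfl | rfl <;> rfl

variable (B hB)

lemma exists_collar : ∃ δ > 0, ∀ G, IsBoundaryFrame B hB G →
    (∀ t ∈ Icc 0 δ, ∀ s, 1 / 2 ≤ 1 - G.κ s * t) ∧
    ∀ t ∈ Ioc 0 δ, ∀ s, G.Φ t s ∉ frontier Ω := by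
  obtain ⟨δ, hδ, htub⟩ := (boundaryFrame B hB).exists_tubular B.injOn
  obtain ⟨K, hK0, hK⟩ := (boundaryFrame B hB).exists_curvature_bound
  have key : ∀ t, |t| ≤ min δ (1 / (2 * K)) → ∀ s, |(boundaryFrame B hB).κ s * t| ≤ 1 / 2 := by
    intro t ht s
    rw [abs_mul]
    calc |(boundaryFrame B hB).κ s| * |t| ≤ K * (1 / (2 * K)) := by
          gcongr
          · exact hK s
          · exact ht.trans (min_le_right _ _)
      _ = 1 / 2 := by field_simp
  refine ⟨min δ (1 / (2 * K)), by positivity, ?_⟩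
  rintro G (rfl | rfl)
  · refine ⟨fun t ht s => ?_, fun t ht s => ?_⟩
    · have := (abs_le.1 (key t (by rw [abs_of_nonneg ht.1]; exact ht.2) s)).2
      linarith
    · rw [← B.range_eq]
      rintro ⟨s', hs'⟩
      exact htub t ht.1.ne' (by rw [abs_of_pos ht.1]; exact ht.2.trans (min_le_left _ _)) s s'
        hs'.symm
  · refine ⟨fun t ht s => ?_, fun t ht s => ?_⟩
    · have := (abs_le.1 (key t (by rw [abs_of_nonneg ht.1]; exact ht.2) s)).1
      rw [Frame.neg_κ]
      linarith
    · rw [← B.range_eq, Frame.neg_Φ]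
      rintro ⟨s', hs'⟩
      exact htub (-t) (neg_ne_zero.2 ht.1.ne')
        (by rw [abs_neg, abs_of_pos ht.1]; exact ht.2.trans (min_le_left _ _)) s s' hs'.symm

variable {B}

/-- Points of the domain close to the boundary lie on a normal segment to the boundary. -/
lemma exists_boundaryFrame_of_infDist_le (hΩ : IsPlaneDomain Ω) {δ : ℝ} {x : E2} (hx : x ∈ Ω)
    (hδ : Metric.infDist x (frontier Ω) ≤ δ) :
    ∃ G, IsBoundaryFrame B hB G ∧ x ∈ G.region 0 δ := by
  have hcomp : IsCompact (frontier Ω) :=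
    hΩ.isBounded.isCompact_closure.of_isClosed_subset isClosed_frontier frontier_subset_closure
  obtain ⟨y, hy, hxy⟩ := hcomp.exists_infDist_eq_dist (by
    rw [← B.range_eq]; exact range_nonempty _) x
  obtain ⟨s, rfl⟩ : y ∈ range B.q := by rwa [B.range_eq]
  have hmin : IsLocalMin (fun s => ‖B.q s - x‖ ^ 2) s := by
    refine Eventually.of_forall fun s' => ?_
    have := Metric.infDist_le_dist_of_mem (x := x) (s := frontier Ω) (y := B.q s')
      (by rw [← B.range_eq]; exact mem_range_self _)
    rw [hxy, dist_comm, dist_eq_norm, dist_comm, dist_eq_norm] at this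
    simp only
    gcongr
  have hz := hmin.hasDerivAt_eq_zero ((B.hasDerivAt s).sub_const x).norm_sq
  have horth : ⟪x - B.q s, B.qd s⟫ = 0 := by
    rw [← neg_sub, inner_neg_left]; linarith
  have hrep := eq_inner_smul_rot (B.unitSpeed s) horth
  set a := ⟪x - B.q s, rot (B.qd s)⟫ with ha
  have hnorm : dist x (B.q s) = |a| := by
    rw [dist_eq_norm, hrep, norm_smul, norm_rot, B.unitSpeed, mul_one, norm_eq_abs]
  have haδ : |a| ≤ δ := by rw [← hnorm, ← hxy]; exact hδ
  have ha0 : a ≠ 0 := by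
    intro h0
    rw [h0, zero_smul, sub_eq_zero] at hrep
    rw [hΩ.isOpen.frontier_eq, ← hrep] at hy
    exact hy.2 hx
  have hxa : x = B.q s + a • rot (B.qd s) := by rw [← hrep, add_sub_cancel]
  rcases ha0.lt_or_gt with hneg | hpos
  · refine ⟨_, Or.inr rfl, -a, ⟨by linarith, by rwa [← abs_of_neg hneg]⟩, s, ?_⟩
    rw [Frame.neg_Φ, neg_neg]
    exact hxa.symm
  · exact ⟨_, Or.inl rfl, a, ⟨hpos, by rwa [← abs_of_pos hpos]⟩, s, hxa.symm⟩

include hB in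
/-- Propagation from a ball to the whole domain. -/
lemma Propagates.of_ball {P : Set E2 → Prop} (h : Propagates B P) (hΩ : IsPlaneDomain Ω) {z : E2}
    (hz : z ∈ Ω) {ε : ℝ} (hε : 0 < ε) (hP : P (Metric.ball z ε)) : P Ω := by
  obtain ⟨δ, hδ, hcol⟩ := exists_collar B hB
  have hK : ∀ K, IsCompact K → K ⊆ Ω → P K := fun K => h.of_isCompact hΩ hz hε hP
  have hG : ∀ G, IsBoundaryFrame B hB G → P (G.region 0 δ) := by
    intro G hG
    obtain ⟨hJ, hfr⟩ := hcol G hG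
    rcases G.strip_inside_or_outside hΩ.isOpen hfr with hin | hout
    · refine h.boundary G (δ / 2) δ (by linarith) (by linarith) hJ hin
        (fun s => ⟨s, congrFun hG.γ_eq s, hG.normal s⟩) ?_
      refine h.mono _ _ (G.region_subset_closedRegion _ _)
        (hK _ (G.isCompact_closedRegion _ _) ?_)
      rintro _ ⟨t, ht, s, rfl⟩
      exact hin t ⟨by linarith [ht.1], ht.2⟩ s
    · refine h.inter _ (h.mono _ _ ?_ (hK ∅ isCompact_empty (empty_subset _)))
      rintro _ ⟨⟨t, ht, s, rfl⟩, hx⟩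
      exact hout t ht s hx
  have hcore : P (closure Ω ∩ {x | δ ≤ Metric.infDist x (frontier Ω)}) := by
    refine hK _ (hΩ.isBounded.isCompact_closure.inter_right
      (isClosed_le continuous_const (Metric.continuous_infDist_pt _))) ?_
    rintro x ⟨hxc, hx⟩
    by_contra hn
    have : x ∈ frontier Ω := by rw [hΩ.isOpen.frontier_eq]; exact ⟨hxc, hn⟩
    rw [mem_ofPred_eq, Metric.infDist_zero_of_mem this] at hx
    linarith
  refine h.mono _ _ (fun x hx => ?_) (h.union _ _ hcore
    (h.union _ _ (hG _ (Or.inl rfl)) (hG _ (Or.inr rfl))))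
  rcases le_total δ (Metric.infDist x (frontier Ω)) with hd | hd
  · exact Or.inl ⟨subset_closure hx, hd⟩
  · obtain ⟨G, rfl | rfl, hxG⟩ := exists_boundaryFrame_of_infDist_le hB hΩ hx hd
    · exact Or.inr (Or.inl hxG)
    · exact Or.inr (Or.inr hxG)

end collar

section trace

variable {Ω : Set E2} {B : BoundaryParam Ω} (hB : B.IsSmooth)

lemma exists_inner_boundaryFrame (hΩ : IsPlaneDomain Ω) :
    ∃ G, IsBoundaryFrame B hB G ∧ ∃ δ > 0, (∀ t ∈ Icc 0 δ, ∀ s, 1 / 2 ≤ 1 - G.κ s * t) ∧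
      ∀ t ∈ Ioc 0 δ, ∀ s, G.Φ t s ∈ Ω := by
  obtain ⟨δ, hδ, hcol⟩ := exists_collar B hB
  obtain ⟨G, hG, hn⟩ : ∃ G, IsBoundaryFrame B hB G ∧ G.n 0 = B.ν 0 := by
    rcases IsBoundaryFrame.normal (Or.inl rfl : IsBoundaryFrame B hB _) 0 with h | h
    · exact ⟨_, Or.inl rfl, h⟩
    · exact ⟨_, Or.inr rfl, by rw [Frame.neg_n, h, neg_neg]⟩
  obtain ⟨η, hη, hin⟩ := B.ν_inward 0
  refine ⟨G, hG, δ, hδ, (hcol G hG).1, ?_⟩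
  refine (G.strip_inside_or_outside hΩ.isOpen (hcol G hG).2).resolve_right fun hout => ?_
  refine hout (min δ (η / 2)) ⟨by positivity, min_le_left _ _⟩ 0 ?_
  rw [Frame.Φ, hn, hG.γ_eq]
  exact hin _ ⟨by positivity, (min_le_right _ _).trans_lt (by linarith)⟩

include hB in
/-- The trace inequality. -/
lemma exists_trace (hΩ : IsPlaneDomain Ω) : ∃ C > 0, ∀ f : E2 → ℝ, ContDiff ℝ 2 f →
    ∫ s in (0 : ℝ)..B.len, f (B.q s) ^ 2 ≤ C * ∫ x in Ω, energyDensity f x := by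
  obtain ⟨G, hG, δ, hδ, hJ, hin⟩ := exists_inner_boundaryFrame hB hΩ
  obtain ⟨C, hC, hcmp⟩ := G.exists_integral_compare hJ
  have hreg : G.region 0 δ ⊆ Ω := by
    rintro _ ⟨t, ht, s, rfl⟩
    exact hin t ht s
  refine ⟨2 * (C / δ) + 2 * (δ * C), by positivity, fun f hf => ?_⟩
  have cf2 : Continuous fun x => f x ^ 2 := hf.continuous.pow 2
  have cd2 := Frame.continuous_sq_norm_fderiv hf
  have cE := continuous_energyDensity (hf.of_le one_le_two)
  have bound : ∀ ρ : E2 → ℝ, Continuous ρ → (∀ x, 0 ≤ ρ x) → (∀ x, ρ x ≤ energyDensity f x) →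
      ∫ t in (0 : ℝ)..δ, ∫ s in (0 : ℝ)..G.len, ρ (G.Φ t s) ≤
        C * ∫ x in Ω, energyDensity f x := by
    intro ρ hρ h0 hle
    refine (hcmp ρ hρ h0 0 δ le_rfl hδ.le le_rfl).2.trans ?_
    gcongr
    refine (setIntegral_mono_subset (integrableOn_of_isBounded hΩ.isBounded hρ) h0 hreg).trans ?_
    exact setIntegral_mono (integrableOn_of_isBounded hΩ.isBounded hρ)
      (integrableOn_of_isBounded hΩ.isBounded cE) hle
  have b1 := bound _ cf2 (fun x => sq_nonneg _)
    fun x => le_add_of_nonneg_right (sq_nonneg _)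
  have b2 := bound _ cd2 (fun x => sq_nonneg _)
    fun x => le_add_of_nonneg_left (sq_nonneg _)
  have cu2 : Continuous (uncurry fun t s => f (G.Φ t s) ^ 2) := cf2.comp G.continuous_Φ
  obtain ⟨t, ht, hlt⟩ := exists_level_le
    (f := fun t => ∫ s in (0 : ℝ)..G.len, f (G.Φ t s) ^ 2)
    (intervalIntegral.continuous_parametric_intervalIntegral_of_continuous' cu2 0 G.len) hδ.le
  have b3 := G.integral_sq_ju_le hf (left_mem_Icc.2 hδ.le) ht
  have e0 : ∫ s in (0 : ℝ)..G.len, G.ju f 0 s ^ 2 = ∫ s in (0 : ℝ)..B.len, f (B.q s) ^ 2 := by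
    rw [hG.len_eq]
    simp only [Frame.ju, Frame.Φ, zero_smul, add_zero, hG.γ_eq]
  rw [e0, sub_zero] at b3
  set E := ∫ x in Ω, energyDensity f x
  have b4 : ∫ s in (0 : ℝ)..G.len, G.ju f t s ^ 2 ≤ C / δ * E := by
    rw [div_mul_eq_mul_div, le_div_iff₀ hδ]
    rw [sub_zero] at hlt
    exact hlt.trans b1
  calc _ ≤ 2 * (C / δ * E) + 2 * (δ * (C * E)) := b3.trans (by gcongr)
    _ = _ := by ring

end trace

section curve

variable {Ω : Set E2} (Γ : InteriorCurve Ω)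

lemma exists_curve_tube (hΩ : IsPlaneDomain Ω) : ∃ δ > 0, ∀ t, |t| ≤ δ → ∀ s,
    1 / 2 ≤ 1 - (curveFrame Γ).κ s * t ∧ (curveFrame Γ).Φ t s ∈ Ω := by
  obtain ⟨K, hK0, hK⟩ := (curveFrame Γ).exists_curvature_bound
  have hc : IsCompact (range Γ.c) := by
    rw [← Γ.periodic.image_Icc Γ.len_pos 0]
    exact isCompact_Icc.image (curveFrame Γ).continuous_γ
  obtain ⟨η, hη, hsub⟩ := hc.exists_cthickening_subset_open hΩ.isOpen (by
    rintro _ ⟨s, rfl⟩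
    exact Γ.mem s)
  refine ⟨min η (1 / (2 * K)), by positivity, fun t ht s => ⟨?_, hsub ?_⟩⟩
  · have : |(curveFrame Γ).κ s * t| ≤ 1 / 2 := by
      rw [abs_mul]
      calc |(curveFrame Γ).κ s| * |t| ≤ K * (1 / (2 * K)) := by
            gcongr
            · exact hK s
            · exact ht.trans (min_le_right _ _)
        _ = 1 / 2 := by field_simp
    linarith [(abs_le.1 this).2]
  · refine Metric.mem_cthickening_of_dist_le _ (Γ.c s) _ _ (mem_range_self s) ?_
    have : (curveFrame Γ).Φ t s - Γ.c s = t • (curveFrame Γ).n s := add_sub_cancel_left _ _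
    rw [dist_eq_norm, this, norm_smul, Frame.norm_n, mul_one, norm_eq_abs]
    exact ht.trans (min_le_left _ _)

variable {Γ} {B : BoundaryParam Ω} (hB : B.IsSmooth)

include hB in
/-- Exponential control of the normal derivative along the curve controls the whole energy. -/
lemma controlled_domain (hΩ : IsPlaneDomain Ω) {N : (E2 → ℝ) → ℝ} (hN : ∀ φ, 0 ≤ N φ) {C₀ : ℝ}
    (hC₀ : 0 < C₀)
    (h : ∀ lam φ, Eig B lam φ → (curveFrame Γ).cauchyData φ 0 ≤ C₀ * exp (C₀ * lam) * N φ) :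
    Controlled B N Ω := by
  obtain ⟨δ, hδ, htube⟩ := exists_curve_tube Γ hΩ
  have hab : ∀ t ∈ Icc (-δ) 0, |t| ≤ δ := fun t ht => abs_le.2 ⟨ht.1, ht.2.trans hδ.le⟩
  have hbase := (curveFrame Γ).controlled_base hΩ hN (α := -δ) (α' := -δ / 2) (by linarith)
    (by linarith) (fun t ht s => (htube t (hab t ht) s).1) (fun t ht s => (htube t (hab t ht) s).2)
    hC₀ h
  have hm : |-δ / 4| ≤ δ := abs_le.2 ⟨by linarith, by linarith⟩
  obtain ⟨r, hr, hball⟩ := (curveFrame Γ).exists_ball_subset_region (α := -δ / 2) (β := 0)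
    (t := -δ / 4) (s := 0) ⟨by linarith, by linarith⟩
    (by linarith [(htube _ hm 0).1] : 0 < 1 - (curveFrame Γ).κ 0 * (-δ / 4)).ne'
  exact (Controlled.propagates hΩ hN).of_ball hB hΩ (htube _ hm 0).2 hr (hbase.mono hΩ hball)

include hB Γ in
/-- The Poincaré inequality on the domain. -/
lemma exists_poincare (hΩ : IsPlaneDomain Ω) : ∃ C > 0, ∀ f : E2 → ℝ, ContDiff ℝ 2 f →
    ∃ m : ℝ, ∫ x in Ω, (f x - m) ^ 2 ≤ C * ∫ x in Ω, ‖fderiv ℝ f x‖ ^ 2 := by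
  obtain ⟨δ, hδ, htube⟩ := exists_curve_tube Γ hΩ
  have hab : ∀ t ∈ Icc (-δ) 0, |t| ≤ δ := fun t ht => abs_le.2 ⟨ht.1, ht.2.trans hδ.le⟩
  have hreg : (curveFrame Γ).region (-δ) 0 ⊆ Ω := by
    rintro _ ⟨t, ht, s, rfl⟩
    exact (htube t (hab t (Ioc_subset_Icc_self ht)) s).2
  obtain ⟨C₁, hC₁, hpoin⟩ := (curveFrame Γ).exists_poincare (neg_lt_zero.2 hδ)
    (fun t ht s => (htube t (hab t ht) s).1)
  have hm : |-δ / 4| ≤ δ := abs_le.2 ⟨by linarith, by linarith⟩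
  obtain ⟨r, hr, hball⟩ := (curveFrame Γ).exists_ball_subset_region (α := -δ) (β := 0)
    (t := -δ / 4) (s := 0) ⟨by linarith, by linarith⟩
    (by linarith [(htube _ hm 0).1] : 0 < 1 - (curveFrame Γ).κ 0 * (-δ / 4)).ne'
  have hprop := MassBound.propagates hΩ B ((curveFrame Γ).region (-δ) 0)
  obtain ⟨C, hC, hmass⟩ := hprop.of_ball hB hΩ (htube _ hm 0).2 hr
    (hprop.mono _ _ hball (MassBound.self Ω _ hreg))
  refine ⟨C * (C₁ + 1), by positivity, fun f hf => ?_⟩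
  obtain ⟨m, hm⟩ := hpoin f hf
  refine ⟨m, ?_⟩
  have h1 := hmass (fun x => f x - m) (hf.sub contDiff_const)
  simp only [fderiv_sub_const, inter_self] at h1
  have h2 := setIntegral_mono_subset (integrableOn_of_isBounded hΩ.isBounded
    (Frame.continuous_sq_norm_fderiv hf)) (fun _ => sq_nonneg _) hreg
  rw [mul_assoc, add_mul, one_mul]
  refine h1.trans ?_
  gcongr
  exact hm.trans (by gcongr)

end curve

/-- The Lipschitz cutoff vanishing off `Ω` and equal to one at distance `ε` from the complement. -/
def cutoff (Ω : Set E2) (ε : ℝ) (x : E2) : ℝ := min 1 (Metric.infDist x Ωᶜ / ε)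

section cutoff

variable {Ω : Set E2} {ε : ℝ}

lemma lipschitz_cutoff (hε : 0 < ε) : LipschitzWith (Real.toNNReal ε⁻¹) (cutoff Ω ε) := by
  refine LipschitzWith.const_min (LipschitzWith.of_le_add_mul _ fun x y => ?_) _
  rw [Real.coe_toNNReal _ (by positivity), div_eq_inv_mul, div_eq_inv_mul, ← mul_add]
  gcongr
  exact Metric.infDist_le_infDist_add_dist

lemma cutoff_nonneg (hε : 0 < ε) (x : E2) : 0 ≤ cutoff Ω ε x :=
  le_min zero_le_one (div_nonneg Metric.infDist_nonneg hε.le)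

lemma cutoff_le_one (x : E2) : cutoff Ω ε x ≤ 1 := min_le_left _ _

lemma cutoff_of_notMem {x : E2} (hx : x ∉ Ω) : cutoff Ω ε x = 0 := by
  rw [cutoff, Metric.infDist_zero_of_mem (show x ∈ Ωᶜ from hx), zero_div, min_eq_right zero_le_one]

lemma cutoff_of_le (hε : 0 < ε) {x : E2} (hx : ε ≤ Metric.infDist x Ωᶜ) : cutoff Ω ε x = 1 :=
  min_eq_left ((one_le_div hε).2 hx)

lemma fderiv_cutoff_of_notMem (hε : 0 < ε) {x : E2} (hx : x ∉ Ω) :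
    fderiv ℝ (cutoff Ω ε) x = 0 := by
  refine IsLocalMin.fderiv_eq_zero (Eventually.of_forall fun y => ?_)
  rw [cutoff_of_notMem hx]
  exact cutoff_nonneg hε y

lemma fderiv_cutoff_of_le (hε : 0 < ε) {x : E2} (hx : ε ≤ Metric.infDist x Ωᶜ) :
    fderiv ℝ (cutoff Ω ε) x = 0 := by
  refine IsLocalMax.fderiv_eq_zero (Eventually.of_forall fun y => ?_)
  rw [cutoff_of_le hε hx]
  exact cutoff_le_one y

lemma ne_univ_of_isBounded (hΩ : Bornology.IsBounded Ω) : Ω ≠ univ := by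
  rintro rfl
  exact NormedSpace.unbounded_univ ℝ E2 hΩ

/-- Vector fields tangential to the boundary have a bounded pairing with the differential of the
cutoff, uniformly in its width. -/
lemma abs_fderiv_cutoff_le (hΩ : IsPlaneDomain Ω) (B : BoundaryParam Ω) {V : E2 → E2} {L : ℝ}
    (hL : 0 ≤ L) (hV : ∀ x y, ‖V x - V y‖ ≤ L * ‖x - y‖) (hn : ∀ s, ⟪V (B.q s), B.ν s⟫ = 0)
    (hε : 0 < ε) {x : E2} (hd : DifferentiableAt ℝ (cutoff Ω ε) x) :
    |fderiv ℝ (cutoff Ω ε) x (V x)| ≤ L := by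
  by_cases hx : x ∈ Ω
  swap
  · rw [fderiv_cutoff_of_notMem hε hx]; simpa
  rcases le_total ε (Metric.infDist x Ωᶜ) with hle | hle
  · rw [fderiv_cutoff_of_le hε hle]; simpa
  obtain ⟨y, hy, hxy⟩ := exists_mem_frontier_infDist_compl_eq_dist hx
    (ne_univ_of_isBounded hΩ.isBounded)
  have hyx : x - y ≠ 0 := by
    intro h0
    rw [hΩ.isOpen.frontier_eq, ← sub_eq_zero.1 h0] at hy
    exact hy.2 hx
  obtain ⟨s, rfl⟩ : y ∈ range B.q := by rwa [B.range_eq]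
  obtain ⟨a, ha⟩ : ∃ a : ℝ, V (B.q s) = a • B.qd s := by
    have h0 : ⟪V (B.q s), rot (B.qd s)⟫ = 0 := by
      have := hn s
      rcases eq_rot_or_eq_neg_rot (B.unitSpeed s) (B.ν_unit s) (B.ν_orth s) with h | h
      · rwa [h] at this
      · rwa [h, inner_neg_right, neg_eq_zero] at this
    have h1 := eq_inner_smul_rot (by rw [norm_rot, B.unitSpeed]) h0
    rw [rot_rot, smul_neg, ← neg_smul] at h1
    exact ⟨_, h1⟩
  have hzero : fderiv ℝ (cutoff Ω ε) x (V (B.q s)) = 0 := by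
    set v := V (B.q s)
    have hq : HasDerivAt (fun h : ℝ => B.q (s + a * h)) v 0 := by
      have h1 : HasDerivAt (fun h : ℝ => s + a * h) a 0 := by
        simpa using ((hasDerivAt_id (0 : ℝ)).const_mul a).const_add s
      have h2 := HasDerivAt.scomp (h := fun h : ℝ => s + a * h) (0 : ℝ)
        (by simpa using B.hasDerivAt (s + a * 0)) h1
      rw [ha]
      exact h2
    have hw : HasDerivAt (fun h : ℝ => x + h • v - B.q (s + a * h)) 0 0 := by
      have h1 : HasDerivAt (fun h : ℝ => x + h • v) v 0 := by
        simpa using ((hasDerivAt_id (0 : ℝ)).smul_const v).const_add x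
      exact (h1.sub hq).congr_deriv (sub_self v)
    have hw0 : x + (0 : ℝ) • v - B.q (s + a * 0) = x - B.q s := by simp
    have hN : HasDerivAt (fun h : ℝ => ‖x + h • v - B.q (s + a * h)‖) 0 0 := by
      have h1 : DifferentiableAt ℝ (fun w : E2 => ‖w‖) (x + (0 : ℝ) • v - B.q (s + a * 0)) := by
        rw [hw0]
        exact (contDiffAt_norm ℝ hyx).differentiableAt one_ne_zero
      exact (h1.hasFDerivAt.comp_hasDerivAt (0 : ℝ) hw).congr_deriv (map_zero _)
    have hχ : HasDerivAt (fun h : ℝ => cutoff Ω ε (x + h • v)) (fderiv ℝ (cutoff Ω ε) x v) 0 :=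
      hd.hasFDerivAt.hasLineDerivAt v
    have hmin : IsLocalMin (fun h : ℝ => ‖x + h • v - B.q (s + a * h)‖ / ε -
        cutoff Ω ε (x + h • v)) 0 := by
      refine Eventually.of_forall fun h => ?_
      simp only
      rw [hw0, zero_smul, add_zero, cutoff, min_eq_right ((div_le_one hε).2 hle), hxy,
        dist_eq_norm, sub_self, sub_nonneg]
      refine (min_le_right _ _).trans ?_
      gcongr
      rw [← dist_eq_norm]
      refine Metric.infDist_le_dist_of_mem ?_
      have : B.q (s + a * h) ∈ frontier Ω := by rw [← B.range_eq]; exact mem_range_self _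
      rw [hΩ.isOpen.frontier_eq] at this
      exact this.2
    have := hmin.hasDerivAt_eq_zero ((hN.div_const ε).sub hχ)
    rw [zero_div, zero_sub, neg_eq_zero] at this
    exact this
  have hle' : ‖x - B.q s‖ ≤ ε := by rw [← dist_eq_norm, ← hxy]; exact hle
  calc |fderiv ℝ (cutoff Ω ε) x (V x)| = ‖fderiv ℝ (cutoff Ω ε) x (V x - V (B.q s))‖ := by
        rw [map_sub, hzero, sub_zero, norm_eq_abs]
    _ ≤ ε⁻¹ * (L * ε) := by
        refine ContinuousLinearMap.le_of_opNorm_le_of_le _ ?_ ((hV _ _).trans (by gcongr))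
        have := norm_fderiv_le_of_lipschitz ℝ (x₀ := x) (lipschitz_cutoff (Ω := Ω) hε)
        rwa [Real.coe_toNNReal _ (by positivity)] at this
    _ = L := by field_simp

end cutoff

/-- The divergence theorem for fields tangential to the boundary. -/
lemma integral_div_eq_zero {Ω : Set E2} (hΩ : IsPlaneDomain Ω) (B : BoundaryParam Ω) {V : E2 → E2}
    (hV : ContDiff ℝ 1 V) (hVc : HasCompactSupport V) (hn : ∀ s, ⟪V (B.q s), B.ν s⟫ = 0) :
    ∫ x in Ω, ∑ i : Fin 2, fderiv ℝ (fun y => V y i) x (EuclideanSpace.single i 1) = 0 := by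
  have hVi : ∀ i : Fin 2, ContDiff ℝ 1 fun y => V y i := fun i => by fun_prop
  have hVic : ∀ i : Fin 2, HasCompactSupport fun y => V y i := fun i =>
    hVc.comp_left (g := fun v : E2 => v i) rfl
  obtain ⟨L, hL⟩ := hV.lipschitzWith_of_hasCompactSupport hVc one_ne_zero
  have hL' : ∀ x y, ‖V x - V y‖ ≤ L * ‖x - y‖ := fun x y => hL.norm_sub_le x y
  set e : Fin 2 → E2 := fun i => EuclideanSpace.single i 1
  set D : E2 → ℝ := fun x => ∑ i : Fin 2, fderiv ℝ (fun y => V y i) x (e i) with hD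
  have cD : Continuous D := continuous_finsetSum _ fun i _ =>
    ((hVi i).continuous_fderiv one_ne_zero).clm_apply continuous_const
  have hsum : ∀ v : E2, v = ∑ i : Fin 2, v i • e i := fun v => by
    ext j; fin_cases j <;> simp [e]
  set ε : ℕ → ℝ := fun k => 1 / ((k : ℝ) + 1)
  have hε : ∀ k, 0 < ε k := fun k => by positivity
  have hε0 : Tendsto ε atTop (𝓝 0) := tendsto_one_div_add_atTop_nhds_zero_nat
  set g : ℕ → E2 → ℝ := fun k x => ∑ i : Fin 2, lineDeriv ℝ (cutoff Ω (ε k)) x (-e i) * V x i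
  have hparts : ∀ k, ∫ x in Ω, cutoff Ω (ε k) x * D x = ∫ x, g k x := by
    intro k
    have hlip := lipschitz_cutoff (Ω := Ω) (hε k)
    rw [setIntegral_eq_integral_of_forall_compl_eq_zero fun x hx => by
      rw [cutoff_of_notMem hx, zero_mul]]
    rw [integral_finsetSum]
    swap
    · intro i _
      exact ((hVi i).continuous.integrable_of_hasCompactSupport (hVic i)).bdd_mul
        (measurable_lineDeriv hlip.continuous).aestronglyMeasurable
        (ae_of_all _ fun x => norm_lineDeriv_le_of_lipschitz ℝ hlip)
    have h1 : ∀ i, ∫ x, lineDeriv ℝ (cutoff Ω (ε k)) x (-e i) * V x i =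
        ∫ x, fderiv ℝ (fun y => V y i) x (e i) * cutoff Ω (ε k) x := fun i => by
      obtain ⟨K, hK⟩ := (hVi i).lipschitzWith_of_hasCompactSupport (hVic i) one_ne_zero
      have := hlip.integral_lineDeriv_mul_eq (μ := volume) hK (hVic i) (-e i)
      rw [this, neg_neg]
      simp only [((hVi i).differentiable one_ne_zero _).lineDeriv_eq_fderiv]
    simp only [h1]
    rw [← integral_finsetSum]
    · congr 1 with x
      rw [hD, Finset.mul_sum]
      simp only [mul_comm]
    · intro i _
      refine Continuous.integrable_of_hasCompactSupport ?_ ?_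
      · exact (((hVi i).continuous_fderiv one_ne_zero).clm_apply continuous_const).mul
          hlip.continuous
      · exact ((hVic i).fderiv_apply (𝕜 := ℝ) (e i)).mul_right
  have hdiff : ∀ᵐ x : E2, ∀ k, DifferentiableAt ℝ (cutoff Ω (ε k)) x :=
    ae_all_iff.2 fun k => (lipschitz_cutoff (hε k)).ae_differentiableAt
  have hg : ∀ x, (∀ k, DifferentiableAt ℝ (cutoff Ω (ε k)) x) → ∀ k,
      g k x = -fderiv ℝ (cutoff Ω (ε k)) x (V x) := by
    intro x hx k
    conv_rhs => rw [hsum (V x), map_sum, ← Finset.sum_neg_distrib]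
    refine Finset.sum_congr rfl fun i _ => ?_
    rw [(hx k).lineDeriv_eq_fderiv, map_neg, map_smul, smul_eq_mul, neg_mul, mul_comm]
  have hpos : ∀ x ∈ Ω, ∀ᶠ k in atTop, ε k ≤ Metric.infDist x Ωᶜ := fun x hx => by
    have : 0 < Metric.infDist x Ωᶜ :=
      (hΩ.isOpen.isClosed_compl.notMem_iff_infDist_pos
        (nonempty_compl.2 (ne_univ_of_isBounded hΩ.isBounded))).1 fun h => h hx
    exact (hε0.eventually (gt_mem_nhds this)).mono fun _ => le_of_lt
  have lim1 : Tendsto (fun k => ∫ x in Ω, cutoff Ω (ε k) x * D x) atTop (𝓝 (∫ x in Ω, D x)) := by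
    refine tendsto_integral_of_dominated_convergence (fun x => |D x|)
      (fun k => ((lipschitz_cutoff (hε k)).continuous.mul cD).aestronglyMeasurable)
      (integrableOn_of_isBounded hΩ.isBounded cD.abs) (fun k => ae_of_all _ fun x => ?_) ?_
    · rw [norm_mul, norm_eq_abs, norm_eq_abs, abs_of_nonneg (cutoff_nonneg (hε k) x)]
      exact mul_le_of_le_one_left (abs_nonneg _) (cutoff_le_one x)
    · rw [ae_restrict_iff' hΩ.isOpen.measurableSet]
      refine ae_of_all _ fun x hx => tendsto_const_nhds.congr' ?_
      filter_upwards [hpos x hx] with k hk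
      rw [cutoff_of_le (hε k) hk, one_mul]
  have lim2 : Tendsto (fun k => ∫ x, g k x) atTop (𝓝 (∫ _ : E2, (0 : ℝ))) := by
    refine tendsto_integral_of_dominated_convergence (Ω.indicator fun _ => (L : ℝ))
      (fun k => (Finset.measurable_sum _ fun i _ =>
        (measurable_lineDeriv (lipschitz_cutoff (hε k)).continuous).mul
          (hVi i).continuous.measurable).aestronglyMeasurable)
      ((integrableOn_of_isBounded hΩ.isBounded continuous_const).integrable_indicator
        hΩ.isOpen.measurableSet) (fun k => ?_) ?_
    · filter_upwards [hdiff] with x hx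
      rw [hg x hx, norm_neg]
      by_cases hxΩ : x ∈ Ω
      · rw [indicator_of_mem hxΩ]
        exact abs_fderiv_cutoff_le hΩ B L.2 hL' hn (hε k) (hx k)
      · rw [indicator_of_notMem hxΩ, fderiv_cutoff_of_notMem (hε k) hxΩ]
        simp
    · filter_upwards [hdiff] with x hx
      refine tendsto_const_nhds.congr' ?_
      by_cases hxΩ : x ∈ Ω
      · filter_upwards [hpos x hxΩ] with k hk
        rw [hg x hx, fderiv_cutoff_of_le (hε k) hk]
        simp
      · refine Eventually.of_forall fun k => ?_
        change 0 = g k x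
        rw [hg x hx, fderiv_cutoff_of_notMem (hε k) hxΩ]
        simp
  rw [integral_zero] at lim2
  exact tendsto_nhds_unique (lim1.congr hparts) lim2

section green

variable {Ω : Set E2} {B : BoundaryParam Ω} {lam : ℝ} {φ : E2 → ℝ}

lemma gradient_apply (φ : E2 → ℝ) (x : E2) (i : Fin 2) :
    gradient φ x i = fderiv ℝ φ x (EuclideanSpace.single i 1) := by
  rw [← inner_gradient, EuclideanSpace.inner_single_right]
  simp

lemma sum_sq_fderiv (φ : E2 → ℝ) (x : E2) :
    ∑ i : Fin 2, fderiv ℝ φ x (EuclideanSpace.single i 1) ^ 2 = ‖fderiv ℝ φ x‖ ^ 2 := by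
  rw [Fin.sum_univ_two]
  exact sq_norm_dual_orthonormal (by simp) (by simp) (by simp [PiLp.inner_apply]) _

/-- Green's first identity. -/
lemma Eig.green (h : Eig B lam φ) (hφc : HasCompactSupport φ) (hΩ : IsPlaneDomain Ω) {u : E2 → ℝ}
    (hu : ContDiff ℝ 1 u) :
    ∫ x in Ω, (u x * (-lam ^ 2 * φ x) + ∑ i : Fin 2, fderiv ℝ u x (EuclideanSpace.single i 1) *
      fderiv ℝ φ x (EuclideanSpace.single i 1)) = 0 := by
  have hd : ContDiff ℝ 1 (fderiv ℝ φ) := h.smooth.fderiv_right (by norm_num)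
  have hg : ContDiff ℝ 1 (gradient φ) :=
    (InnerProductSpace.toDual ℝ E2).symm.toContinuousLinearEquiv.contDiff.comp hd
  have hgc : HasCompactSupport (gradient φ) :=
    (hφc.fderiv ℝ).comp_left (g := (InnerProductSpace.toDual ℝ E2).symm) (map_zero _)
  rw [← integral_div_eq_zero hΩ B (hu.smul hg) (hgc.smul_left (f := u)) (fun s => by
    rw [Pi.smul_apply', real_inner_smul_left, h.isEigenfunction.neumann, mul_zero])]
  refine setIntegral_congr_fun hΩ.isOpen.measurableSet fun x hx => ?_
  have hdi : ∀ i : Fin 2, DifferentiableAt ℝ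
      (fun y => fderiv ℝ φ y (EuclideanSpace.single i 1)) x := fun i =>
    (hd.differentiable one_ne_zero x).clm_apply (differentiableAt_const _)
  have e : ∀ i : Fin 2, (fun y => (u • gradient φ) y i) =
      fun y => u y * fderiv ℝ φ y (EuclideanSpace.single i 1) := fun i => by
    ext y
    rw [Pi.smul_apply', PiLp.smul_apply, gradient_apply, smul_eq_mul]
  simp only [e]
  rw [← h.eigen x hx, lap, Finset.mul_sum, ← Finset.sum_add_distrib]
  refine Finset.sum_congr rfl fun i _ => ?_
  rw [fderiv_fun_mul (hu.differentiable one_ne_zero x) (hdi i)]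
  simp [mul_comm]

lemma Eig.integral_eq_zero (h : Eig B lam φ) (hφc : HasCompactSupport φ) (hΩ : IsPlaneDomain Ω) :
    ∫ x in Ω, φ x = 0 := by
  have := h.green hφc hΩ (contDiff_const (c := (1 : ℝ)))
  simp only [fderiv_fun_const, Pi.zero_apply, zero_apply, zero_mul,
    Finset.sum_const_zero, add_zero, one_mul, integral_const_mul] at this
  exact (mul_eq_zero.1 this).resolve_left (neg_ne_zero.2 (pow_ne_zero 2 h.pos.ne'))

lemma Eig.dirichlet_eq (h : Eig B lam φ) (hφc : HasCompactSupport φ) (hΩ : IsPlaneDomain Ω) :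
    ∫ x in Ω, ‖fderiv ℝ φ x‖ ^ 2 = lam ^ 2 * ∫ x in Ω, φ x ^ 2 := by
  have := h.green hφc hΩ (h.smooth.of_le one_le_two)
  simp only [← sq, sum_sq_fderiv] at this
  have e : ∀ x, φ x * (-lam ^ 2 * φ x) = -lam ^ 2 * φ x ^ 2 := fun x => by ring
  simp only [e] at this
  have c2 : Continuous fun x => φ x ^ 2 := h.smooth.continuous.pow 2
  rw [integral_add ((integrableOn_of_isBounded hΩ.isBounded c2).const_mul _)
    (integrableOn_of_isBounded hΩ.isBounded (Frame.continuous_sq_norm_fderiv h.smooth)),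
    integral_const_mul] at this
  linarith

lemma Eig.integral_sq_pos (h : Eig B lam φ) (hΩ : IsPlaneDomain Ω) : 0 < ∫ x in Ω, φ x ^ 2 := by
  refine (integral_nonneg fun _ => sq_nonneg _).lt_of_ne' fun h0 => ?_
  obtain ⟨x, hx, hne⟩ := h.isEigenfunction.nontrivial
  have c2 : Continuous fun x => φ x ^ 2 := h.smooth.continuous.pow 2
  rw [integral_eq_zero_iff_of_nonneg (fun _ => sq_nonneg _)
    (integrableOn_of_isBounded hΩ.isBounded c2)] at h0
  have := Measure.eqOn_open_of_ae_eq h0 hΩ.isOpen c2.continuousOn continuousOn_const hx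
  exact hne (pow_eq_zero_iff two_ne_zero |>.1 this)

/-- The frequencies of the domain are bounded below by a positive constant. -/
lemma exists_frequency_bound (hB : B.IsSmooth) (Γ : InteriorCurve Ω) (hΩ : IsPlaneDomain Ω) :
    ∃ l > 0, ∀ lam φ, Eig B lam φ → HasCompactSupport φ → l ≤ lam := by
  obtain ⟨C, hC, hpoin⟩ := exists_poincare (Γ := Γ) hB hΩ
  refine ⟨min 1 (1 / C), by positivity, fun lam φ h hφc => ?_⟩
  obtain ⟨m, hm⟩ := hpoin φ h.smooth
  have c1 := h.smooth.continuous
  have i1 := integrableOn_of_isBounded hΩ.isBounded c1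
  have i2 : IntegrableOn (fun x => φ x ^ 2) Ω :=
    integrableOn_of_isBounded hΩ.isBounded (c1.pow 2)
  have ic : ∀ a : ℝ, IntegrableOn (fun _ : E2 => a) Ω := fun a =>
    integrableOn_of_isBounded hΩ.isBounded continuous_const
  have hexp : ∫ x in Ω, (φ x - m) ^ 2 = (∫ x in Ω, φ x ^ 2) + ∫ x in Ω, m ^ 2 := by
    have e : ∀ x, (φ x - m) ^ 2 = φ x ^ 2 + m ^ 2 - 2 * m * φ x := fun x => by ring
    have i3 : IntegrableOn (fun x => φ x ^ 2 + m ^ 2) Ω := i2.add (ic _)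
    simp only [e]
    rw [integral_sub i3 (i1.const_mul _), integral_add i2 (ic _), integral_const_mul,
      h.integral_eq_zero hφc hΩ, mul_zero, sub_zero]
  have hm0 : 0 ≤ ∫ x in Ω, m ^ 2 := integral_nonneg fun _ => sq_nonneg _
  rw [hexp, h.dirichlet_eq hφc hΩ] at hm
  have hpos := h.integral_sq_pos hΩ
  have h1 : 1 ≤ C * lam ^ 2 := by
    refine le_of_mul_le_mul_right ?_ hpos
    linarith
  by_contra! hlt
  have h2 : lam < 1 := hlt.trans_le (min_le_left _ _)
  have h3 : C * lam < 1 := by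
    have := hlt.trans_le (min_le_right _ _)
    rwa [lt_div_iff₀ hC, mul_comm] at this
  have : C * lam ^ 2 ≤ C * lam := by
    gcongr
    exact pow_le_of_le_one h.pos.le h2.le two_ne_zero
  linarith

end green

section reduction

variable {Ω : Set E2} {B : BoundaryParam Ω}

lemma exists_contDiff_cutoff {K U : Set E2} (hK : IsCompact K) (hU : IsOpen U) (hKU : K ⊆ U) :
    ∃ χ : E2 → ℝ, ContDiff ℝ (⊤ : ℕ∞) χ ∧ HasCompactSupport χ ∧ tsupport χ ⊆ U ∧
      ∀ x ∈ K, χ =ᶠ[𝓝 x] 1 := by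
  obtain ⟨K', hK', hKK', hK'U⟩ := exists_compact_between hK hU hKU
  obtain ⟨χ, h1, h0, -⟩ := exists_contMDiffMap_one_nhds_of_subset_interior (n := (⊤ : ℕ∞))
    (modelWithCornersSelf ℝ E2) hK.isClosed hKK'
  have hsupp : tsupport χ ⊆ K' := by
    refine closure_minimal (fun x hx => ?_) hK'.isClosed
    by_contra hn
    exact hx (h0 x hn)
  exact ⟨χ, χ.contMDiff.contDiff, hK'.of_isClosed_subset (isClosed_tsupport _) hsupp,
    hsupp.trans hK'U, fun x hx => h1.filter_mono (nhds_le_nhdsSet hx)⟩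

/-- Every Neumann eigenfunction has a globally smooth extension of compact support. -/
lemma IsNeumannEigenfunction.exists_eig {lam : ℝ} {φ : E2 → ℝ}
    (h : IsNeumannEigenfunction B lam φ) (hlam : 0 < lam) (hΩ : IsPlaneDomain Ω) :
    ∃ ψ, Eig B lam ψ ∧ HasCompactSupport ψ ∧ ∀ x ∈ closure Ω, ψ x = φ x := by
  obtain ⟨U, hU, hΩU, hφ⟩ := h.smooth
  obtain ⟨χ, hχ, hχc, hχU, hχ1⟩ := exists_contDiff_cutoff hΩ.isBounded.isCompact_closure hU hΩU
  set ψ : E2 → ℝ := fun x => χ x * φ x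
  have heq : ∀ x ∈ closure Ω, ψ =ᶠ[𝓝 x] φ := fun x hx => by
    filter_upwards [hχ1 x hx] with y hy
    simp [ψ, hy]
  have hψ : ContDiff ℝ (⊤ : ℕ∞) ψ := by
    rw [contDiff_iff_contDiffAt]
    intro x
    by_cases hx : x ∈ tsupport χ
    · exact hχ.contDiffAt.mul (hφ.contDiffAt (hU.mem_nhds (hχU hx)))
    · refine ContDiffAt.congr_of_eventuallyEq (f := fun _ => (0 : ℝ)) contDiffAt_const ?_
      filter_upwards [notMem_tsupport_iff_eventuallyEq.1 hx] with y hy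
      simp [ψ, hy]
  have hval : ∀ x ∈ closure Ω, ψ x = φ x := fun x hx => (heq x hx).self_of_nhds
  refine ⟨ψ, ⟨hlam, hψ, ⟨univ, isOpen_univ, subset_univ _, hψ.contDiffOn⟩, ?_, ?_, ?_⟩,
    hχc.mul_right, hval⟩
  · obtain ⟨x, hx, hne⟩ := h.nontrivial
    exact ⟨x, hx, by rwa [hval x (subset_closure hx)]⟩
  · intro x hx
    rw [hval x (subset_closure hx), ← h.eigen x hx]
    refine Finset.sum_congr rfl fun i _ => ?_
    have : (fun y => fderiv ℝ ψ y (EuclideanSpace.single i 1)) =ᶠ[𝓝 x]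
        fun y => fderiv ℝ φ y (EuclideanSpace.single i 1) := by
      filter_upwards [(heq x (subset_closure hx)).fderiv (𝕜 := ℝ)] with y hy
      rw [hy]
    rw [this.fderiv_eq]
  · intro s
    have hs : B.q s ∈ closure Ω :=
      frontier_subset_closure (by rw [← B.range_eq]; exact mem_range_self s)
    rw [gradient, (heq _ hs).fderiv_eq]
    exact h.neumann s

lemma curveFrame_cauchyData (Γ : InteriorCurve Ω) {φ : E2 → ℝ} (hφ : ContDiff ℝ 2 φ) :
    (curveFrame Γ).cauchyData φ 0 = (∫ s in (0 : ℝ)..Γ.len, φ (Γ.c s) ^ 2) +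
      ∫ s in (0 : ℝ)..Γ.len, ⟪gradient φ (Γ.c s), Γ.n s⟫ ^ 2 := by
  have S := (curveFrame Γ).stripJet hφ
  have eu : ∀ s, (curveFrame Γ).ju φ 0 s = φ (Γ.c s) := fun s => by
    simp [Frame.ju, Frame.Φ, curveFrame]
  have eb : ∀ s, (curveFrame Γ).jb φ 0 s ^ 2 = ⟪gradient φ (Γ.c s), Γ.n s⟫ ^ 2 := fun s => by
    rw [inner_gradient]
    rcases eq_rot_or_eq_neg_rot (Γ.unitSpeed s) (Γ.n_unit s) (Γ.n_orth s) with h | h <;>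
      simp [Frame.jb, Frame.Φ, curveFrame, h]
  have i1 : IntervalIntegrable (fun s => (curveFrame Γ).ju φ 0 s ^ 2) volume 0 Γ.len :=
    ((continuous_section S.contu 0).pow 2).intervalIntegrable _ _
  have i2 : IntervalIntegrable (fun s => (curveFrame Γ).jb φ 0 s ^ 2) volume 0 Γ.len :=
    ((continuous_section S.contb 0).pow 2).intervalIntegrable _ _
  change ∫ s in (0 : ℝ)..Γ.len, _ = _
  rw [intervalIntegral.integral_add i1 i2]
  simp only [eu, eb]

end reduction

end NeumannCauchy

/-- If the normal derivative of every Neumann eigenfunction along the interior curve is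
exponentially controlled by its restriction to the curve, then the curve is good. -/
theorem good_curve_from_cauchy_data_bound
    (Ω : Set E2) (hΩ : IsPlaneDomain Ω) (B : BoundaryParam Ω) (hB : B.IsSmooth)
    (Γ : InteriorCurve Ω)
    (hyp : ∃ c₀ > (0 : ℝ), ∀ lam : ℝ, 0 < lam → ∀ φ : E2 → ℝ,
      IsNeumannEigenfunction B lam φ →
      Real.sqrt (∫ s in (0 : ℝ)..Γ.len, (⟪gradient φ (Γ.c s), Γ.n s⟫ : ℝ) ^ 2) ≤
        Real.exp (c₀ * lam) * Real.sqrt (∫ s in (0 : ℝ)..Γ.len, (φ (Γ.c s)) ^ 2)) :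
    ∃ a > (0 : ℝ), ∀ lam : ℝ, 0 < lam → ∀ φ : E2 → ℝ,
      IsNeumannEigenfunction B lam φ →
      (∫ s in (0 : ℝ)..B.len, (φ (B.q s)) ^ 2) ≤
        Real.exp (2 * a * lam) * ∫ s in (0 : ℝ)..Γ.len, (φ (Γ.c s)) ^ 2 := by
  obtain ⟨c₀, hc₀, hyp⟩ := hyp
  set N : (E2 → ℝ) → ℝ := fun φ => ∫ s in (0 : ℝ)..Γ.len, φ (Γ.c s) ^ 2 with hN
  have hN0 : ∀ φ, 0 ≤ N φ := fun φ =>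
    intervalIntegral.integral_nonneg Γ.len_pos.le fun _ _ => sq_nonneg _
  have hcauchy : ∀ lam φ, NeumannCauchy.Eig B lam φ →
      (NeumannCauchy.curveFrame Γ).cauchyData φ 0 ≤
        (2 * c₀ + 2) * exp ((2 * c₀ + 2) * lam) * N φ := fun lam φ h => by
    have hb := hyp lam h.pos φ h.isEigenfunction
    have hD : 0 ≤ ∫ s in (0 : ℝ)..Γ.len, ⟪gradient φ (Γ.c s), Γ.n s⟫ ^ 2 :=
      intervalIntegral.integral_nonneg Γ.len_pos.le fun _ _ => sq_nonneg _
    have hsq := pow_le_pow_left₀ (Real.sqrt_nonneg _) hb 2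
    rw [Real.sq_sqrt hD, mul_pow, Real.sq_sqrt (hN0 φ), ← Real.exp_nat_mul] at hsq
    rw [NeumannCauchy.curveFrame_cauchyData Γ h.smooth]
    have h1 : exp (((2 : ℕ) : ℝ) * (c₀ * lam)) ≤ exp ((2 * c₀ + 2) * lam) := by
      refine exp_le_exp.2 ?_
      push_cast
      linarith [h.pos]
    have h2 : 1 ≤ exp ((2 * c₀ + 2) * lam) :=
      one_le_exp (mul_nonneg (by linarith) h.pos.le)
    have h3 := mul_le_mul_of_nonneg_right h1 (hN0 φ)
    have h4 := mul_le_mul_of_nonneg_right h2 (hN0 φ)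
    have h5 : 0 ≤ 2 * c₀ * (exp ((2 * c₀ + 2) * lam) * N φ) :=
      mul_nonneg (by linarith) (mul_nonneg (exp_pos _).le (hN0 φ))
    change N φ + _ ≤ _
    linarith
  obtain ⟨C, hC, c, hc, hctrl⟩ := NeumannCauchy.controlled_domain (Γ := Γ) hB hΩ hN0
    (by linarith) hcauchy
  obtain ⟨l, hl, hlam⟩ := NeumannCauchy.exists_frequency_bound hB Γ hΩ
  obtain ⟨T, hT, htrace⟩ := NeumannCauchy.exists_trace hB hΩ
  set C' := C + 2 * C / c with hC'
  have hC'0 : 0 < C' := by positivity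
  set M := T * (2 * C) * exp (C * C') with hM
  have hM0 : 0 < M := by positivity
  refine ⟨(M / l + C * C') / 2, by positivity, fun lam hpos φ hφ => ?_⟩
  obtain ⟨ψ, hψ, hψc, hval⟩ := NeumannCauchy.IsNeumannEigenfunction.exists_eig hφ hpos hΩ
  have hq : ∀ s, φ (B.q s) = ψ (B.q s) := fun s => (hval _ (frontier_subset_closure
    (by rw [← B.range_eq]; exact Set.mem_range_self s))).symm
  have hcv : ∀ s, φ (Γ.c s) = ψ (Γ.c s) := fun s => (hval _ (subset_closure (Γ.mem s))).symm
  have hNψ : N φ = N ψ := by simp only [hN, hcv]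
  change _ ≤ _ * N φ
  rw [hNψ]
  simp only [hq]
  have hE := hctrl lam ψ hψ (C' * (1 + lam)) (by
    refine mul_le_mul_of_nonneg_right ?_ (by linarith)
    have : 0 ≤ 2 * C / c := by positivity
    linarith)
  rw [Set.inter_self] at hE
  set E := ∫ x in Ω, NeumannCauchy.energyDensity ψ x
  have hE0 : 0 ≤ E := MeasureTheory.integral_nonneg fun x =>
    NeumannCauchy.energyDensity_nonneg ψ x
  have habs : C * exp (-(c * (C' * (1 + lam)))) ≤ 1 / 2 := by
    have h1 : 2 * C ≤ c * (C' * (1 + lam)) := by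
      have h2 : c * C' = c * C + 2 * C := by rw [hC']; field_simp
      have h3 : 0 ≤ c * C' * lam := by positivity
      have h4 : 0 < c * C := by positivity
      linarith
    rw [exp_neg, ← div_eq_mul_inv, div_le_iff₀ (exp_pos _)]
    linarith [add_one_le_exp (c * (C' * (1 + lam)))]
  have hE2 : E ≤ 2 * C * exp (C * (C' * (1 + lam))) * N ψ := by
    have := mul_le_mul_of_nonneg_right habs hE0
    linarith
  calc ∫ s in (0 : ℝ)..B.len, ψ (B.q s) ^ 2 ≤ T * E := htrace ψ hψ.smooth
    _ ≤ T * (2 * C * exp (C * (C' * (1 + lam))) * N ψ) := by gcongr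
    _ = M * exp (C * C' * lam) * N ψ := by
      rw [hM, show C * (C' * (1 + lam)) = C * C' + C * C' * lam by ring, exp_add]
      ring
    _ ≤ exp (M / l * lam) * exp (C * C' * lam) * N ψ := by
      gcongr
      · exact hN0 ψ
      have h1 : M ≤ M / l * lam := by
        rw [div_mul_eq_mul_div, le_div_iff₀ hl]
        gcongr
        exact hlam lam ψ hψ hψc
      linarith [add_one_le_exp (M / l * lam)]
    _ = exp (2 * ((M / l + C * C') / 2) * lam) * N ψ := by
      rw [← exp_add]
      congr 2
      ring
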